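/- Let x_i < x_{i+1}, T > 0, Q_i = (x_i, x_{i+1}) × (0,T], and let u₀ be continuous on [x_i, x_{i+1}] with u₀ > 0 on (x_i, x_{i+1}) and u₀(x_i) = u₀(x_{i+1}) = 0. Then for every n ∈ ℕ the problem u_t = u(u_xx + 1 − u) in Q_i, u(x_i,t) = u(x_{i+1},t) = 1/n for t ∈ (0,T], u(x,0) = u₀(x) + 1/n, has a unique solution u_{i,n} ∈ C(Q̄_i) ∩ C^{2,1}([x_i, x_{i+1}] × (0,T]); the sequence u_{i,n} is pointwise decreasing in n; and its pointwise limit u_i is the unique function in C(Q̄_i) ∩ C^{2,1}(Q_i) which is positive in Q_i and solves u_t = u u_xx + u(1 − u) in Q_i with u(x_i,t) = u(x_{i+1},t) = 0 for t ∈ (0,T] and u(·,0) = u₀. -/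

import Mathlib

open Set Filter Topology MeasureTheory

/-- `Q_i = (x_i, x_{i+1}) × (0,T]`. -/
def QiSet (xi xip T : ℝ) : Set (ℝ × ℝ) := Set.Ioo xi xip ×ˢ Set.Ioc 0 T

/-- A solution of the approximating problem (8.45):
`u ∈ C(Q̄_i) ∩ C^{2,1}([x_i,x_{i+1}] × (0,T])` with `u_t = u(u_xx + 1 - u)` in `Q_i`,
boundary values `c` and initial datum `f`. -/
def IsApproxSol (xi xip T c : ℝ) (f : ℝ → ℝ) (u : ℝ → ℝ → ℝ) : Prop :=
  ContinuousOn (fun p : ℝ × ℝ => u p.1 p.2) (Set.Icc xi xip ×ˢ Set.Icc 0 T) ∧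
  (∀ t ∈ Set.Ioc (0:ℝ) T, u xi t = c ∧ u xip t = c) ∧
  (∀ x ∈ Set.Icc xi xip, u x 0 = f x) ∧
  ∃ v1 v2 vt : ℝ → ℝ → ℝ,
    ContinuousOn (fun p : ℝ × ℝ => v1 p.1 p.2) (Set.Icc xi xip ×ˢ Set.Ioc 0 T) ∧
    ContinuousOn (fun p : ℝ × ℝ => v2 p.1 p.2) (Set.Icc xi xip ×ˢ Set.Ioc 0 T) ∧
    ContinuousOn (fun p : ℝ × ℝ => vt p.1 p.2) (Set.Icc xi xip ×ˢ Set.Ioc 0 T) ∧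
    (∀ x ∈ Set.Icc xi xip, ∀ t ∈ Set.Ioc (0:ℝ) T,
      HasDerivWithinAt (fun y => u y t) (v1 x t) (Set.Icc xi xip) x ∧
      HasDerivWithinAt (fun y => v1 y t) (v2 x t) (Set.Icc xi xip) x ∧
      HasDerivWithinAt (fun s => u x s) (vt x t) (Set.Iic T) t) ∧
    (∀ x ∈ Set.Ioo xi xip, ∀ t ∈ Set.Ioc (0:ℝ) T,
      vt x t = u x t * (v2 x t + 1 - u x t))

/-- A positive classical solution of the degenerate problem (8.44):
`u ∈ C(Q̄_i) ∩ C^{2,1}(Q_i)`, positive in `Q_i`, with `u_t = u u_xx + u(1-u)` in `Q_i`,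
zero boundary values and initial datum `f`. -/
def IsDegSol (xi xip T : ℝ) (f : ℝ → ℝ) (u : ℝ → ℝ → ℝ) : Prop :=
  ContinuousOn (fun p : ℝ × ℝ => u p.1 p.2) (Set.Icc xi xip ×ˢ Set.Icc 0 T) ∧
  (∀ t ∈ Set.Ioc (0:ℝ) T, u xi t = 0 ∧ u xip t = 0) ∧
  (∀ x ∈ Set.Icc xi xip, u x 0 = f x) ∧
  (∀ x ∈ Set.Ioo xi xip, ∀ t ∈ Set.Ioc (0:ℝ) T, 0 < u x t) ∧
  (∀ x ∈ Set.Ioo xi xip, ∀ t ∈ Set.Ioc (0:ℝ) T,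
    DifferentiableAt ℝ (fun y => u y t) x ∧
    DifferentiableAt ℝ (fun y => deriv (fun z => u z t) y) x ∧
    DifferentiableWithinAt ℝ (fun s => u x s) (Set.Iic T) t ∧
    derivWithin (fun s => u x s) (Set.Iic T) t
      = u x t * deriv (fun y => deriv (fun z => u z t) y) x + u x t * (1 - u x t)) ∧
  ContinuousOn (fun p : ℝ × ℝ => deriv (fun z => u z p.2) p.1) (QiSet xi xip T) ∧
  ContinuousOn (fun p : ℝ × ℝ => deriv (fun y => deriv (fun z => u z p.2) y) p.1)
    (QiSet xi xip T) ∧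
  ContinuousOn (fun p : ℝ × ℝ => derivWithin (fun s => u p.1 s) (Set.Iic T) p.2)
    (QiSet xi xip T)

/-- The limit of a real sequence along the hyperfilter on `ℕ`. -/
noncomputable def ulim (f : ℕ → ℝ) : ℝ := limUnder (hyperfilter ℕ : Filter ℕ) f

lemma exists_tendsto_hyperfilter {f : ℕ → ℝ} {p q : ℝ}
    (hf : ∀ᶠ n in (hyperfilter ℕ : Filter ℕ), f n ∈ Icc p q) :
    ∃ x ∈ Icc p q, Tendsto f (hyperfilter ℕ : Filter ℕ) (𝓝 x) := by
  have hc : IsCompact (Icc p q) := isCompact_Icc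
  exact hc.ultrafilter_le_nhds (Ultrafilter.map f (hyperfilter ℕ)) (by
    rw [le_principal_iff]; exact hf)

lemma tendsto_ulim {f : ℕ → ℝ} {C : ℝ}
    (hf : ∀ᶠ n in (hyperfilter ℕ : Filter ℕ), |f n| ≤ C) :
    Tendsto f (hyperfilter ℕ : Filter ℕ) (𝓝 (ulim f)) := by
  have : ∀ᶠ n in (hyperfilter ℕ : Filter ℕ), f n ∈ Icc (-C) C :=
    hf.mono fun n hn => abs_le.1 hn
  obtain ⟨x, -, hx⟩ := exists_tendsto_hyperfilter this
  exact tendsto_nhds_limUnder ⟨x, hx⟩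

/-- A family `U` sampled at the points `X x`, with discrete first and second space derivatives
`V`, `W` (in the sense of uniform Taylor estimates), whose time increments obey the mean value
property for the speed `U (W + 1 - U)`. -/
structure Reg (C α β τ T : ℝ) (X : ℝ → ℝ) (U V W : ℝ → ℝ → ℝ) : Prop where
  bddU : ∀ x ∈ Icc α β, ∀ t ∈ Icc τ T, |U x t| ≤ C
  bddV : ∀ x ∈ Icc α β, ∀ t ∈ Icc τ T, |V x t| ≤ C
  bddW : ∀ x ∈ Icc α β, ∀ t ∈ Icc τ T, |W x t| ≤ C
  taylorU : ∀ x ∈ Icc α β, ∀ y ∈ Icc α β, ∀ t ∈ Icc τ T,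
    |U y t - U x t - (X y - X x) * V x t| ≤ C * (X y - X x) ^ 2
  taylorV : ∀ x ∈ Icc α β, ∀ y ∈ Icc α β, ∀ t ∈ Icc τ T,
    |V y t - V x t - (X y - X x) * W x t| ≤ C * (|X y - X x| * √|X y - X x|)
  mvt : ∀ x ∈ Icc α β, ∀ s ∈ Icc τ T, ∀ t ∈ Icc τ T, s ≤ t → ∃ ξ ∈ Icc s t,
    U x t - U x s = (t - s) * (U x ξ * (W x ξ + 1 - U x ξ))

lemma hasDerivWithinAt_of_taylor {S : Set ℝ} {f : ℝ → ℝ} {x v : ℝ} {C : ℝ} {ω : ℝ → ℝ}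
    (hω : Tendsto ω (𝓝 0) (𝓝 0))
    (h : ∀ y ∈ S, |f y - f x - (y - x) * v| ≤ C * (|y - x| * ω |y - x|)) :
    HasDerivWithinAt f v S x := by
  rw [hasDerivWithinAt_iff_isLittleO, Asymptotics.isLittleO_iff]
  intro c hc
  have h1 : Tendsto (fun y => |C| * abs (ω (abs (y - x)))) (𝓝 x) (𝓝 0) := by
    have h2 : Tendsto (fun y : ℝ => |y - x|) (𝓝 x) (𝓝 0) := by
      have : Continuous fun y : ℝ => |y - x| := by fun_prop
      simpa using this.tendsto x
    have := ((hω.comp h2).abs).const_mul |C|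
    simpa using this
  have h3 : ∀ᶠ y in 𝓝[S] x, |C| * abs (ω (abs (y - x))) < c :=
    (h1.eventually (gt_mem_nhds hc)).filter_mono nhdsWithin_le_nhds
  filter_upwards [h3, self_mem_nhdsWithin] with y hy hyS
  simp only [smul_eq_mul, Real.norm_eq_abs]
  refine (h y hyS).trans ?_
  calc C * (|y - x| * ω |y - x|) ≤ |C * (|y - x| * ω |y - x|)| := le_abs_self _
    _ = |C| * abs (ω (abs (y - x))) * |y - x| := by rw [abs_mul, abs_mul, abs_abs]; ring
    _ ≤ c * |y - x| := by gcongr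

lemma Reg.nonneg {C α β τ T : ℝ} {X : ℝ → ℝ} {U V W : ℝ → ℝ → ℝ} (hαβ : α < β) (hτ : τ ≤ T)
    (h : Reg C α β τ T X U V W) : 0 ≤ C :=
  (abs_nonneg _).trans (h.bddU α ⟨le_rfl, hαβ.le⟩ τ ⟨le_rfl, hτ⟩)

lemma Reg.speed_le {C α β τ T : ℝ} {X : ℝ → ℝ} {U V W : ℝ → ℝ → ℝ} (hC : 0 ≤ C)
    (h : Reg C α β τ T X U V W) {x t : ℝ} (hx : x ∈ Icc α β) (ht : t ∈ Icc τ T) :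
    |U x t * (W x t + 1 - U x t)| ≤ C * (2 * C + 1) := by
  rw [abs_mul]
  have h1 := h.bddU x hx t ht
  have h2 := h.bddW x hx t ht
  have h3 : |W x t + 1 - U x t| ≤ 2 * C + 1 := by
    rw [abs_le] at *; constructor <;> linarith
  gcongr

lemma Reg.lip_time {C α β τ T : ℝ} {X : ℝ → ℝ} {U V W : ℝ → ℝ → ℝ} (hC : 0 ≤ C)
    (h : Reg C α β τ T X U V W) {x s t : ℝ} (hx : x ∈ Icc α β) (hs : s ∈ Icc τ T)
    (ht : t ∈ Icc τ T) : |U x t - U x s| ≤ C * (2 * C + 1) * |t - s| := by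
  wlog hst : s ≤ t generalizing s t
  · have := this ht hs (le_of_not_ge hst)
    rwa [abs_sub_comm, abs_sub_comm t s]
  obtain ⟨ξ, hξ, e⟩ := h.mvt x hx s hs t ht hst
  rw [e, abs_mul, mul_comm]
  have := h.speed_le hC hx (t := ξ) ⟨hs.1.trans hξ.1, hξ.2.trans ht.2⟩
  gcongr

lemma Reg.hasDeriv_space {C α β τ T : ℝ} {U V W : ℝ → ℝ → ℝ}
    (h : Reg C α β τ T id U V W) {x t : ℝ} (hx : x ∈ Icc α β) (ht : t ∈ Icc τ T) :
    HasDerivWithinAt (fun y => U y t) (V x t) (Icc α β) x ∧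
    HasDerivWithinAt (fun y => V y t) (W x t) (Icc α β) x := by
  constructor
  · refine hasDerivWithinAt_of_taylor (ω := fun r => r) (C := C) tendsto_id fun y hy => ?_
    have := h.taylorU x hx y hy t ht
    simpa [← sq] using this
  · refine hasDerivWithinAt_of_taylor (ω := fun r => √r) (C := C) ?_ fun y hy => ?_
    · simpa using (Real.continuous_sqrt.tendsto 0)
    · simpa using h.taylorV x hx y hy t ht

/-- Profiles satisfying uniform Taylor estimates converge to a twice differentiable profile. -/
lemma profile_limit {C α β : ℝ} {X : ℕ → ℝ → ℝ} {U V W : ℕ → ℝ → ℝ} {u v w : ℝ → ℝ}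
    (hX : ∀ x ∈ Icc α β, Tendsto (fun n => X n x) (hyperfilter ℕ : Filter ℕ) (𝓝 x))
    (hU : ∀ x ∈ Icc α β, Tendsto (fun n => U n x) (hyperfilter ℕ : Filter ℕ) (𝓝 (u x)))
    (hV : ∀ x ∈ Icc α β, Tendsto (fun n => V n x) (hyperfilter ℕ : Filter ℕ) (𝓝 (v x)))
    (hW : ∀ x ∈ Icc α β, Tendsto (fun n => W n x) (hyperfilter ℕ : Filter ℕ) (𝓝 (w x)))
    (h1 : ∀ᶠ n in (hyperfilter ℕ : Filter ℕ), ∀ x ∈ Icc α β, ∀ y ∈ Icc α β,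
      |U n y - U n x - (X n y - X n x) * V n x| ≤ C * (X n y - X n x) ^ 2)
    (h2 : ∀ᶠ n in (hyperfilter ℕ : Filter ℕ), ∀ x ∈ Icc α β, ∀ y ∈ Icc α β,
      |V n y - V n x - (X n y - X n x) * W n x| ≤ C * (|X n y - X n x| * √|X n y - X n x|)) :
    (∀ x ∈ Icc α β, ∀ y ∈ Icc α β, |u y - u x - (y - x) * v x| ≤ C * (y - x) ^ 2) ∧
    (∀ x ∈ Icc α β, ∀ y ∈ Icc α β,
      |v y - v x - (y - x) * w x| ≤ C * (|y - x| * √|y - x|)) := by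
  constructor
  · intro x hx y hy
    have hd := (hX y hy).sub (hX x hx)
    refine le_of_tendsto_of_tendsto
      (((hU y hy).sub (hU x hx)).sub (hd.mul (hV x hx))).abs ((hd.pow 2).const_mul C) ?_
    filter_upwards [h1] with n hn using hn x hx y hy
  · intro x hx y hy
    have hd := (hX y hy).sub (hX x hx)
    refine le_of_tendsto_of_tendsto
      (((hV y hy).sub (hV x hx)).sub (hd.mul (hW x hx))).abs
      ((hd.abs.mul hd.abs.sqrt).const_mul C) ?_
    filter_upwards [h2] with n hn using hn x hx y hy

lemma profile_unique {C C' α β : ℝ} (hαβ : α < β) {u v w v' w' : ℝ → ℝ}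
    (h1 : ∀ x ∈ Icc α β, ∀ y ∈ Icc α β, |u y - u x - (y - x) * v x| ≤ C * (y - x) ^ 2)
    (h2 : ∀ x ∈ Icc α β, ∀ y ∈ Icc α β,
      |v y - v x - (y - x) * w x| ≤ C * (|y - x| * √|y - x|))
    (h1' : ∀ x ∈ Icc α β, ∀ y ∈ Icc α β, |u y - u x - (y - x) * v' x| ≤ C' * (y - x) ^ 2)
    (h2' : ∀ x ∈ Icc α β, ∀ y ∈ Icc α β,
      |v' y - v' x - (y - x) * w' x| ≤ C' * (|y - x| * √|y - x|)) :
    ∀ x ∈ Icc α β, w x = w' x := by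
  have d1 : ∀ {C : ℝ} {u v : ℝ → ℝ}, (∀ x ∈ Icc α β, ∀ y ∈ Icc α β,
      |u y - u x - (y - x) * v x| ≤ C * (y - x) ^ 2) →
      ∀ x ∈ Icc α β, HasDerivWithinAt u (v x) (Icc α β) x := by
    intro C u v h x hx
    refine hasDerivWithinAt_of_taylor (ω := fun r => r) (C := C) tendsto_id fun y hy => ?_
    simpa [← sq] using h x hx y hy
  have d2 : ∀ {C : ℝ} {v w : ℝ → ℝ}, (∀ x ∈ Icc α β, ∀ y ∈ Icc α β,
      |v y - v x - (y - x) * w x| ≤ C * (|y - x| * √|y - x|)) →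
      ∀ x ∈ Icc α β, HasDerivWithinAt v (w x) (Icc α β) x := by
    intro C v w h x hx
    refine hasDerivWithinAt_of_taylor (ω := fun r => √r) (C := C) ?_ fun y hy => h x hx y hy
    simpa using (Real.continuous_sqrt.tendsto 0)
  have hv : ∀ x ∈ Icc α β, v x = v' x := fun x hx =>
    (uniqueDiffOn_Icc hαβ x hx).eq_deriv _ (d1 h1 x hx) (d1 h1' x hx)
  intro x hx
  have e := (d2 h2 x hx).congr_of_mem (fun y hy => (hv y hy).symm) hx
  exact (uniqueDiffOn_Icc hαβ x hx).eq_deriv _ e (d2 h2' x hx)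

theorem Reg.limit {C α β τ T : ℝ} (hαβ : α < β) (hτ : τ ≤ T) {X : ℕ → ℝ → ℝ}
    {U V W : ℕ → ℝ → ℝ → ℝ} {u v w : ℝ → ℝ → ℝ}
    (hX : ∀ x ∈ Icc α β, Tendsto (fun n => X n x) (hyperfilter ℕ : Filter ℕ) (𝓝 x))
    (hR : ∀ᶠ n in (hyperfilter ℕ : Filter ℕ), Reg C α β τ T (X n) (U n) (V n) (W n))
    (hU : ∀ x ∈ Icc α β, ∀ t ∈ Icc τ T,
      Tendsto (fun n => U n x t) (hyperfilter ℕ : Filter ℕ) (𝓝 (u x t)))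
    (hV : ∀ x ∈ Icc α β, ∀ t ∈ Icc τ T,
      Tendsto (fun n => V n x t) (hyperfilter ℕ : Filter ℕ) (𝓝 (v x t)))
    (hW : ∀ x ∈ Icc α β, ∀ t ∈ Icc τ T,
      Tendsto (fun n => W n x t) (hyperfilter ℕ : Filter ℕ) (𝓝 (w x t))) :
    Reg C α β τ T id u v w := by
  have hC : 0 ≤ C := by
    obtain ⟨n, hn⟩ := hR.exists
    exact hn.nonneg hαβ hτ
  have key : ∀ t ∈ Icc τ T,
      (∀ x ∈ Icc α β, ∀ y ∈ Icc α β, |u y t - u x t - (y - x) * v x t| ≤ C * (y - x) ^ 2) ∧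
      (∀ x ∈ Icc α β, ∀ y ∈ Icc α β,
        |v y t - v x t - (y - x) * w x t| ≤ C * (|y - x| * √|y - x|)) := by
    intro t ht
    refine profile_limit (U := fun n x => U n x t) (V := fun n x => V n x t)
      (W := fun n x => W n x t) (u := fun x => u x t) (v := fun x => v x t)
      (w := fun x => w x t) hX (fun x hx => hU x hx t ht)
      (fun x hx => hV x hx t ht) (fun x hx => hW x hx t ht) ?_ ?_
    · filter_upwards [hR] with n hn x hx y hy using hn.taylorU x hx y hy t ht
    · filter_upwards [hR] with n hn x hx y hy using hn.taylorV x hx y hy t ht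
  refine ⟨fun x hx t ht => ?_, fun x hx t ht => ?_, fun x hx t ht => ?_,
    fun x hx y hy t ht => (key t ht).1 x hx y hy,
    fun x hx y hy t ht => (key t ht).2 x hx y hy, fun x hx s hs t ht hst => ?_⟩
  · exact le_of_tendsto (hU x hx t ht).abs (hR.mono fun n hn => hn.bddU x hx t ht)
  · exact le_of_tendsto (hV x hx t ht).abs (hR.mono fun n hn => hn.bddV x hx t ht)
  · exact le_of_tendsto (hW x hx t ht).abs (hR.mono fun n hn => hn.bddW x hx t ht)
  · have hex : ∀ n, ∃ ξ ∈ Icc s t, Reg C α β τ T (X n) (U n) (V n) (W n) →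
        U n x t - U n x s = (t - s) * (U n x ξ * (W n x ξ + 1 - U n x ξ)) := by
      intro n
      by_cases hn : Reg C α β τ T (X n) (U n) (V n) (W n)
      · obtain ⟨ξ, hξ, e⟩ := hn.mvt x hx s hs t ht hst
        exact ⟨ξ, hξ, fun _ => e⟩
      · exact ⟨s, ⟨le_rfl, hst⟩, fun h => absurd h hn⟩
    choose ξ hξm hξe using hex
    obtain ⟨ζ, hζm, hζ⟩ := exists_tendsto_hyperfilter (Eventually.of_forall hξm)
    have hmem : ∀ r ∈ Icc s t, r ∈ Icc τ T := fun r hr => ⟨hs.1.trans hr.1, hr.2.trans ht.2⟩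
    have hUξ : ∀ y ∈ Icc α β,
        Tendsto (fun n => U n y (ξ n)) (hyperfilter ℕ : Filter ℕ) (𝓝 (u y ζ)) := by
      intro y hy
      have h0 : Tendsto (fun n => U n y (ξ n) - U n y ζ) (hyperfilter ℕ : Filter ℕ) (𝓝 0) := by
        have hb : Tendsto (fun n => C * (2 * C + 1) * |ξ n - ζ|)
            (hyperfilter ℕ : Filter ℕ) (𝓝 0) := by
          have := ((hζ.sub_const ζ).abs).const_mul (C * (2 * C + 1))
          simpa using this
        refine squeeze_zero_norm' ?_ hb
        filter_upwards [hR] with n hn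
        exact hn.lip_time hC hy (hmem _ hζm) (hmem _ (hξm n))
      simpa using h0.add (hU y hy ζ (hmem _ hζm))
    have hVξ : ∀ y ∈ Icc α β, Tendsto (fun n => V n y (ξ n)) (hyperfilter ℕ : Filter ℕ)
        (𝓝 (ulim fun n => V n y (ξ n))) := fun y hy =>
      tendsto_ulim (hR.mono fun n hn => hn.bddV y hy _ (hmem _ (hξm n)))
    have hWξ : ∀ y ∈ Icc α β, Tendsto (fun n => W n y (ξ n)) (hyperfilter ℕ : Filter ℕ)
        (𝓝 (ulim fun n => W n y (ξ n))) := fun y hy =>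
      tendsto_ulim (hR.mono fun n hn => hn.bddW y hy _ (hmem _ (hξm n)))
    have p := profile_limit (C := C) (U := fun n y => U n y (ξ n)) (V := fun n y => V n y (ξ n))
      (W := fun n y => W n y (ξ n)) (u := fun y => u y ζ)
      (v := fun y => ulim fun n => V n y (ξ n)) (w := fun y => ulim fun n => W n y (ξ n))
      hX hUξ hVξ hWξ
      (by filter_upwards [hR] with n hn x hx y hy using hn.taylorU x hx y hy _ (hmem _ (hξm n)))
      (by filter_upwards [hR] with n hn x hx y hy using hn.taylorV x hx y hy _ (hmem _ (hξm n)))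
    have q := key ζ (hmem _ hζm)
    have hw : (ulim fun n => W n x (ξ n)) = w x ζ :=
      profile_unique hαβ p.1 p.2 q.1 q.2 x hx
    refine ⟨ζ, hζm, ?_⟩
    have l1 := (hU x hx t ht).sub (hU x hx s hs)
    have hW' := hWξ x hx
    rw [hw] at hW'
    have l2 := ((hUξ x hx).mul ((hW'.add_const 1).sub (hUξ x hx))).const_mul (t - s)
    refine tendsto_nhds_unique l1 (l2.congr' ?_)
    filter_upwards [hR] with n hn using (hξe n hn).symm

/-- If difference quotients of a jointly continuous function converge uniformly, the limit is
jointly continuous. -/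
lemma continuousOn_of_taylor {α β : ℝ} (hαβ : α < β) {J : Set ℝ} {u v : ℝ → ℝ → ℝ} {C : ℝ}
    {ω : ℝ → ℝ} (hω : Tendsto ω (𝓝 0) (𝓝 0)) (hmono : Monotone ω) (hC : 0 ≤ C)
    (hu : ContinuousOn (fun p : ℝ × ℝ => u p.1 p.2) (Icc α β ×ˢ J))
    (h : ∀ x ∈ Icc α β, ∀ y ∈ Icc α β, ∀ t ∈ J,
      |u y t - u x t - (y - x) * v x t| ≤ C * (|y - x| * ω |y - x|)) :
    ContinuousOn (fun p : ℝ × ℝ => v p.1 p.2) (Icc α β ×ˢ J) := by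
  rintro ⟨x₀, t₀⟩ ⟨hx₀, ht₀⟩
  simp only at hx₀ ht₀
  rw [Metric.continuousWithinAt_iff']
  intro ε hε
  have hlim : Tendsto (fun r : ℝ => C * ω (2 * r)) (𝓝 0) (𝓝 0) := by
    have : Tendsto (fun r : ℝ => 2 * r) (𝓝 0) (𝓝 0) := by
      simpa using (continuous_const_mul (2 : ℝ)).tendsto 0
    simpa using (hω.comp this).const_mul C
  obtain ⟨δ, hδ, hδs, hδ1⟩ : ∃ δ > 0, C * ω (2 * δ) < ε / 3 ∧ δ ≤ (β - α) / 2 := by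
    have e1 := (hlim.eventually (gt_mem_nhds (show (0:ℝ) < ε / 3 by positivity)))
    obtain ⟨r, hr, hr'⟩ := Metric.eventually_nhds_iff.1 e1
    refine ⟨min (r / 2) ((β - α) / 2), ?_, hr' ?_, min_le_right _ _⟩
    · have : 0 < β - α := sub_pos.2 hαβ
      positivity
    · have : 0 < min (r / 2) ((β - α) / 2) := by
        have : 0 < β - α := sub_pos.2 hαβ
        positivity
      rw [Real.dist_eq, sub_zero, abs_of_pos this]
      exact (min_le_left _ _).trans_lt (by linarith)
  obtain ⟨y, hy, hyx⟩ : ∃ y ∈ Icc α β, |y - x₀| = δ := by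
    rcases le_total x₀ ((α + β) / 2) with h' | h'
    · exact ⟨x₀ + δ, ⟨by linarith [hx₀.1], by linarith⟩, by simp [abs_of_pos hδ]⟩
    · exact ⟨x₀ - δ, ⟨by linarith, by linarith [hx₀.2]⟩, by simp [abs_of_pos hδ]⟩
  have hyne : y - x₀ ≠ 0 := by
    intro h0; rw [h0, abs_zero] at hyx; exact hδ.ne hyx
  have est : ∀ x ∈ Icc α β, ∀ t ∈ J, y - x ≠ 0 → |y - x| ≤ 2 * δ →
      |v x t - (u y t - u x t) / (y - x)| ≤ C * ω (2 * δ) := by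
    intro x hx t ht hne hle
    have h1 := h x hx y hy t ht
    have h2 : v x t - (u y t - u x t) / (y - x)
        = -((u y t - u x t - (y - x) * v x t) / (y - x)) := by field_simp; ring
    rw [h2, abs_neg, abs_div, div_le_iff₀ (abs_pos.2 hne)]
    refine h1.trans ?_
    have := hmono hle
    calc C * (|y - x| * ω |y - x|) ≤ C * (|y - x| * ω (2 * δ)) := by gcongr
      _ = _ := by ring
  have hq : ContinuousWithinAt (fun p : ℝ × ℝ => (u y p.2 - u p.1 p.2) / (y - p.1))
      (Icc α β ×ˢ J) (x₀, t₀) := by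
    refine ContinuousWithinAt.div (ContinuousWithinAt.sub ?_ (hu _ ⟨hx₀, ht₀⟩)) ?_ hyne
    · have h1 : ContinuousWithinAt (fun p : ℝ × ℝ => u p.1 p.2) (Icc α β ×ˢ J) (y, t₀) :=
        hu (y, t₀) ⟨hy, ht₀⟩
      have h2 : ContinuousWithinAt (fun p : ℝ × ℝ => (y, p.2)) (Icc α β ×ˢ J) (x₀, t₀) := by
        fun_prop
      exact ContinuousWithinAt.comp (f := fun p : ℝ × ℝ => (y, p.2)) (x := (x₀, t₀)) h1 h2
        (fun p hp => ⟨hy, hp.2⟩)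
    · fun_prop
  have e1 := (Metric.continuousWithinAt_iff'.1 hq) (ε / 3) (by positivity)
  have e2 : ∀ᶠ p : ℝ × ℝ in 𝓝[Icc α β ×ˢ J] (x₀, t₀), |p.1 - x₀| < δ := by
    have : Continuous fun p : ℝ × ℝ => |p.1 - x₀| := by fun_prop
    have h2 := this.tendsto (x₀, t₀)
    simp only [sub_self, abs_zero] at h2
    exact (h2.eventually (gt_mem_nhds hδ)).filter_mono nhdsWithin_le_nhds
  filter_upwards [e1, e2, self_mem_nhdsWithin] with p hp1 hp2 hp3
  obtain ⟨hpx, hpt⟩ := hp3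
  have hpne : y - p.1 ≠ 0 := by
    intro h0
    have : p.1 = y := by linarith
    rw [this, hyx] at hp2
    exact lt_irrefl _ hp2
  have hple : |y - p.1| ≤ 2 * δ := by
    calc |y - p.1| = |(y - x₀) - (p.1 - x₀)| := by congr 1; ring
      _ ≤ |y - x₀| + |p.1 - x₀| := abs_sub _ _
      _ ≤ 2 * δ := by linarith
  have a1 := est p.1 hpx p.2 hpt hpne hple
  have a2 := est x₀ hx₀ t₀ ht₀ hyne (by linarith)
  rw [Real.dist_eq] at hp1 ⊢
  rw [abs_lt] at hp1 ⊢
  rw [abs_le] at a1 a2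
  constructor <;> linarith [a1.1, a1.2, a2.1, a2.2, hp1.1, hp1.2]

theorem Reg.continuousOn {C α β τ T : ℝ} (hαβ : α < β) (hτ : τ ≤ T) {U V W : ℝ → ℝ → ℝ}
    (h : Reg C α β τ T id U V W) :
    ContinuousOn (fun p : ℝ × ℝ => U p.1 p.2) (Icc α β ×ˢ Icc τ T) ∧
    ContinuousOn (fun p : ℝ × ℝ => V p.1 p.2) (Icc α β ×ˢ Icc τ T) ∧
    ContinuousOn (fun p : ℝ × ℝ => W p.1 p.2) (Icc α β ×ˢ Icc τ T) := by
  have hC := h.nonneg hαβ hτ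
  have hU : ContinuousOn (fun p : ℝ × ℝ => U p.1 p.2) (Icc α β ×ˢ Icc τ T) := by
    refine continuousOn_prod_of_continuousOn_lipschitzOnWith'
      (K := ⟨C * (2 * C + 1), by positivity⟩) _ ?_ ?_
    rotate_left
    · intro t ht x hx
      exact (h.hasDeriv_space hx ht).1.continuousWithinAt
    · intro x hx
      refine LipschitzOnWith.of_dist_le_mul fun s hs t ht => ?_
      rw [Real.dist_eq, Real.dist_eq]
      exact h.lip_time hC hx ht hs
  have hV : ContinuousOn (fun p : ℝ × ℝ => V p.1 p.2) (Icc α β ×ˢ Icc τ T) := by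
    refine continuousOn_of_taylor (ω := fun r => r) (C := C) hαβ tendsto_id monotone_id hC hU
      fun x hx y hy t ht => ?_
    have := h.taylorU x hx y hy t ht
    simpa [← sq] using this
  refine ⟨hU, hV, ?_⟩
  refine continuousOn_of_taylor (ω := fun r => √r) (C := C) hαβ
    (by simpa using Real.continuous_sqrt.tendsto 0) (fun _ _ => Real.sqrt_le_sqrt) hC hV
      fun x hx y hy t ht => ?_
  simpa using h.taylorV x hx y hy t ht

theorem Reg.hasDeriv_time {C α β τ T : ℝ} (hαβ : α < β) {U V W : ℝ → ℝ → ℝ}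
    (h : Reg C α β τ T id U V W) {x t : ℝ} (hx : x ∈ Icc α β) (ht : t ∈ Ioc τ T) :
    HasDerivWithinAt (fun s => U x s) (U x t * (W x t + 1 - U x t)) (Iic T) t := by
  have hτ : τ ≤ T := ht.1.le.trans ht.2
  have ht' : t ∈ Icc τ T := ⟨ht.1.le, ht.2⟩
  obtain ⟨hU, -, hW⟩ := h.continuousOn hαβ hτ
  have hG : ContinuousWithinAt (fun s => U x s * (W x s + 1 - U x s)) (Icc τ T) t := by
    have c1 : ContinuousWithinAt (fun s : ℝ => (x, s)) (Icc τ T) t := by fun_prop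
    have m : MapsTo (fun s : ℝ => (x, s)) (Icc τ T) (Icc α β ×ˢ Icc τ T) :=
      fun s hs => ⟨hx, hs⟩
    have cU : ContinuousWithinAt (fun s => U x s) (Icc τ T) t :=
      ContinuousWithinAt.comp (f := fun s : ℝ => (x, s)) (hU (x, t) ⟨hx, ht'⟩) c1 m
    have cW : ContinuousWithinAt (fun s => W x s) (Icc τ T) t :=
      ContinuousWithinAt.comp (f := fun s : ℝ => (x, s)) (hW (x, t) ⟨hx, ht'⟩) c1 m
    exact cU.mul ((cW.add continuousWithinAt_const).sub cU)
  have main : HasDerivWithinAt (fun s => U x s) (U x t * (W x t + 1 - U x t)) (Icc τ T) t := by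
    rw [hasDerivWithinAt_iff_isLittleO, Asymptotics.isLittleO_iff]
    intro c hc
    have e1 := (Metric.continuousWithinAt_iff.1 hG) c hc
    obtain ⟨δ, hδ, hδ'⟩ := e1
    have e2 : ∀ᶠ s in 𝓝[Icc τ T] t, dist s t < δ :=
      mem_nhdsWithin_of_mem_nhds (Metric.ball_mem_nhds t hδ)
    filter_upwards [e2, self_mem_nhdsWithin] with s hs hsm
    simp only [smul_eq_mul, Real.norm_eq_abs]
    have claim : ∃ ξ ∈ Icc τ T, dist ξ t < δ ∧
        U x s - U x t = (s - t) * (U x ξ * (W x ξ + 1 - U x ξ)) := by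
      rcases le_total s t with hst | hst
      · obtain ⟨ξ, hξ, e⟩ := h.mvt x hx s hsm t ht' hst
        refine ⟨ξ, ⟨hsm.1.trans hξ.1, hξ.2.trans ht.2⟩, ?_, by linarith⟩
        rw [Real.dist_eq, abs_lt] at *
        constructor <;> linarith [hξ.1, hξ.2]
      · obtain ⟨ξ, hξ, e⟩ := h.mvt x hx t ht' s hsm hst
        refine ⟨ξ, ⟨ht.1.le.trans hξ.1, hξ.2.trans hsm.2⟩, ?_, by linarith⟩
        rw [Real.dist_eq, abs_lt] at *
        constructor <;> linarith [hξ.1, hξ.2]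
    obtain ⟨ξ, hξ, hξd, e⟩ := claim
    rw [e, ← mul_sub, abs_mul, mul_comm]
    have := (hδ' hξ hξd).le
    rw [Real.dist_eq] at this
    gcongr
  refine main.mono_of_mem_nhdsWithin ?_
  rw [← Ici_inter_Iic]
  exact inter_mem (mem_nhdsWithin_of_mem_nhds (Ici_mem_nhds ht.1)) self_mem_nhdsWithin

/-- `u` satisfies `u_t = u (u_xx + 1 - u)` classically in `(a,b) × (0,T]`. -/
def IntSol (a b T : ℝ) (u : ℝ → ℝ → ℝ) : Prop :=
  ∀ x ∈ Ioo a b, ∀ t ∈ Ioc (0 : ℝ) T, ∃ (v : ℝ → ℝ) (q : ℝ),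
    (∀ y ∈ Ioo a b, HasDerivAt (fun z => u z t) (v y) y) ∧ HasDerivAt v q x ∧
    HasDerivWithinAt (fun s => u x s) (u x t * (q + 1 - u x t)) (Iic T) t

lemma second_deriv_nonneg_of_min {a b x q : ℝ} {f v : ℝ → ℝ} (hx : x ∈ Ioo a b)
    (hf : ∀ y ∈ Ioo a b, HasDerivAt f (v y) y) (hv : HasDerivAt v q x)
    (hmin : ∀ y ∈ Ioo a b, f x ≤ f y) : 0 ≤ q := by
  by_contra! hq
  have hnhds : Ioo a b ∈ 𝓝 x := Ioo_mem_nhds hx.1 hx.2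
  have hlm : IsLocalMin f x := by filter_upwards [hnhds] with y hy using hmin y hy
  have e1 : deriv f =ᶠ[𝓝 x] v := by filter_upwards [hnhds] with y hy using (hf y hy).deriv
  have e2 : deriv (deriv f) x = q := by rw [e1.deriv_eq, hv.deriv]
  have hlM : IsLocalMax f x :=
    isLocalMax_of_deriv_deriv_neg (by rw [e2]; exact hq) hlm.deriv_eq_zero
      (hf x hx).continuousAt
  have hconst : f =ᶠ[𝓝 x] fun _ => f x := by
    filter_upwards [hlm, hlM] with y h1 h2 using le_antisymm h2 h1
  have e3 : deriv f =ᶠ[𝓝 x] fun _ => 0 := by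
    filter_upwards [hconst.eventually_nhds] with y hy
    have hy' : f =ᶠ[𝓝 y] fun _ => f x := hy
    rw [hy'.deriv_eq]; simp
  rw [e3.deriv_eq] at e2
  simp at e2
  exact hq.ne e2.symm

lemma time_deriv_nonpos_of_min {T t p : ℝ} {f : ℝ → ℝ} (ht : t ∈ Ioc 0 T)
    (hf : HasDerivWithinAt f p (Iic T) t) (hmin : ∀ s ∈ Ico 0 t, f t ≤ f s) : p ≤ 0 := by
  have h1 : HasDerivWithinAt f p (Iio t) t := hf.mono fun s hs => hs.le.trans ht.2
  rw [hasDerivWithinAt_iff_tendsto_slope' (by simp)] at h1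
  refine le_of_tendsto h1 ?_
  have : Ico 0 t ∈ 𝓝[<] t := Ico_mem_nhdsLT ht.1
  filter_upwards [this] with s hs
  rw [slope_def_field]
  exact div_nonpos_of_nonneg_of_nonpos (by linarith [hmin s hs]) (by linarith [hs.2]) 

lemma pos_of_no_touch {a b S : ℝ} {d : ℝ → ℝ → ℝ}
    (hd : ContinuousOn (fun p : ℝ × ℝ => d p.1 p.2) (Icc a b ×ˢ Icc 0 S))
    (h0 : ∀ x ∈ Icc a b, 0 < d x 0) (hb : ∀ t ∈ Icc 0 S, 0 < d a t ∧ 0 < d b t)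
    (htouch : ∀ x ∈ Ioo a b, ∀ t ∈ Ioc 0 S, d x t = 0 → (∀ y ∈ Icc a b, 0 ≤ d y t) →
      (∀ s ∈ Ico 0 t, 0 ≤ d x s) → False) :
    ∀ x ∈ Icc a b, ∀ t ∈ Icc 0 S, 0 < d x t := by
  by_contra! hcon
  obtain ⟨x₁, hx₁, t₁, ht₁, hneg⟩ := hcon
  set K := (Icc a b ×ˢ Icc 0 S) ∩ (fun p : ℝ × ℝ => d p.1 p.2) ⁻¹' Iic 0 with hK
  have hKc : IsCompact K := by
    refine (isCompact_Icc.prod isCompact_Icc).of_isClosed_subset ?_ inter_subset_left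
    exact hd.preimage_isClosed_of_isClosed (isClosed_Icc.prod isClosed_Icc) isClosed_Iic
  obtain ⟨⟨x, t⟩, ⟨⟨hx, ht⟩, hdle⟩, hmin⟩ :=
    hKc.exists_isMinOn ⟨(x₁, t₁), ⟨hx₁, ht₁⟩, hneg⟩ continuous_snd.continuousOn
  simp only at hx ht
  have hdle' : d x t ≤ 0 := hdle
  have hbefore : ∀ y ∈ Icc a b, ∀ s ∈ Ico 0 t, 0 < d y s := by
    intro y hy s hs
    by_contra! hle
    have h2 : (y, s) ∈ K := ⟨⟨hy, ⟨hs.1, hs.2.le.trans ht.2⟩⟩, hle⟩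
    have h3 : t ≤ s := hmin h2
    exact absurd hs.2 (not_lt.2 h3)
  have ht0 : 0 < t := by
    rcases ht.1.eq_or_lt with h | h
    · rw [← h] at hdle'; exact absurd (h0 x hx) (not_lt.2 hdle')
    · exact h
  have hnow : ∀ y ∈ Icc a b, 0 ≤ d y t := by
    intro y hy
    have hc : ContinuousWithinAt (fun s => d y s) (Icc 0 S) t :=
      ContinuousWithinAt.comp (f := fun s : ℝ => (y, s)) (hd (y, t) ⟨hy, ht⟩)
        (by fun_prop) (fun s hs => ⟨hy, hs⟩)
    have hc' : Tendsto (fun s => d y s) (𝓝[<] t) (𝓝 (d y t)) := by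
      have : 𝓝[Ico 0 t] t = 𝓝[<] t := nhdsWithin_Ico_eq_nhdsLT ht0
      rw [← this]
      exact hc.mono fun s hs => ⟨hs.1, hs.2.le.trans ht.2⟩
    refine ge_of_tendsto hc' ?_
    filter_upwards [Ico_mem_nhdsLT ht0] with s hs using (hbefore y hy s hs).le
  have hxI : x ∈ Ioo a b := by
    refine ⟨lt_of_le_of_ne hx.1 ?_, lt_of_le_of_ne hx.2 ?_⟩
    · rintro rfl; exact absurd (hb t ht).1 (not_lt.2 hdle')
    · rintro rfl; exact absurd (hb t ht).2 (not_lt.2 hdle')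
  exact htouch x hxI t ⟨ht0, ht.2⟩ (le_antisymm hdle' (hnow x hx)) hnow
    fun s hs => (hbefore x hx s hs).le

/-- A classical solution which is at least `c ∈ (0,1]` on the parabolic boundary is positive. -/
theorem IntSol.pos {a b T c : ℝ} {u : ℝ → ℝ → ℝ}
    (hu : ContinuousOn (fun p : ℝ × ℝ => u p.1 p.2) (Icc a b ×ˢ Icc 0 T))
    (hs : IntSol a b T u) (hc : 0 < c) (hc1 : c ≤ 1) (h0 : ∀ x ∈ Icc a b, c ≤ u x 0)
    (hb : ∀ t ∈ Icc 0 T, c ≤ u a t ∧ c ≤ u b t) :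
    ∀ x ∈ Icc a b, ∀ t ∈ Icc 0 T, 0 < u x t := by
  have := pos_of_no_touch (d := fun x t => u x t - c / 2) (a := a) (b := b) (S := T)
    (hu.sub continuousOn_const) (fun x hx => by linarith [h0 x hx])
    (fun t ht => ⟨by linarith [(hb t ht).1], by linarith [(hb t ht).2]⟩) ?_
  · intro x hx t ht
    linarith [this x hx t ht]
  · intro x hx t ht hz hx' ht'
    obtain ⟨v, q, h1, h2, h3⟩ := hs x hx t ht
    have hq : 0 ≤ q := second_deriv_nonneg_of_min hx h1 h2 fun y hy => by
      linarith [hx' y (Ioo_subset_Icc_self hy)]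
    have hp := time_deriv_nonpos_of_min ht h3 fun s hs => by linarith [ht' s hs]
    have hu' : u x t = c / 2 := by linarith
    rw [hu'] at hp
    have : 0 < c / 2 * (q + 1 - c / 2) := by
      apply mul_pos <;> linarith
    linarith

theorem IntSol.comparison {a b T c : ℝ} (hT : 0 < T) {u v : ℝ → ℝ → ℝ}
    (huc : ContinuousOn (fun p : ℝ × ℝ => u p.1 p.2) (Icc a b ×ˢ Icc 0 T))
    (hvc : ContinuousOn (fun p : ℝ × ℝ => v p.1 p.2) (Icc a b ×ˢ Icc 0 T))
    (hu : IntSol a b T u) (hv : IntSol a b T v) (hc : 0 < c)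
    (hvpos : ∀ x ∈ Icc a b, ∀ t ∈ Icc 0 T, 0 < v x t)
    (h0 : ∀ x ∈ Icc a b, u x 0 ≤ v x 0)
    (hbu : ∀ t ∈ Icc 0 T, u a t ≤ c ∧ u b t ≤ c) (hbv : ∀ t ∈ Icc 0 T, v a t = c ∧ v b t = c) :
    ∀ x ∈ Icc a b, ∀ t ∈ Icc 0 T, u x t ≤ v x t := by
  have strict : ∀ l : ℝ, 1 < l → ∀ x ∈ Icc a b, ∀ t ∈ Icc 0 (T / l),
      0 < l * v x (l * t) - u x t := by
    intro l hl
    have hl0 : 0 < l := by linarith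
    have hmem : ∀ t ∈ Icc 0 (T / l), l * t ∈ Icc 0 T := fun t ht =>
      ⟨mul_nonneg hl0.le ht.1, by have := ht.2; rw [le_div_iff₀ hl0] at this; linarith⟩
    have hTl : T / l ≤ T := div_le_self hT.le hl.le
    refine pos_of_no_touch ?_ ?_ ?_ ?_
    · refine ContinuousOn.sub (continuousOn_const.mul ?_)
        (huc.mono (prod_mono_right (Icc_subset_Icc_right hTl)))
      exact ContinuousOn.comp (f := fun p : ℝ × ℝ => (p.1, l * p.2)) hvc (by fun_prop)
        fun p hp => ⟨hp.1, hmem _ hp.2⟩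
    · intro x hx
      have h1 := hvpos x hx 0 ⟨le_rfl, hT.le⟩
      have h2 := h0 x hx
      rw [mul_zero]
      nlinarith
    · intro t ht
      have h1 := hbv _ (hmem t ht)
      have h2 := hbu t ⟨ht.1, ht.2.trans hTl⟩
      rw [h1.1, h1.2]
      constructor <;> nlinarith [h2.1, h2.2]
    · intro x hx t ht hz hx' ht'
      have hlt : l * t ∈ Ioc 0 T := ⟨mul_pos hl0 ht.1, (hmem t ⟨ht.1.le, ht.2⟩).2⟩
      obtain ⟨v1, qv, hv1, hv2, hv3⟩ := hv x hx (l * t) hlt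
      obtain ⟨u1, qu, hu1, hu2, hu3⟩ := hu x hx t ⟨ht.1, ht.2.trans hTl⟩
      have hq : 0 ≤ l * qv - qu := by
        refine second_deriv_nonneg_of_min hx
          (f := fun y => l * v y (l * t) - u y t) (v := fun y => l * v1 y - u1 y)
          (fun y hy => ((hv1 y hy).const_mul l).sub (hu1 y hy))
          ((hv2.const_mul l).sub hu2) fun y hy => ?_
        rw [hz]; exact hx' y (Ioo_subset_Icc_self hy)
      have hvt : HasDerivWithinAt (fun s => l * v x (l * s))
          (l * (v x (l * t) * (qv + 1 - v x (l * t)) * l)) (Iic (T / l)) t := by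
        refine HasDerivWithinAt.const_mul l ?_
        have hlin : HasDerivWithinAt (fun s => l * s) l (Iic (T / l)) t := by
          simpa using ((hasDerivAt_id t).const_mul l).hasDerivWithinAt
        exact HasDerivWithinAt.comp t (h₂ := fun s => v x s) hv3 hlin fun s hs => by
          have : s ≤ T / l := hs
          rw [le_div_iff₀ hl0] at this
          show l * s ≤ T
          linarith
      have hp := time_deriv_nonpos_of_min ht (hvt.sub (hu3.mono (Iic_subset_Iic.2 hTl)))
        fun s hs => by
          have := ht' s hs
          simp only [Pi.sub_apply]
          rw [hz]; exact this
      have hv0 := hvpos x (Ioo_subset_Icc_self hx) _ (hmem t ⟨ht.1.le, ht.2⟩)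
      have hue : u x t = l * v x (l * t) := by linarith
      set w := v x (l * t)
      rw [hue] at hp
      have : 0 < l * w * (l * qv - qu + (l - 1)) := by
        apply mul_pos (mul_pos hl0 hv0); linarith
      nlinarith
  have weak : ∀ x ∈ Icc a b, ∀ t ∈ Ico 0 T, u x t ≤ v x t := by
    intro x hx t ht
    rcases ht.1.eq_or_lt with rfl | ht0
    · exact h0 x hx
    have hc1 : ContinuousWithinAt (fun s => v x s) (Icc 0 T) (1 * t) := by
      rw [one_mul]
      exact ContinuousWithinAt.comp (f := fun s : ℝ => (x, s)) (hvc (x, t) ⟨hx, ht.1, ht.2.le⟩)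
        (by fun_prop) (fun s hs => ⟨hx, hs⟩)
    have hI : Ioo 1 (T / t) ∈ 𝓝[>] (1 : ℝ) := Ioo_mem_nhdsGT (by rw [lt_div_iff₀ ht0]; linarith [ht.2])
    have hlim : Tendsto (fun l => l * v x (l * t)) (𝓝[Ioo 1 (T / t)] 1) (𝓝 (1 * v x (1 * t))) := by
      refine Tendsto.mul (tendsto_id.mono_left nhdsWithin_le_nhds) ?_
      refine ContinuousWithinAt.comp (f := fun l : ℝ => l * t) hc1 (by fun_prop) fun l hl => ?_
      have := hl.2
      rw [lt_div_iff₀ ht0] at this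
      exact ⟨mul_nonneg (by linarith [hl.1]) ht0.le, this.le⟩
    rw [one_mul, one_mul] at hlim
    have : (𝓝[Ioo 1 (T / t)] (1:ℝ)).NeBot := by
      rw [nhdsWithin_Ioo_eq_nhdsGT (by rw [lt_div_iff₀ ht0]; linarith [ht.2])]
      infer_instance
    refine ge_of_tendsto hlim ?_
    filter_upwards [self_mem_nhdsWithin] with l hl
    have hl0 : 0 < l := by linarith [hl.1]
    have := strict l hl.1 x hx t ⟨ht.1, by
      have := hl.2
      rw [lt_div_iff₀ ht0] at this
      rw [le_div_iff₀ hl0]; linarith⟩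
    linarith
  intro x hx t ht
  have hc1 : ∀ {w : ℝ → ℝ → ℝ}, ContinuousOn (fun p : ℝ × ℝ => w p.1 p.2) (Icc a b ×ˢ Icc 0 T) →
      ContinuousOn (fun s => w x s) (Icc 0 T) := fun hw =>
    ContinuousOn.comp (f := fun s : ℝ => (x, s)) hw (by fun_prop) (fun s hs => ⟨hx, hs⟩)
  have hcl : closure (Ico 0 T) = Icc 0 T := closure_Ico hT.ne
  have := ContinuousWithinAt.closure_le (s := Ico 0 T) (x := t) (f := fun s => u x s)
    (g := fun s => v x s) (by rw [hcl]; exact ht)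
    ((hc1 huc t ht).mono Ico_subset_Icc_self) ((hc1 hvc t ht).mono Ico_subset_Icc_self)
    (fun s hs => weak x hx s hs)
  exact this

lemma IsApproxSol.intSol {a b T c : ℝ} {f : ℝ → ℝ} {u : ℝ → ℝ → ℝ}
    (h : IsApproxSol a b T c f u) : IntSol a b T u := by
  obtain ⟨-, -, -, v1, v2, vt, -, -, -, hd, he⟩ := h
  intro x hx t ht
  refine ⟨fun y => v1 y t, v2 x t, fun y hy => ?_, ?_, ?_⟩
  · exact (hd y (Ioo_subset_Icc_self hy) t ht).1.hasDerivAt (Icc_mem_nhds hy.1 hy.2)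
  · exact (hd x (Ioo_subset_Icc_self hx) t ht).2.1.hasDerivAt (Icc_mem_nhds hx.1 hx.2)
  · rw [← he x hx t ht]
    exact (hd x (Ioo_subset_Icc_self hx) t ht).2.2

lemma IsDegSol.intSol {a b T : ℝ} {f : ℝ → ℝ} {u : ℝ → ℝ → ℝ}
    (h : IsDegSol a b T f u) : IntSol a b T u := by
  obtain ⟨-, -, -, -, hd, -⟩ := h
  intro x hx t ht
  obtain ⟨h1, h2, h3, h4⟩ := hd x hx t ht
  refine ⟨fun y => deriv (fun z => u z t) y,
    deriv (fun y => deriv (fun z => u z t) y) x, fun y hy => ?_, h2.hasDerivAt, ?_⟩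
  · exact (hd y hy t ht).1.hasDerivAt
  · have := h3.hasDerivWithinAt
    rw [h4] at this
    rw [show u x t * (deriv (fun y => deriv (fun z => u z t) y) x + 1 - u x t)
      = u x t * deriv (fun y => deriv (fun z => u z t) y) x + u x t * (1 - u x t) by ring]
    exact this

/-- Comparison for approximate solutions with ordered constant boundary values and data. -/
theorem IsApproxSol.comparison {a b T c c' : ℝ} (hab : a < b) (hT : 0 < T) {f f' : ℝ → ℝ}
    {u v : ℝ → ℝ → ℝ} (hu : IsApproxSol a b T c f u) (hv : IsApproxSol a b T c' f' v)
    (hcc : c ≤ c') (hc' : 0 < c') (hc'1 : c' ≤ 1) (hff : ∀ x ∈ Icc a b, f x ≤ f' x)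
    (hf' : ∀ x ∈ Icc a b, c' ≤ f' x) (hfa : f a = c) (hfb : f b = c) (hfa' : f' a = c')
    (hfb' : f' b = c') :
    ∀ x ∈ Icc a b, ∀ t ∈ Icc 0 T, u x t ≤ v x t := by
  have ha : a ∈ Icc a b := ⟨le_rfl, hab.le⟩
  have hb : b ∈ Icc a b := ⟨hab.le, le_rfl⟩
  have hbv : ∀ t ∈ Icc 0 T, v a t = c' ∧ v b t = c' := by
    intro t ht
    rcases ht.1.eq_or_lt with rfl | h
    · rw [hv.2.2.1 a ha, hv.2.2.1 b hb]; exact ⟨hfa', hfb'⟩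
    · exact hv.2.1 t ⟨h, ht.2⟩
  have hbu : ∀ t ∈ Icc 0 T, u a t = c ∧ u b t = c := by
    intro t ht
    rcases ht.1.eq_or_lt with rfl | h
    · rw [hu.2.2.1 a ha, hu.2.2.1 b hb]; exact ⟨hfa, hfb⟩
    · exact hu.2.1 t ⟨h, ht.2⟩
  refine IntSol.comparison hT hu.1 hv.1 hu.intSol hv.intSol hc' ?_ ?_ ?_ hbv
  · refine hv.intSol.pos hv.1 hc' hc'1 (fun x hx => ?_) fun t ht => ?_
    · rw [hv.2.2.1 x hx]; exact hf' x hx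
    · rw [(hbv t ht).1, (hbv t ht).2]; exact ⟨le_rfl, le_rfl⟩
  · intro x hx
    rw [hu.2.2.1 x hx, hv.2.2.1 x hx]; exact hff x hx
  · intro t ht
    rw [(hbu t ht).1, (hbu t ht).2]; exact ⟨hcc, hcc⟩

/-- Degenerate solutions lie below approximate solutions. -/
theorem IsDegSol.le_approx {a b T c' : ℝ} (hab : a < b) (hT : 0 < T) {f f' : ℝ → ℝ}
    {u v : ℝ → ℝ → ℝ} (hu : IsDegSol a b T f u) (hv : IsApproxSol a b T c' f' v)
    (hc' : 0 < c') (hc'1 : c' ≤ 1) (hff : ∀ x ∈ Icc a b, f x ≤ f' x)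
    (hf' : ∀ x ∈ Icc a b, c' ≤ f' x) (hfa : f a = 0) (hfb : f b = 0) (hfa' : f' a = c')
    (hfb' : f' b = c') :
    ∀ x ∈ Icc a b, ∀ t ∈ Icc 0 T, u x t ≤ v x t := by
  have ha : a ∈ Icc a b := ⟨le_rfl, hab.le⟩
  have hb : b ∈ Icc a b := ⟨hab.le, le_rfl⟩
  have hbv : ∀ t ∈ Icc 0 T, v a t = c' ∧ v b t = c' := by
    intro t ht
    rcases ht.1.eq_or_lt with rfl | h
    · rw [hv.2.2.1 a ha, hv.2.2.1 b hb]; exact ⟨hfa', hfb'⟩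
    · exact hv.2.1 t ⟨h, ht.2⟩
  have hbu : ∀ t ∈ Icc 0 T, u a t = 0 ∧ u b t = 0 := by
    intro t ht
    rcases ht.1.eq_or_lt with rfl | h
    · rw [hu.2.2.1 a ha, hu.2.2.1 b hb]; exact ⟨hfa, hfb⟩
    · exact hu.2.1 t ⟨h, ht.2⟩
  refine IntSol.comparison hT hu.1 hv.1 hu.intSol hv.intSol hc' ?_ ?_ ?_ hbv
  · refine hv.intSol.pos hv.1 hc' hc'1 (fun x hx => ?_) fun t ht => ?_
    · rw [hv.2.2.1 x hx]; exact hf' x hx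
    · rw [(hbv t ht).1, (hbv t ht).2]; exact ⟨le_rfl, le_rfl⟩
  · intro x hx
    rw [hu.2.2.1 x hx, hv.2.2.1 x hx]; exact hff x hx
  · intro t ht
    rw [(hbu t ht).1, (hbu t ht).2]; exact ⟨hc'.le, hc'.le⟩

lemma le_left_of_hasDerivAt_nonpos {p q : ℝ} {f f' : ℝ → ℝ} (hf : ContinuousOn f (Icc p q))
    (hd : ∀ t ∈ Ioo p q, HasDerivAt f (f' t) t) (hle : ∀ t ∈ Ioo p q, f' t ≤ 0) :
    ∀ t ∈ Icc p q, f t ≤ f p := by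
  have : AntitoneOn f (Icc p q) := by
    refine antitoneOn_of_deriv_nonpos (convex_Icc p q) hf ?_ ?_
    · rw [interior_Icc]
      exact fun t ht => (hd t ht).differentiableAt.differentiableWithinAt
    · rw [interior_Icc]
      intro t ht
      rw [(hd t ht).deriv]
      exact hle t ht
  intro t ht
  exact this ⟨le_rfl, ht.1.trans ht.2⟩ ht ht.1

lemma exists_small_near_zero {a b T : ℝ} {u : ℝ → ℝ → ℝ}
    (hu : ContinuousOn (fun p : ℝ × ℝ => u p.1 p.2) (Icc a b ×ˢ Icc 0 T))
    (x₀ : ℝ) (hx₀ : x₀ ∈ Icc a b) (h0 : ∀ t ∈ Icc 0 T, u x₀ t = 0) {ε : ℝ} (hε : 0 < ε) :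
    ∃ δ > 0, ∀ x ∈ Icc a b, |x - x₀| < δ → ∀ t ∈ Icc 0 T, |u x t| < ε := by
  have huc := (isCompact_Icc.prod isCompact_Icc).uniformContinuousOn_of_continuous hu
  rw [Metric.uniformContinuousOn_iff] at huc
  obtain ⟨δ, hδ, h⟩ := huc ε hε
  refine ⟨δ, hδ, fun x hx hxδ t ht => ?_⟩
  have := h (x, t) ⟨hx, ht⟩ (x₀, t) ⟨hx₀, ht⟩ (by
    rw [Prod.dist_eq]; simp [Real.dist_eq, hxδ])
  simpa [h0 t ht, Real.dist_eq] using this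

lemma integral_second_deriv_mul_le {α β : ℝ} (hαβ : α ≤ β) {r r1 r2 : ℝ → ℝ}
    (h1 : ∀ x ∈ Icc α β, HasDerivAt r (r1 x) x) (h2 : ∀ x ∈ Icc α β, HasDerivAt r1 (r2 x) x)
    (hc2 : ContinuousOn r2 (Icc α β)) (hr : ∀ x ∈ Icc α β, 0 ≤ r x) :
    ∫ x in α..β, (r2 x - r x) * ((x - α) * (β - x)) ≤ (β - α) * (r α + r β) := by
  have hu : uIcc α β = Icc α β := uIcc_of_le hαβ
  have hcr : ContinuousOn r (Icc α β) := fun x hx => (h1 x hx).continuousAt.continuousWithinAt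
  have hcr1 : ContinuousOn r1 (Icc α β) := fun x hx => (h2 x hx).continuousAt.continuousWithinAt
  have hF : ∀ x ∈ uIcc α β, HasDerivAt
      (fun x => r1 x * ((x - α) * (β - x)) - r x * (α + β - 2 * x))
      (r2 x * ((x - α) * (β - x)) + 2 * r x) x := by
    rw [hu]
    intro x hx
    have e1 : HasDerivAt (fun x => (x - α) * (β - x)) (α + β - 2 * x) x := by
      refine (((hasDerivAt_id x).sub_const α).mul ((hasDerivAt_id x).const_sub β)).congr_deriv ?_
      simp only [id]
      ring
    have e2 : HasDerivAt (fun x => α + β - 2 * x) (-2) x := by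
      simpa using ((hasDerivAt_id x).const_mul 2).const_sub (α + β)
    refine (((h2 x hx).mul e1).sub ((h1 x hx).mul e2)).congr_deriv ?_
    ring
  have h_int : IntervalIntegrable (fun x => r2 x * ((x - α) * (β - x)) + 2 * r x) volume α β := by
    apply ContinuousOn.intervalIntegrable
    rw [hu]
    fun_prop
  have hI := intervalIntegral.integral_eq_sub_of_hasDerivAt hF h_int
  have hle : ∫ x in α..β, (r2 x - r x) * ((x - α) * (β - x)) ≤
      ∫ x in α..β, (r2 x * ((x - α) * (β - x)) + 2 * r x) := by
    refine intervalIntegral.integral_mono_on hαβ ?_ h_int fun x hx => ?_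
    · apply ContinuousOn.intervalIntegrable
      rw [hu]
      fun_prop
    · have := mul_nonneg (hr x hx) (mul_nonneg (sub_nonneg.2 hx.1) (sub_nonneg.2 hx.2))
      nlinarith [hr x hx]
  rw [hI] at hle
  refine hle.trans (le_of_eq ?_)
  ring

/-- The weighted logarithmic difference of two positive solutions on `[α,β]` grows at most with
the lateral values of their difference. -/
lemma log_diff_integral_le {α β T ε : ℝ} (hαβ : α < β)
    {u v u1 v1 u2 v2 : ℝ → ℝ → ℝ}
    (hu : ContinuousOn (fun p : ℝ × ℝ => u p.1 p.2) (Icc α β ×ˢ Icc 0 T))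
    (hv : ContinuousOn (fun p : ℝ × ℝ => v p.1 p.2) (Icc α β ×ˢ Icc 0 T))
    (hu2 : ContinuousOn (fun p : ℝ × ℝ => u2 p.1 p.2) (Icc α β ×ˢ Ioc 0 T))
    (hv2 : ContinuousOn (fun p : ℝ × ℝ => v2 p.1 p.2) (Icc α β ×ˢ Ioc 0 T))
    (hup : ∀ x ∈ Icc α β, ∀ t ∈ Icc 0 T, 0 < u x t)
    (hvp : ∀ x ∈ Icc α β, ∀ t ∈ Icc 0 T, 0 < v x t)
    (hle : ∀ x ∈ Icc α β, ∀ t ∈ Icc 0 T, v x t ≤ u x t)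
    (h0 : ∀ x ∈ Icc α β, u x 0 = v x 0)
    (hu' : ∀ x ∈ Icc α β, ∀ t ∈ Ioo 0 T, HasDerivAt (fun y => u y t) (u1 x t) x ∧
      HasDerivAt (fun y => u1 y t) (u2 x t) x ∧
      HasDerivAt (fun s => u x s) (u x t * (u2 x t + 1 - u x t)) t)
    (hv' : ∀ x ∈ Icc α β, ∀ t ∈ Ioo 0 T, HasDerivAt (fun y => v y t) (v1 x t) x ∧
      HasDerivAt (fun y => v1 y t) (v2 x t) x ∧
      HasDerivAt (fun s => v x s) (v x t * (v2 x t + 1 - v x t)) t)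
    (hε : ∀ t ∈ Icc 0 T, (u α t - v α t) + (u β t - v β t) ≤ ε) :
    ∀ t ∈ Icc 0 T, ∫ x in α..β, (Real.log (u x t) - Real.log (v x t)) * ((x - α) * (β - x)) ≤
      (β - α) * ε * t := by
  set P : ℝ → ℝ → ℝ := fun x t =>
    (Real.log (u x t) - Real.log (v x t)) * ((x - α) * (β - x)) with hP
  set Q : ℝ → ℝ → ℝ := fun x t =>
    ((u2 x t - v2 x t) - (u x t - v x t)) * ((x - α) * (β - x)) with hQ
  have huIoc : uIoc α β ⊆ Icc α β := by rw [uIoc_of_le hαβ.le]; exact Ioc_subset_Icc_self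
  have hPc : ContinuousOn (fun p : ℝ × ℝ => P p.1 p.2) (Icc α β ×ˢ Icc 0 T) := by
    refine ContinuousOn.mul (ContinuousOn.sub (hu.log fun p hp => (hup _ hp.1 _ hp.2).ne')
      (hv.log fun p hp => (hvp _ hp.1 _ hp.2).ne')) (by fun_prop)
  have hQc : ContinuousOn (fun p : ℝ × ℝ => Q p.1 p.2) (Icc α β ×ˢ Ioc 0 T) := by
    have hs : Icc α β ×ˢ Ioc 0 T ⊆ Icc α β ×ˢ Icc 0 T := prod_mono_right Ioc_subset_Icc_self
    exact ContinuousOn.mul ((hu2.sub hv2).sub ((hu.mono hs).sub (hv.mono hs))) (by fun_prop)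
  have hPx : ∀ t ∈ Icc 0 T, ContinuousOn (fun x => P x t) (Icc α β) := fun t ht =>
    ContinuousOn.comp (f := fun x : ℝ => (x, t)) hPc (by fun_prop) (fun x hx => ⟨hx, ht⟩)
  have hQx : ∀ t ∈ Ioc 0 T, ContinuousOn (fun x => Q x t) (Icc α β) := fun t ht =>
    ContinuousOn.comp (f := fun x : ℝ => (x, t)) hQc (by fun_prop) (fun x hx => ⟨hx, ht⟩)
  have hmeas : ∀ {g : ℝ → ℝ}, ContinuousOn g (Icc α β) →
      AEStronglyMeasurable g (volume.restrict (uIoc α β)) := fun hg =>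
    (hg.mono huIoc).aestronglyMeasurable measurableSet_uIoc
  have hIc : ContinuousOn (fun t => ∫ x in α..β, P x t) (Icc 0 T) := by
    obtain ⟨B, hB⟩ := (isCompact_Icc.prod isCompact_Icc).exists_bound_of_continuousOn hPc
    intro t ht
    refine intervalIntegral.continuousWithinAt_of_dominated_interval (bound := fun _ => B)
      ?_ ?_ ?_ ?_
    · filter_upwards [self_mem_nhdsWithin] with s hs using hmeas (hPx s hs)
    · filter_upwards [self_mem_nhdsWithin] with s hs
      exact ae_of_all _ fun x hx => hB (x, s) ⟨huIoc hx, hs⟩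
    · exact intervalIntegrable_const
    · refine ae_of_all _ fun x hx => ?_
      exact ContinuousWithinAt.comp (f := fun s : ℝ => (x, s)) (hPc (x, t) ⟨huIoc hx, ht⟩)
        (by fun_prop) (fun s hs => ⟨huIoc hx, hs⟩)
  have hId : ∀ t ∈ Ioo 0 T, HasDerivAt (fun t => ∫ x in α..β, P x t) (∫ x in α..β, Q x t) t := by
    intro t ht
    have hsub : Icc (t / 2) ((t + T) / 2) ⊆ Ioo 0 T := fun s hs =>
      ⟨by linarith [hs.1, ht.1], by linarith [hs.2, ht.2]⟩
    obtain ⟨B, hB⟩ := (isCompact_Icc.prod isCompact_Icc).exists_bound_of_continuousOn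
      (hQc.mono (prod_mono_right (hsub.trans Ioo_subset_Ioc_self)))
    have hnh : Icc (t / 2) ((t + T) / 2) ∈ 𝓝 t :=
      Icc_mem_nhds (by linarith [ht.1]) (by linarith [ht.2])
    refine (intervalIntegral.hasDerivAt_integral_of_dominated_loc_of_deriv_le (F := fun t x => P x t)
      (F' := fun t x => Q x t) (bound := fun _ => B) hnh ?_ ?_ ?_ ?_ ?_ ?_).2
    · filter_upwards [hnh] with s hs using hmeas (hPx s (Ioo_subset_Icc_self (hsub hs)))
    · apply ContinuousOn.intervalIntegrable
      rw [uIcc_of_le hαβ.le]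
      exact hPx t (Ioo_subset_Icc_self ht)
    · exact hmeas (hQx t (Ioo_subset_Ioc_self ht))
    · exact ae_of_all _ fun x hx s hs => hB (x, s) ⟨huIoc hx, hs⟩
    · exact intervalIntegrable_const
    · refine ae_of_all _ fun x hx s hs => ?_
      have hx' := huIoc hx
      have hs' := hsub hs
      have pu := (hup x hx' s (Ioo_subset_Icc_self hs')).ne'
      have pv := (hvp x hx' s (Ioo_subset_Icc_self hs')).ne'
      have := (((hu' x hx' s hs').2.2.log pu).sub ((hv' x hx' s hs').2.2.log pv)).mul_const
        ((x - α) * (β - x))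
      refine this.congr_deriv ?_
      rw [mul_div_cancel_left₀ _ pu, mul_div_cancel_left₀ _ pv]
      simp only [hQ]
      ring
  have key := le_left_of_hasDerivAt_nonpos (p := 0) (q := T)
    (f := fun t => (∫ x in α..β, P x t) - (β - α) * ε * t)
    (f' := fun t => (∫ x in α..β, Q x t) - (β - α) * ε) (hIc.sub (by fun_prop))
    (fun t ht => (hId t ht).sub (by simpa using (hasDerivAt_id t).const_mul ((β - α) * ε)))
    (fun t ht => ?_)
  · intro t ht
    have h1 := key t ht
    have h2 : ∫ x in α..β, P x 0 = 0 := by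
      rw [intervalIntegral.integral_congr (g := fun _ => (0 : ℝ))]
      · simp
      · rw [uIcc_of_le hαβ.le]
        intro x hx
        simp [hP, h0 x hx]
    simp only [h2, mul_zero, sub_zero] at h1
    linarith
  · have ht' := Ioo_subset_Icc_self ht
    have := integral_second_deriv_mul_le hαβ.le (r := fun x => u x t - v x t)
      (r1 := fun x => u1 x t - v1 x t) (r2 := fun x => u2 x t - v2 x t)
      (fun x hx => (hu' x hx t ht).1.sub (hv' x hx t ht).1)
      (fun x hx => (hu' x hx t ht).2.1.sub (hv' x hx t ht).2.1)
      (ContinuousOn.comp (f := fun x : ℝ => (x, t)) (hu2.sub hv2) (by fun_prop)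
        (fun x hx => ⟨hx, Ioo_subset_Ioc_self ht⟩))
      (fun x hx => sub_nonneg.2 (hle x hx t ht'))
    have h3 : (β - α) * ((u α t - v α t) + (u β t - v β t)) ≤ (β - α) * ε :=
      mul_le_mul_of_nonneg_left (hε t ht') (by linarith)
    show (∫ x in α..β, Q x t) - (β - α) * ε ≤ 0
    simp only [hQ]
    linarith

/-- Ordered positive solutions of the degenerate problem coincide. -/
theorem IsDegSol.eq_of_le {a b T : ℝ} (hab : a < b) (hT : 0 < T) {f : ℝ → ℝ}
    {u v : ℝ → ℝ → ℝ} (hfa : f a = 0) (hfb : f b = 0) (hfp : ∀ x ∈ Ioo a b, 0 < f x)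
    (hu : IsDegSol a b T f u) (hv : IsDegSol a b T f v)
    (hle : ∀ x ∈ Icc a b, ∀ t ∈ Icc 0 T, v x t ≤ u x t) :
    ∀ x ∈ Icc a b, ∀ t ∈ Icc 0 T, v x t = u x t := by
  have ha : a ∈ Icc a b := ⟨le_rfl, hab.le⟩
  have hb : b ∈ Icc a b := ⟨hab.le, le_rfl⟩
  have zero : ∀ {w : ℝ → ℝ → ℝ}, IsDegSol a b T f w → ∀ t ∈ Icc 0 T, w a t = 0 ∧ w b t = 0 := by
    intro w hw t ht
    rcases ht.1.eq_or_lt with rfl | h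
    · rw [hw.2.2.1 a ha, hw.2.2.1 b hb]; exact ⟨hfa, hfb⟩
    · exact hw.2.1 t ⟨h, ht.2⟩
  have pos : ∀ {w : ℝ → ℝ → ℝ}, IsDegSol a b T f w → ∀ x ∈ Ioo a b, ∀ t ∈ Icc 0 T, 0 < w x t := by
    intro w hw x hx t ht
    rcases ht.1.eq_or_lt with rfl | h
    · rw [hw.2.2.1 x (Ioo_subset_Icc_self hx)]; exact hfp x hx
    · exact hw.2.2.2.1 x hx t ⟨h, ht.2⟩
  have der : ∀ {w : ℝ → ℝ → ℝ}, IsDegSol a b T f w → ∀ x ∈ Ioo a b, ∀ t ∈ Ioo 0 T,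
      HasDerivAt (fun y => w y t) (deriv (fun z => w z t) x) x ∧
      HasDerivAt (fun y => deriv (fun z => w z t) y)
        (deriv (fun y => deriv (fun z => w z t) y) x) x ∧
      HasDerivAt (fun s => w x s)
        (w x t * (deriv (fun y => deriv (fun z => w z t) y) x + 1 - w x t)) t := by
    intro w hw x hx t ht
    obtain ⟨h1, h2, h3, h4⟩ := hw.2.2.2.2.1 x hx t (Ioo_subset_Ioc_self ht)
    refine ⟨h1.hasDerivAt, h2.hasDerivAt, ?_⟩
    have := h3.hasDerivWithinAt
    rw [h4] at this
    rw [show w x t * (deriv (fun y => deriv (fun z => w z t) y) x + 1 - w x t)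
      = w x t * deriv (fun y => deriv (fun z => w z t) y) x + w x t * (1 - w x t) by ring]
    exact this.hasDerivAt (Iic_mem_nhds ht.2)
  intro x₀ hx₀ t₀ ht₀
  rcases hx₀.1.eq_or_lt with rfl | hax
  · rw [(zero hu t₀ ht₀).1, (zero hv t₀ ht₀).1]
  rcases hx₀.2.eq_or_lt with rfl | hxb
  · rw [(zero hu t₀ ht₀).2, (zero hv t₀ ht₀).2]
  by_contra hne
  have hlt : v x₀ t₀ < u x₀ t₀ := lt_of_le_of_ne (hle x₀ hx₀ t₀ ht₀) hne
  set p : ℝ → ℝ := fun x => Real.log (u x t₀) - Real.log (v x t₀) with hp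
  have hslice : ∀ {w : ℝ → ℝ → ℝ}, IsDegSol a b T f w → ContinuousOn (fun x => w x t₀) (Icc a b) :=
    fun hw => ContinuousOn.comp (f := fun x : ℝ => (x, t₀)) hw.1 (by fun_prop)
      (fun x hx => ⟨hx, ht₀⟩)
  have hpc : ContinuousOn p (Ioo a b) :=
    ((hslice hu).mono Ioo_subset_Icc_self |>.log fun x hx => (pos hu x hx t₀ ht₀).ne').sub
      ((hslice hv).mono Ioo_subset_Icc_self |>.log fun x hx => (pos hv x hx t₀ ht₀).ne')
  have hp0 : ∀ x ∈ Ioo a b, 0 ≤ p x := fun x hx => sub_nonneg.2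
    (Real.log_le_log (pos hv x hx t₀ ht₀) (hle x (Ioo_subset_Icc_self hx) t₀ ht₀))
  have hpx₀ : 0 < p x₀ := sub_pos.2 (Real.log_lt_log (pos hv x₀ ⟨hax, hxb⟩ t₀ ht₀) hlt)
  obtain ⟨α₀, hα₀⟩ := exists_between hax
  obtain ⟨β₀, hβ₀⟩ := exists_between hxb
  have hsub₀ : Icc α₀ β₀ ⊆ Ioo a b := fun x hx => ⟨hα₀.1.trans_le hx.1, hx.2.trans_lt hβ₀.2⟩
  have hαβ₀ : α₀ < β₀ := hα₀.2.trans hβ₀.1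
  set κ := ∫ x in α₀..β₀, p x * ((x - α₀) * (β₀ - x)) with hκ
  have hκpos : 0 < κ := by
    refine intervalIntegral.integral_pos hαβ₀ ((hpc.mono hsub₀).mul (by fun_prop))
      (fun x hx => ?_) ⟨x₀, ⟨hα₀.2.le, hβ₀.1.le⟩, ?_⟩
    · exact mul_nonneg (hp0 x (hsub₀ ⟨hx.1.le, hx.2⟩))
        (mul_nonneg (by linarith [hx.1]) (by linarith [hx.2]))
    · exact mul_pos hpx₀ (mul_pos (by linarith [hα₀.2]) (by linarith [hβ₀.1]))
  set ε := κ / (2 * ((b - a) * T)) with hεd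
  have hLT : 0 < (b - a) * T := mul_pos (sub_pos.2 hab) hT
  have hε : 0 < ε := by positivity
  obtain ⟨δ₁, hδ₁, hd₁⟩ := exists_small_near_zero hu.1 a ha (fun t ht => (zero hu t ht).1)
    (half_pos hε)
  obtain ⟨δ₂, hδ₂, hd₂⟩ := exists_small_near_zero hu.1 b hb (fun t ht => (zero hu t ht).2)
    (half_pos hε)
  obtain ⟨α, hα⟩ := exists_between (show a < min (a + δ₁) α₀ from lt_min (by linarith) hα₀.1)
  obtain ⟨β, hβ⟩ := exists_between (show max (b - δ₂) β₀ < b from max_lt (by linarith) hβ₀.2)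
  have hα' := lt_min_iff.1 hα.2
  have hβ' := max_lt_iff.1 hβ.1
  have hαβ : α < β := hα'.2.trans (hαβ₀.trans hβ'.2)
  have hsub : Icc α β ⊆ Ioo a b := fun x hx => ⟨hα.1.trans_le hx.1, hx.2.trans_lt hβ.2⟩
  have hsub' : Icc α β ⊆ Icc a b := hsub.trans Ioo_subset_Icc_self
  have huα : ∀ t ∈ Icc 0 T, u α t < ε / 2 := fun t ht => (le_abs_self _).trans_lt
    (hd₁ α (hsub' ⟨le_rfl, hαβ.le⟩) (by rw [abs_of_pos] <;> linarith [hα.1]) t ht)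
  have huβ : ∀ t ∈ Icc 0 T, u β t < ε / 2 := fun t ht => (le_abs_self _).trans_lt
    (hd₂ β (hsub' ⟨hαβ.le, le_rfl⟩) (by rw [abs_of_neg] <;> linarith [hβ.2]) t ht)
  have main := log_diff_integral_le (ε := ε) hαβ
    (u1 := fun x t => deriv (fun z => u z t) x)
    (v1 := fun x t => deriv (fun z => v z t) x)
    (u2 := fun x t => deriv (fun y => deriv (fun z => u z t) y) x)
    (v2 := fun x t => deriv (fun y => deriv (fun z => v z t) y) x)
    (hu.1.mono (prod_mono_left hsub')) (hv.1.mono (prod_mono_left hsub'))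
    (hu.2.2.2.2.2.2.1.mono (prod_mono_left hsub)) (hv.2.2.2.2.2.2.1.mono (prod_mono_left hsub))
    (fun x hx => pos hu x (hsub hx)) (fun x hx => pos hv x (hsub hx))
    (fun x hx => hle x (hsub' hx))
    (fun x hx => by rw [hu.2.2.1 x (hsub' hx), hv.2.2.1 x (hsub' hx)])
    (fun x hx => der hu x (hsub hx)) (fun x hx => der hv x (hsub hx))
    (fun t ht => by
      have h1 := pos hv α (hsub ⟨le_rfl, hαβ.le⟩) t ht
      have h2 := pos hv β (hsub ⟨hαβ.le, le_rfl⟩) t ht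
      linarith [huα t ht, huβ t ht]) t₀ ht₀
  have hcI : ContinuousOn (fun x => p x * ((x - α) * (β - x))) (Icc α β) :=
    (hpc.mono hsub).mul (by fun_prop)
  have hlow : κ ≤ ∫ x in α..β, p x * ((x - α) * (β - x)) := by
    have s1 : κ ≤ ∫ x in α₀..β₀, p x * ((x - α) * (β - x)) := by
      refine intervalIntegral.integral_mono_on hαβ₀.le ?_ ?_ fun x hx => ?_
      · apply ContinuousOn.intervalIntegrable
        rw [uIcc_of_le hαβ₀.le]
        exact (hpc.mono hsub₀).mul (by fun_prop)
      · apply ContinuousOn.intervalIntegrable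
        rw [uIcc_of_le hαβ₀.le]
        exact hcI.mono (Icc_subset_Icc hα'.2.le hβ'.2.le)
      · refine mul_le_mul_of_nonneg_left ?_ (hp0 x (hsub₀ hx))
        exact mul_le_mul (by linarith [hα'.2]) (by linarith [hβ'.2]) (by linarith [hx.2])
          (by linarith [hx.1, hα'.2])
    refine s1.trans (intervalIntegral.integral_mono_interval hα'.2.le hαβ₀.le hβ'.2.le ?_ ?_)
    · rw [EventuallyLE, ae_restrict_iff' measurableSet_Ioc]
      refine ae_of_all _ fun x hx => ?_
      exact mul_nonneg (hp0 x (hsub ⟨hx.1.le, hx.2⟩))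
        (mul_nonneg (by linarith [hx.1]) (by linarith [hx.2]))
    · apply ContinuousOn.intervalIntegrable
      rw [uIcc_of_le hαβ.le]
      exact hcI
  have hup : (β - α) * ε * t₀ ≤ κ / 2 := by
    have h1 : (β - α) * ε * t₀ ≤ (b - a) * ε * T := by
      have : β - α ≤ b - a := by linarith [hα.1, hβ.2]
      have h0 : 0 ≤ b - a := by linarith
      exact mul_le_mul (mul_le_mul_of_nonneg_right this hε.le) ht₀.2 ht₀.1 (by positivity)
    have h2 : (b - a) * ε * T = κ / 2 := by
      rw [hεd]
      have : b - a ≠ 0 := (sub_pos.2 hab).ne'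
      field_simp
    linarith
  linarith

/-- A solution of the spatially discretised problem: `u j t` approximates the solution at the
`j`-th grid point of a grid of size `h`, with `u = c` at the sites `0` and `j ≥ N`. -/
structure DSol (N : ℕ) (h c M T : ℝ) (u : ℕ → ℝ → ℝ) : Prop where
  hpos : 0 < h
  cpos : 0 < c
  cle : c ≤ 1
  leM : 1 ≤ M
  lower : ∀ j, ∀ t ∈ Icc 0 T, c ≤ u j t
  upper : ∀ j, ∀ t ∈ Icc 0 T, u j t ≤ M
  left : ∀ t ∈ Icc 0 T, u 0 t = c
  right : ∀ j, N ≤ j → ∀ t ∈ Icc 0 T, u j t = c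
  cont : ∀ j, ContinuousOn (u j) (Icc 0 T)
  ode : ∀ j, j + 1 < N → ∀ t ∈ Ioc 0 T, HasDerivAt (u (j + 1))
    (u (j + 1) t * ((u (j + 2) t - 2 * u (j + 1) t + u j t) / h ^ 2 + 1 - u (j + 1) t)) t

lemma le_of_hasDerivAt_nonneg_below {c T : ℝ} {f f' : ℝ → ℝ}
    (hf : ∀ t ∈ Icc 0 T, HasDerivAt f (f' t) t) (h0 : c ≤ f 0)
    (h : ∀ t ∈ Icc 0 T, f t ≤ c → 0 ≤ f' t) : ∀ t ∈ Icc 0 T, c ≤ f t := by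
  intro t ht
  have key : ∀ ε > 0, c - ε * (1 + t) ≤ f t := by
    intro ε hε
    have := image_le_of_deriv_right_lt_deriv_boundary' (f := fun s => - f s)
      (f' := fun s => - f' s) (a := 0) (b := T) (B := fun s => ε * (1 + s) - c)
      (B' := fun _ => ε)
      (fun s hs => (hf s hs).neg.continuousAt.continuousWithinAt)
      (fun s hs => (hf s (Ico_subset_Icc_self hs)).neg.hasDerivWithinAt)
      (by linarith)
      (by fun_prop)
      (fun s _ => by
        simpa using ((((hasDerivAt_id s).const_add 1).const_mul ε).sub_const c).hasDerivWithinAt)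
      (fun s hs he => by
        have := h s (Ico_subset_Icc_self hs) (by
          have : 0 ≤ ε * (1 + s) := mul_nonneg hε.le (by linarith [hs.1])
          linarith)
        linarith) ht
    linarith
  refine le_of_forall_pos_sub_le fun ε hε => ?_
  have h1 : 0 < 1 + t := by linarith [ht.1]
  have := key (ε / (1 + t)) (by positivity)
  rwa [div_mul_cancel₀ _ h1.ne'] at this

section Clamp

variable (c M h : ℝ)

/-- Truncation of a real number to `[c, M]`. -/
noncomputable def clampTo (x : ℝ) : ℝ := max c (min x M)

lemma clampTo_mem (hcM : c ≤ M) (x : ℝ) : clampTo c M x ∈ Icc c M :=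
  ⟨le_max_left _ _, max_le hcM (min_le_right _ _)⟩

lemma abs_clampTo_sub_le (x y : ℝ) : |clampTo c M x - clampTo c M y| ≤ |x - y| := by
  refine (abs_max_sub_max_le_max c (min x M) c (min y M)).trans ?_
  simp only [sub_self, abs_zero]
  refine max_le (abs_nonneg _) ((abs_min_sub_min_le_max x M y M).trans ?_)
  simp

/-- The discrete speed in terms of a value and its right and left neighbours. -/
noncomputable def speed (r p l : ℝ) : ℝ := p * ((r - 2 * p + l) / h ^ 2 + 1 - p)

variable {c M h}

lemma clampTo_eq {x : ℝ} (hx : x ∈ Icc c M) : clampTo c M x = x := by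
  rw [clampTo, min_eq_left hx.2, max_eq_right hx.1]

lemma clampTo_of_le {x : ℝ} (hcM : c ≤ M) (hx : x ≤ c) : clampTo c M x = c := by
  rw [clampTo, min_eq_left (hx.trans hcM), max_eq_left hx]

lemma clampTo_of_ge {x : ℝ} (hcM : c ≤ M) (hx : M ≤ x) : clampTo c M x = M := by
  rw [clampTo, min_eq_right hx, max_eq_right hcM]

lemma abs_bracket_le (hh : 0 < h) {r p l : ℝ} (hr : r ∈ Icc 0 M)
    (hp : p ∈ Icc 0 M) (hl : l ∈ Icc 0 M) :
    |(r - 2 * p + l) / h ^ 2 + 1 - p| ≤ 2 * M / h ^ 2 + 1 + M := by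
  have h2 : 0 < h ^ 2 := by positivity
  have e : |(r - 2 * p + l) / h ^ 2| ≤ 2 * M / h ^ 2 := by
    rw [abs_div, abs_of_pos h2]
    gcongr
    rw [abs_le]
    constructor <;> linarith [hr.1, hr.2, hp.1, hp.2, hl.1, hl.2]
  rw [abs_le] at *
  constructor <;> linarith [hp.1, hp.2, e.1, e.2]

lemma abs_speed_le (hh : 0 < h) {r p l : ℝ} (hr : r ∈ Icc 0 M)
    (hp : p ∈ Icc 0 M) (hl : l ∈ Icc 0 M) :
    |speed h r p l| ≤ M * (2 * M / h ^ 2 + 1 + M) := by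
  rw [speed, abs_mul, abs_of_nonneg hp.1]
  exact mul_le_mul hp.2 (abs_bracket_le hh hr hp hl) (abs_nonneg _) (hp.1.trans hp.2)

lemma abs_speed_sub_le (hh : 0 < h) {r p l r' p' l' ε : ℝ} (hr : r ∈ Icc 0 M)
    (hp : p ∈ Icc 0 M) (hl : l ∈ Icc 0 M)
    (hp' : p' ∈ Icc 0 M) (er : |r - r'| ≤ ε) (ep : |p - p'| ≤ ε)
    (el : |l - l'| ≤ ε) :
    |speed h r p l - speed h r' p' l'| ≤
      ((2 * M / h ^ 2 + 1 + M) + M * (4 / h ^ 2 + 1)) * ε := by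
  have h2 : 0 < h ^ 2 := by positivity
  have hε : 0 ≤ ε := (abs_nonneg _).trans er
  have e1 : |((r - r') - 2 * (p - p') + (l - l')) / h ^ 2 - (p - p')| ≤ (4 / h ^ 2 + 1) * ε := by
    have e : |((r - r') - 2 * (p - p') + (l - l')) / h ^ 2| ≤ 4 * ε / h ^ 2 := by
      rw [abs_div, abs_of_pos h2]
      gcongr
      rw [abs_le] at *
      constructor <;> linarith [er.1, er.2, ep.1, ep.2, el.1, el.2]
    have : (4 / h ^ 2 + 1) * ε = 4 * ε / h ^ 2 + ε := by ring
    rw [this]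
    rw [abs_le] at *
    constructor <;> linarith [ep.1, ep.2, e.1, e.2]
  have e2 : speed h r p l - speed h r' p' l' =
      (p - p') * ((r - 2 * p + l) / h ^ 2 + 1 - p) +
      p' * (((r - r') - 2 * (p - p') + (l - l')) / h ^ 2 - (p - p')) := by
    simp only [speed]; ring
  rw [e2]
  refine (abs_add_le _ _).trans ?_
  rw [abs_mul, abs_mul, abs_of_nonneg hp'.1]
  have e3 := mul_le_mul ep (abs_bracket_le hh hr hp hl) (abs_nonneg _) hε
  have e4 := mul_le_mul hp'.2 e1 (abs_nonneg _) (hp'.1.trans hp'.2)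
  linarith

end Clamp

/-- Extension of a finite vector by the constant `c`. -/
noncomputable def extendBy (c : ℝ) {N : ℕ} (w : Fin N → ℝ) (j : ℕ) : ℝ :=
  if hj : j < N then w ⟨j, hj⟩ else c

lemma abs_extendBy_sub_le (c : ℝ) {N : ℕ} (w w' : Fin N → ℝ) (j : ℕ) :
    |extendBy c w j - extendBy c w' j| ≤ dist w w' := by
  unfold extendBy
  split_ifs with hj
  · exact dist_le_pi_dist w w' ⟨j, hj⟩
  · simp

/-- The truncated discrete vector field. -/
noncomputable def gridField (h c M : ℝ) (N : ℕ) (w : Fin N → ℝ) (i : Fin N) : ℝ :=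
  if i.1 = 0 then 0 else
    speed h (clampTo c M (extendBy c w (i.1 + 1))) (clampTo c M (extendBy c w i.1))
      (clampTo c M (extendBy c w (i.1 - 1)))

theorem exists_dSol {N : ℕ} {h c M T : ℝ} (hh : 0 < h) (hc : 0 < c) (hc1 : c ≤ 1) (hM : 1 ≤ M)
    (hT : 0 < T) {f : ℕ → ℝ} (hf : ∀ j, f j ∈ Icc c M) (hf0 : f 0 = c)
    (hfN : ∀ j, N ≤ j → f j = c) :
    ∃ u, DSol N h c M T u ∧ ∀ j, u j 0 = f j := by
  have hcM : c ≤ M := hc1.trans hM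
  have hM0 : 0 ≤ M := by linarith
  have cm : ∀ x, clampTo c M x ∈ Icc 0 M := fun x =>
    ⟨hc.le.trans (clampTo_mem c M hcM x).1, (clampTo_mem c M hcM x).2⟩
  set K : ℝ := (2 * M / h ^ 2 + 1 + M) + M * (4 / h ^ 2 + 1) with hK
  set L : ℝ := M * (2 * M / h ^ 2 + 1 + M) with hL
  have hK0 : 0 ≤ K := by positivity
  have hL0 : 0 ≤ L := by positivity
  have hlip : ∀ w w' : Fin N → ℝ, dist (gridField h c M N w) (gridField h c M N w') ≤
      K * dist w w' := by
    intro w w'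
    refine (dist_pi_le_iff (by positivity)).2 fun i => ?_
    unfold gridField
    split_ifs with hi
    · simp; positivity
    · have e : ∀ j, |clampTo c M (extendBy c w j) - clampTo c M (extendBy c w' j)| ≤ dist w w' :=
        fun j => (abs_clampTo_sub_le c M _ _).trans (abs_extendBy_sub_le c w w' j)
      exact abs_speed_sub_le hh (cm _) (cm _) (cm _) (cm _) (e _) (e _) (e _)
  have hbd : ∀ w : Fin N → ℝ, ‖gridField h c M N w‖ ≤ L := by
    intro w
    refine (pi_norm_le_iff_of_nonneg hL0).2 fun i => ?_
    unfold gridField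
    split_ifs with hi
    · simpa using hL0
    · exact abs_speed_le hh (cm _) (cm _) (cm _)
  have h0mem : (0 : ℝ) ∈ Icc (-1) (T + 1) := ⟨by norm_num, by linarith⟩
  have hPL : IsPicardLindelof (fun _ : ℝ => gridField h c M N) (⟨0, h0mem⟩ : Icc (-1) (T + 1))
      (fun i : Fin N => f i) (L.toNNReal * (T + 1).toNNReal) 0 L.toNNReal K.toNNReal := by
    refine ⟨fun t _ => ?_, fun x _ => continuousOn_const, fun t _ x _ => ?_, ?_⟩
    · refine (LipschitzWith.of_dist_le_mul fun w w' => ?_).lipschitzOnWith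
      rw [Real.coe_toNNReal _ hK0]
      exact hlip w w'
    · rw [Real.coe_toNNReal _ hL0]; exact hbd x
    · have : max (T + 1 - 0) (0 - (-1)) = T + 1 := by
        rw [max_eq_left]; · ring
        · linarith
      simp only [NNReal.coe_mul, NNReal.coe_zero]
      rw [this, Real.coe_toNNReal (T + 1) (by linarith), sub_zero]
  obtain ⟨α, hα0, hα⟩ := hPL.exists_eq_forall_mem_Icc_hasDerivWithinAt₀
  set u : ℕ → ℝ → ℝ := fun j t => extendBy c (α t) j with hu
  set u' : ℕ → ℝ → ℝ := fun j t => if j = 0 ∨ N ≤ j then 0 else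
    speed h (clampTo c M (u (j + 1) t)) (clampTo c M (u j t)) (clampTo c M (u (j - 1) t)) with hu'
  have hd : ∀ j, ∀ t ∈ Icc 0 T, HasDerivAt (u j) (u' j t) t := by
    intro j t ht
    by_cases hj : j < N
    · have h1 := (hα t ⟨by linarith [ht.1], by linarith [ht.2]⟩).hasDerivAt
        (Icc_mem_nhds (by linarith [ht.1]) (by linarith [ht.2]))
      have h2 := (hasDerivAt_pi.1 h1) ⟨j, hj⟩
      have e1 : u j = fun t => α t ⟨j, hj⟩ := by
        funext t; simp [hu, extendBy, hj]
      rw [e1]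
      refine h2.congr_deriv ?_
      simp only [gridField, hu', not_le.2 hj, or_false, hu]
    · have e1 : u j = fun _ => c := by
        funext t; simp [hu, extendBy, hj]
      rw [e1]
      simpa [hu', not_lt.1 hj] using hasDerivAt_const t c
  have hu0 : ∀ j, u j 0 = f j := by
    intro j
    have hα0' : α 0 = fun i : Fin N => f i := hα0
    by_cases hj : j < N
    · simp [hu, extendBy, hj, hα0']
    · simp [hu, extendBy, hj, hfN j (not_lt.1 hj)]
  have hlow : ∀ j, ∀ t ∈ Icc 0 T, c ≤ u j t := by
    intro j
    refine le_of_hasDerivAt_nonneg_below (hd j) (by rw [hu0]; exact (hf j).1) fun t ht hle => ?_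
    simp only [hu']
    split_ifs with hj
    · exact le_rfl
    · rw [clampTo_of_le hcM hle, speed]
      refine mul_nonneg hc.le ?_
      have h1 := (clampTo_mem c M hcM (u (j + 1) t)).1
      have h2 := (clampTo_mem c M hcM (u (j - 1) t)).1
      have : 0 ≤ (clampTo c M (u (j + 1) t) - 2 * c + clampTo c M (u (j - 1) t)) / h ^ 2 :=
        div_nonneg (by linarith) (by positivity)
      linarith
  have hupp : ∀ j, ∀ t ∈ Icc 0 T, u j t ≤ M := by
    intro j
    have := le_of_hasDerivAt_nonneg_below (c := -M) (f := fun t => - u j t)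
      (fun t ht => (hd j t ht).neg) (by rw [hu0]; exact neg_le_neg (hf j).2) fun t ht hle => ?_
    · intro t ht
      linarith [this t ht]
    · have hle' : M ≤ u j t := by linarith
      simp only [hu']
      split_ifs with hj
      · simp
      · rw [clampTo_of_ge hcM hle', speed, neg_nonneg]
        refine mul_nonpos_of_nonneg_of_nonpos hM0 ?_
        have h1 := (clampTo_mem c M hcM (u (j + 1) t)).2
        have h2 := (clampTo_mem c M hcM (u (j - 1) t)).2
        have : (clampTo c M (u (j + 1) t) - 2 * M + clampTo c M (u (j - 1) t)) / h ^ 2 ≤ 0 :=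
          div_nonpos_of_nonpos_of_nonneg (by linarith) (by positivity)
        linarith
  have hfix : ∀ j, j = 0 ∨ N ≤ j → ∀ t ∈ Icc 0 T, u j t = c := by
    intro j hj t ht
    have hfj : u j 0 = c := by
      rw [hu0]
      rcases hj with rfl | hj
      · exact hf0
      · exact hfN j hj
    refine le_antisymm ?_ (hlow j t ht)
    have := le_of_hasDerivAt_nonneg_below (c := -c) (f := fun t => - u j t)
      (fun t ht => (hd j t ht).neg) (by rw [hfj]) (fun t ht _ => by simp [hu', hj]) t ht
    linarith
  refine ⟨u, ⟨hh, hc, hc1, hM, hlow, hupp, hfix 0 (Or.inl rfl), fun j hj => hfix j (Or.inr hj),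
    fun j t ht => (hd j t ht).continuousAt.continuousWithinAt, fun j hj t ht => ?_⟩, hu0⟩
  have ht' := Ioc_subset_Icc_self ht
  refine (hd (j + 1) t ht').congr_deriv ?_
  have e : ∀ i, clampTo c M (u i t) = u i t := fun i => clampTo_eq ⟨hlow i t ht', hupp i t ht'⟩
  have hj' : ¬ (j + 1 = 0 ∨ N ≤ j + 1) := by omega
  simp only [hu', hj', if_false, e, speed]
  rfl

/-- A discrete minimum principle. -/
lemma discrete_nonneg {N : ℕ} {T : ℝ} (hT : 0 ≤ T) {d d' : ℕ → ℝ → ℝ}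
    (hc : ∀ j, ContinuousOn (d j) (Icc 0 T)) (h0 : ∀ j ≤ N, 0 ≤ d j 0)
    (hl : ∀ t ∈ Icc 0 T, 0 ≤ d 0 t) (hr : ∀ t ∈ Icc 0 T, 0 ≤ d N t)
    (hd : ∀ j, j + 1 < N → ∀ t ∈ Ioc 0 T, HasDerivAt (d (j + 1)) (d' j t) t)
    (hmin : ∀ j, j + 1 < N → ∀ t ∈ Ioc 0 T, d (j + 1) t < 0 → d (j + 1) t ≤ d j t →
      d (j + 1) t ≤ d (j + 2) t → 0 < d' j t) :
    ∀ j ≤ N, ∀ t ∈ Icc 0 T, 0 ≤ d j t := by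
  have hex : ∀ j, ∃ τ ∈ Icc 0 T, ∀ t ∈ Icc 0 T, d j τ ≤ d j t := fun j =>
    isCompact_Icc.exists_isMinOn (nonempty_Icc.2 hT) (hc j)
  choose τ hτ hτmin using hex
  obtain ⟨j, hj, hjmin⟩ := Finset.exists_min_image (Finset.range (N + 1)) (fun j => d j (τ j))
    ⟨0, by simp⟩
  rw [Finset.mem_range] at hj
  have glob : ∀ i ≤ N, ∀ t ∈ Icc 0 T, d j (τ j) ≤ d i t := fun i hi t ht =>
    (hjmin i (by rw [Finset.mem_range]; omega)).trans (hτmin i t ht)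
  suffices 0 ≤ d j (τ j) from fun i hi t ht => this.trans (glob i hi t ht)
  by_contra! hneg
  have ht0 : 0 < τ j := by
    rcases (hτ j).1.eq_or_lt with h | h
    · rw [← h] at hneg; exact absurd (h0 j (by omega)) (not_le.2 hneg)
    · exact h
  have hj0 : j ≠ 0 := by
    rintro rfl; exact absurd (hl _ (hτ 0)) (not_le.2 hneg)
  have hjN : j ≠ N := by
    rintro rfl; exact absurd (hr _ (hτ j)) (not_le.2 hneg)
  obtain ⟨i, rfl⟩ := Nat.exists_eq_succ_of_ne_zero hj0
  have hi : i + 1 < N := by simp only [Nat.succ_eq_add_one] at hj hjN; omega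
  have htI : τ (i + 1) ∈ Ioc 0 T := ⟨ht0, (hτ _).2⟩
  have h1 := hmin i hi _ htI hneg (glob i (by omega) _ (hτ _)) (glob (i + 2) (by omega) _ (hτ _))
  have h2 := time_deriv_nonpos_of_min htI (hd i hi _ htI).hasDerivWithinAt
    fun s hs => hτmin (i + 1) s ⟨hs.1, hs.2.le.trans htI.2⟩
  linarith

lemma second_diff_sq (p s h K : ℝ) (j : ℕ) :
    K * (p + ((j + 2 : ℕ) : ℝ) * h - s) ^ 2 - 2 * (K * (p + ((j + 1 : ℕ) : ℝ) * h - s) ^ 2) +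
      K * (p + (j : ℝ) * h - s) ^ 2 = 2 * K * h ^ 2 := by
  push_cast; ring

section Barriers

variable {N : ℕ} {h c M T : ℝ} {u : ℕ → ℝ → ℝ}

theorem DSol.upper_barrier (hu : DSol N h c M T u) (hT : 0 ≤ T) {p s A K Λ : ℝ} (hK : 0 ≤ K)
    (hΛ : M * (2 * K + 1) < Λ) (h0 : ∀ j ≤ N, u j 0 ≤ A + K * (p + (j : ℝ) * h - s) ^ 2) :
    ∀ j ≤ N, ∀ t ∈ Icc 0 T, u j t ≤ A + K * (p + (j : ℝ) * h - s) ^ 2 + Λ * t := by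
  have h2 : 0 < h ^ 2 := pow_pos hu.hpos 2
  have hM := hu.leM
  have hΛ0 : 0 ≤ Λ := by
    have : 0 ≤ M * (2 * K + 1) := by positivity
    linarith
  have hz : (0 : ℝ) ∈ Icc 0 T := ⟨le_rfl, hT⟩
  have := discrete_nonneg (N := N) hT
    (d := fun j t => A + K * (p + (j : ℝ) * h - s) ^ 2 + Λ * t - u j t)
    (d' := fun j t => Λ - (u (j + 1) t *
      ((u (j + 2) t - 2 * u (j + 1) t + u j t) / h ^ 2 + 1 - u (j + 1) t)))
    (fun j => ContinuousOn.sub (by fun_prop) (hu.cont j)) (fun j hj => by linarith [h0 j hj])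
    (fun t ht => by
      have := h0 0 (Nat.zero_le _)
      have := mul_nonneg hΛ0 ht.1
      rw [hu.left _ hz] at *
      rw [hu.left t ht]; linarith)
    (fun t ht => by
      have := h0 N le_rfl
      have := mul_nonneg hΛ0 ht.1
      rw [hu.right _ le_rfl _ hz] at *
      rw [hu.right _ le_rfl t ht]; linarith)
    (fun j hj t ht => by
      refine HasDerivAt.sub ?_ (hu.ode j hj t ht)
      exact (hasDerivAt_const_mul Λ).const_add _)
    (fun j hj t ht hneg hm1 hm2 => by
      have ht' := Ioc_subset_Icc_self ht
      have hu0 := hu.cpos.le.trans (hu.lower (j + 1) t ht')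
      have huM := hu.upper (j + 1) t ht'
      have e := second_diff_sq p s h K j
      have hD : (u (j + 2) t - 2 * u (j + 1) t + u j t) / h ^ 2 ≤ 2 * K := by
        rw [div_le_iff₀ h2]; linarith
      have h3 : u (j + 1) t * ((u (j + 2) t - 2 * u (j + 1) t + u j t) / h ^ 2 + 1 - u (j + 1) t) ≤
          M * (2 * K + 1) :=
        (mul_le_mul_of_nonneg_left (by linarith : _ ≤ 2 * K + 1) hu0).trans
          (mul_le_mul_of_nonneg_right huM (by positivity))
      show 0 < Λ - _
      linarith)
  intro j hj t ht
  linarith [this j hj t ht]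

theorem DSol.lower_barrier (hu : DSol N h c M T u) (hT : 0 ≤ T) {p s A K Λ : ℝ} (hK : 0 ≤ K)
    (hΛ : M * (2 * K + M) < Λ) (h0 : ∀ j ≤ N, A - K * (p + (j : ℝ) * h - s) ^ 2 ≤ u j 0) :
    ∀ j ≤ N, ∀ t ∈ Icc 0 T, A - K * (p + (j : ℝ) * h - s) ^ 2 - Λ * t ≤ u j t := by
  have h2 : 0 < h ^ 2 := pow_pos hu.hpos 2
  have hM := hu.leM
  have hΛ0 : 0 ≤ Λ := by
    have : 0 ≤ M * (2 * K + M) := by positivity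
    linarith
  have hz : (0 : ℝ) ∈ Icc 0 T := ⟨le_rfl, hT⟩
  have := discrete_nonneg (N := N) hT
    (d := fun j t => u j t + (K * (p + (j : ℝ) * h - s) ^ 2 + Λ * t - A))
    (d' := fun j t => u (j + 1) t *
      ((u (j + 2) t - 2 * u (j + 1) t + u j t) / h ^ 2 + 1 - u (j + 1) t) + Λ)
    (fun j => (hu.cont j).add (by fun_prop)) (fun j hj => by linarith [h0 j hj])
    (fun t ht => by
      have := h0 0 (Nat.zero_le _)
      have := mul_nonneg hΛ0 ht.1
      rw [hu.left _ hz] at *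
      rw [hu.left t ht]; linarith)
    (fun t ht => by
      have := h0 N le_rfl
      have := mul_nonneg hΛ0 ht.1
      rw [hu.right _ le_rfl _ hz] at *
      rw [hu.right _ le_rfl t ht]; linarith)
    (fun j hj t ht => by
      refine HasDerivAt.add (hu.ode j hj t ht) ?_
      exact ((hasDerivAt_const_mul Λ).const_add _).sub_const A)
    (fun j hj t ht hneg hm1 hm2 => by
      have ht' := Ioc_subset_Icc_self ht
      have hu0 := hu.cpos.le.trans (hu.lower (j + 1) t ht')
      have huM := hu.upper (j + 1) t ht'
      have e := second_diff_sq p s h K j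
      have hD : -(2 * K) ≤ (u (j + 2) t - 2 * u (j + 1) t + u j t) / h ^ 2 := by
        rw [le_div_iff₀ h2]; linarith
      have h3 : u (j + 1) t * (2 * K + M) ≤ M * (2 * K + M) :=
        mul_le_mul_of_nonneg_right huM (by positivity)
      have h4 : u (j + 1) t * (-(2 * K + M)) ≤ u (j + 1) t *
          ((u (j + 2) t - 2 * u (j + 1) t + u j t) / h ^ 2 + 1 - u (j + 1) t) :=
        mul_le_mul_of_nonneg_left (by linarith) hu0
      linarith)
  intro j hj t ht
  linarith [this j hj t ht]

theorem DSol.decay_barrier (hu : DSol N h c M T u) (hT : 0 ≤ T) {p s m K Λ : ℝ} (hK : 0 ≤ K)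
    (hm : 0 ≤ m) (hΛ : 2 * K + m ≤ Λ) (h0 : ∀ j ≤ N, m - K * (p + (j : ℝ) * h - s) ^ 2 ≤ u j 0) :
    ∀ j ≤ N, ∀ t ∈ Icc 0 T,
      Real.exp (-(Λ * t)) * (m - K * (p + (j : ℝ) * h - s) ^ 2) ≤ u j t := by
  have h2 : 0 < h ^ 2 := pow_pos hu.hpos 2
  have hΛ0 : 0 ≤ Λ := by linarith
  have hz : (0 : ℝ) ∈ Icc 0 T := ⟨le_rfl, hT⟩
  have hexp : ∀ t ∈ Icc 0 T, Real.exp (-(Λ * t)) ≤ 1 := fun t ht => by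
    rw [Real.exp_le_one_iff]; linarith [mul_nonneg hΛ0 ht.1]
  have hbdry : ∀ t ∈ Icc 0 T, ∀ z, z ≤ c → Real.exp (-(Λ * t)) * z ≤ c := by
    intro t ht z hz
    have hc := hu.cpos
    have := Real.exp_pos (-(Λ * t))
    have := hexp t ht
    rcases le_total 0 z with h | h <;> nlinarith
  have := discrete_nonneg (N := N) hT
    (d := fun j t => u j t - Real.exp (-(Λ * t)) * (m - K * (p + (j : ℝ) * h - s) ^ 2))
    (d' := fun j t => u (j + 1) t *
      ((u (j + 2) t - 2 * u (j + 1) t + u j t) / h ^ 2 + 1 - u (j + 1) t) -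
      Real.exp (-(Λ * t)) * (-Λ) * (m - K * (p + ((j + 1 : ℕ) : ℝ) * h - s) ^ 2))
    (fun j => (hu.cont j).sub (by fun_prop)) (fun j hj => by simpa using h0 j hj)
    (fun t ht => by
      have := h0 0 (Nat.zero_le _)
      rw [hu.left _ hz] at this
      have := hbdry t ht _ this
      rw [hu.left t ht]; linarith)
    (fun t ht => by
      have := h0 N le_rfl
      rw [hu.right _ le_rfl _ hz] at this
      have := hbdry t ht _ this
      rw [hu.right _ le_rfl t ht]; linarith)
    (fun j hj t ht => by
      refine HasDerivAt.sub (hu.ode j hj t ht) (HasDerivAt.mul_const ?_ _)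
      exact (hasDerivAt_const_mul Λ).neg.exp)
    (fun j hj t ht hneg hm1 hm2 => by
      have ht' := Ioc_subset_Icc_self ht
      have hu0 := hu.cpos.trans_le (hu.lower (j + 1) t ht')
      have e := second_diff_sq p s h K j
      set E := Real.exp (-(Λ * t)) with hE
      have hE0 : 0 < E := Real.exp_pos _
      have hE1 : E ≤ 1 := hexp t ht'
      set q := K * (p + ((j + 1 : ℕ) : ℝ) * h - s) ^ 2 with hq
      have hq0 : 0 ≤ q := mul_nonneg hK (sq_nonneg _)
      have eE : E * (K * (p + ((j + 2 : ℕ) : ℝ) * h - s) ^ 2) - 2 * (E * q) +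
          E * (K * (p + (j : ℝ) * h - s) ^ 2) = E * (2 * K * h ^ 2) := by rw [← e]; ring
      have hD : -(2 * K) ≤ (u (j + 2) t - 2 * u (j + 1) t + u j t) / h ^ 2 := by
        rw [le_div_iff₀ h2]
        have : E * (2 * K * h ^ 2) ≤ 1 * (2 * K * h ^ 2) :=
          mul_le_mul_of_nonneg_right hE1 (by positivity)
        simp only [mul_sub] at hm1 hm2 hneg
        linarith
      have hlt : u (j + 1) t < E * (m - q) := by linarith
      have hle : u (j + 1) t ≤ m := by
        have : E * (m - q) ≤ m := by nlinarith
        linarith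
      have h4 : u (j + 1) t * (-(2 * K) + 1 - m) ≤ u (j + 1) t *
          ((u (j + 2) t - 2 * u (j + 1) t + u j t) / h ^ 2 + 1 - u (j + 1) t) :=
        mul_le_mul_of_nonneg_left (by linarith) hu0.le
      have h5 : Λ * u (j + 1) t ≤ Λ * (E * (m - q)) := mul_le_mul_of_nonneg_left hlt.le hΛ0
      have h6 : u (j + 1) t * (2 * K + m) ≤ u (j + 1) t * Λ := mul_le_mul_of_nonneg_left hΛ hu0.le
      show 0 < _ - E * (-Λ) * (m - q)
      nlinarith)
  intro j hj t ht
  linarith [this j hj t ht]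

end Barriers

lemma sum_diff_mul_eq {N : ℕ} {k q : ℕ → ℝ} (k0 : k 0 = 0) (kN : k N = 0) :
    ∑ j ∈ Finset.range N, (k (j + 1) - k j) * q j =
      -∑ j ∈ Finset.range N, k (j + 1) * (q (j + 1) - q j) := by
  have h1 : ∑ j ∈ Finset.range N, ((k (j + 1) - k j) * q j + k (j + 1) * (q (j + 1) - q j)) =
      k N * q N - k 0 * q 0 := by
    rw [← Finset.sum_range_sub (fun j => k j * q j)]
    exact Finset.sum_congr rfl fun j _ => by ring
  rw [Finset.sum_add_distrib, k0, kN] at h1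
  linarith

/-- The time derivative of a discrete solution. -/
noncomputable def dg (N : ℕ) (h : ℝ) (u : ℕ → ℝ → ℝ) (j : ℕ) (t : ℝ) : ℝ :=
  if j = 0 ∨ N ≤ j then 0 else
    u j t * ((u (j + 1) t - 2 * u j t + u (j - 1) t) / h ^ 2 + 1 - u j t)

/-- The second time derivative of a discrete solution. -/
noncomputable def ddg (N : ℕ) (h : ℝ) (u : ℕ → ℝ → ℝ) (j : ℕ) (t : ℝ) : ℝ :=
  if j = 0 ∨ N ≤ j then 0 else
    dg N h u j t ^ 2 / u j t + u j t *
      ((dg N h u (j + 1) t - 2 * dg N h u j t + dg N h u (j - 1) t) / h ^ 2 - dg N h u j t)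

/-- The discrete Dirichlet energy. -/
noncomputable def gradEnergy (N : ℕ) (h : ℝ) (u : ℕ → ℝ → ℝ) (t : ℝ) : ℝ :=
  ∑ j ∈ Finset.range N, (u (j + 1) t - u j t) ^ 2 / h

/-- The discrete free energy. -/
noncomputable def freeEnergy (N : ℕ) (h : ℝ) (u : ℕ → ℝ → ℝ) (t : ℝ) : ℝ :=
  gradEnergy N h u t / 2 - h * ∑ j ∈ Finset.range N, (u (j + 1) t - u (j + 1) t ^ 2 / 2)

/-- The weighted discrete dissipation. -/
noncomputable def dissip (N : ℕ) (h : ℝ) (u : ℕ → ℝ → ℝ) (η : ℕ → ℝ) (t : ℝ) : ℝ :=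
  h * ∑ j ∈ Finset.range N, η (j + 1) ^ 2 * (dg N h u (j + 1) t ^ 2 / u (j + 1) t)

/-- The weighted Dirichlet energy of the time derivative. -/
noncomputable def speedEnergy (N : ℕ) (h : ℝ) (u : ℕ → ℝ → ℝ) (η : ℕ → ℝ) (t : ℝ) : ℝ :=
  ∑ j ∈ Finset.range N, (η j ^ 2 + η (j + 1) ^ 2) / 2 *
    (dg N h u (j + 1) t - dg N h u j t) ^ 2 / h

section

variable {N : ℕ} {h c M T : ℝ} {u : ℕ → ℝ → ℝ}

lemma dg_zero (t : ℝ) : dg N h u 0 t = 0 := by simp [dg]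

lemma dg_right {j : ℕ} (hj : N ≤ j) (t : ℝ) : dg N h u j t = 0 := by simp [dg, hj]

lemma dg_succ {j : ℕ} (hj : j + 1 < N) (t : ℝ) : dg N h u (j + 1) t =
    u (j + 1) t * ((u (j + 2) t - 2 * u (j + 1) t + u j t) / h ^ 2 + 1 - u (j + 1) t) := by
  have : ¬ (j + 1 = 0 ∨ N ≤ j + 1) := by omega
  simp [dg, hj]

lemma ddg_zero (t : ℝ) : ddg N h u 0 t = 0 := by simp [ddg]

lemma ddg_right {j : ℕ} (hj : N ≤ j) (t : ℝ) : ddg N h u j t = 0 := by simp [ddg, hj]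

lemma ddg_succ {j : ℕ} (hj : j + 1 < N) (t : ℝ) : ddg N h u (j + 1) t =
    dg N h u (j + 1) t ^ 2 / u (j + 1) t + u (j + 1) t *
      ((dg N h u (j + 2) t - 2 * dg N h u (j + 1) t + dg N h u j t) / h ^ 2 -
        dg N h u (j + 1) t) := by
  have : ¬ (j + 1 = 0 ∨ N ≤ j + 1) := by omega
  simp [ddg, hj]

lemma hasDerivAt_of_const {f : ℝ → ℝ} {t : ℝ} (ht : t ∈ Ioo 0 T)
    (hf : ∀ s ∈ Icc 0 T, f s = c) : HasDerivAt f 0 t := by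
  refine (hasDerivAt_const t c).congr_of_eventuallyEq ?_
  filter_upwards [Ioo_mem_nhds ht.1 ht.2] with s hs using hf s (Ioo_subset_Icc_self hs)

lemma DSol.pos (hu : DSol N h c M T u) (j : ℕ) {t : ℝ} (ht : t ∈ Icc 0 T) : 0 < u j t :=
  hu.cpos.trans_le (hu.lower j t ht)

lemma DSol.hasDerivAt (hu : DSol N h c M T u) (j : ℕ) {t : ℝ} (ht : t ∈ Ioo 0 T) :
    HasDerivAt (u j) (dg N h u j t) t := by
  rcases j with _ | j
  · rw [dg_zero]
    exact hasDerivAt_of_const ht hu.left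
  · rcases lt_or_ge (j + 1) N with hj | hj
    · rw [dg_succ hj]
      exact hu.ode j hj t (Ioo_subset_Ioc_self ht)
    · rw [dg_right hj]
      exact hasDerivAt_of_const ht (hu.right _ hj)

lemma DSol.continuousOn_dg (hu : DSol N h c M T u) (j : ℕ) :
    ContinuousOn (dg N h u j) (Icc 0 T) := by
  have h1 := hu.cont j
  have h2 := hu.cont (j + 1)
  have h3 := hu.cont (j - 1)
  have : dg N h u j = fun t => dg N h u j t := rfl
  rw [this]
  unfold dg
  split_ifs
  · exact continuousOn_const
  · exact h1.mul ((((h2.sub (continuousOn_const.mul h1)).add h3).div_const _).add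
      continuousOn_const |>.sub h1)

lemma DSol.hasDerivAt_dg (hu : DSol N h c M T u) (j : ℕ) {t : ℝ} (ht : t ∈ Ioo 0 T) :
    HasDerivAt (dg N h u j) (ddg N h u j t) t := by
  rcases j with _ | j
  · rw [ddg_zero]
    exact hasDerivAt_of_const ht fun s _ => dg_zero s
  · rcases lt_or_ge (j + 1) N with hj | hj
    · have e : dg N h u (j + 1) = fun t =>
          u (j + 1) t * ((u (j + 2) t - 2 * u (j + 1) t + u j t) / h ^ 2 + 1 - u (j + 1) t) :=
        funext fun t => dg_succ hj t
      have h1 := hu.hasDerivAt j ht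
      have h2 := hu.hasDerivAt (j + 1) ht
      have h3 := hu.hasDerivAt (j + 2) ht
      have hp := (hu.pos (j + 1) (Ioo_subset_Icc_self ht)).ne'
      rw [e]
      refine (h2.mul (((((h3.sub (h2.const_mul 2)).add h1).div_const _).add_const 1).sub h2)).congr_deriv ?_
      rw [ddg_succ hj]
      have e2 : dg N h u (j + 1) t ^ 2 / u (j + 1) t = dg N h u (j + 1) t *
          ((u (j + 2) t - 2 * u (j + 1) t + u j t) / h ^ 2 + 1 - u (j + 1) t) := by
        rw [div_eq_iff hp, dg_succ hj]; ring
      rw [e2]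
      rfl
    · rw [ddg_right hj]
      exact hasDerivAt_of_const ht fun s _ => dg_right hj s

lemma DSol.sq_div (hu : DSol N h c M T u) {j : ℕ} (hj : j + 1 < N) {t : ℝ} (ht : t ∈ Icc 0 T) :
    dg N h u (j + 1) t / u (j + 1) t =
      (u (j + 2) t - 2 * u (j + 1) t + u j t) / h ^ 2 + 1 - u (j + 1) t := by
  rw [dg_succ hj, mul_div_cancel_left₀ _ (hu.pos _ ht).ne']

lemma DSol.hasDerivAt_freeEnergy (hu : DSol N h c M T u) {t : ℝ} (ht : t ∈ Ioo 0 T) :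
    HasDerivAt (freeEnergy N h u) (-dissip N h u (fun _ => 1) t) t := by
  have ht' := Ioo_subset_Icc_self ht
  have hh := hu.hpos.ne'
  have h1 : HasDerivAt (gradEnergy N h u) (∑ j ∈ Finset.range N,
      (2 * (u (j + 1) t - u j t) * (dg N h u (j + 1) t - dg N h u j t)) / h) t := by
    unfold gradEnergy
    refine HasDerivAt.fun_sum fun j _ => ?_
    refine ((((hu.hasDerivAt (j + 1) ht).sub (hu.hasDerivAt j ht)).pow 2).div_const h).congr_deriv ?_
    simp
  have h2 : HasDerivAt (fun t => ∑ j ∈ Finset.range N, (u (j + 1) t - u (j + 1) t ^ 2 / 2))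
      (∑ j ∈ Finset.range N, (dg N h u (j + 1) t - u (j + 1) t * dg N h u (j + 1) t)) t := by
    refine HasDerivAt.fun_sum fun j _ => ?_
    refine ((hu.hasDerivAt (j + 1) ht).sub
      (((hu.hasDerivAt (j + 1) ht).pow 2).div_const 2)).congr_deriv ?_
    simp; ring
  refine ((h1.div_const 2).sub (h2.const_mul h)).congr_deriv ?_
  have sbp := sum_diff_mul_eq (N := N) (k := fun j => dg N h u j t)
    (q := fun j => u (j + 1) t - u j t) (dg_zero t) (dg_right le_rfl t)
  have e1 : (∑ j ∈ Finset.range N,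
      (2 * (u (j + 1) t - u j t) * (dg N h u (j + 1) t - dg N h u j t)) / h) / 2 =
      (∑ j ∈ Finset.range N, (dg N h u (j + 1) t - dg N h u j t) * (u (j + 1) t - u j t)) / h := by
    rw [Finset.sum_div, Finset.sum_div]
    exact Finset.sum_congr rfl fun j _ => by ring
  rw [e1, sbp, dissip, Finset.mul_sum, Finset.mul_sum, neg_div, Finset.sum_div,
    ← neg_add', ← Finset.sum_add_distrib]
  congr 1
  refine Finset.sum_congr rfl fun j hj => ?_
  rw [Finset.mem_range] at hj
  rcases lt_or_ge (j + 1) N with hj1 | hj1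
  · have e := hu.sq_div hj1 ht'
    have : dg N h u (j + 1) t ^ 2 / u (j + 1) t =
        dg N h u (j + 1) t * (dg N h u (j + 1) t / u (j + 1) t) := by ring
    rw [this, e]
    field_simp
    ring
  · simp [dg_right hj1]

lemma DSol.dissip_nonneg (hu : DSol N h c M T u) (η : ℕ → ℝ) {t : ℝ} (ht : t ∈ Icc 0 T) :
    0 ≤ dissip N h u η t := by
  refine mul_nonneg hu.hpos.le (Finset.sum_nonneg fun j _ => ?_)
  have := hu.pos (j + 1) ht
  positivity

lemma DSol.speedEnergy_nonneg (hu : DSol N h c M T u) (η : ℕ → ℝ) (t : ℝ) :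
    0 ≤ speedEnergy N h u η t := by
  have := hu.hpos
  exact Finset.sum_nonneg fun j _ => by positivity

lemma DSol.continuousOn_freeEnergy (hu : DSol N h c M T u) :
    ContinuousOn (freeEnergy N h u) (Icc 0 T) := by
  have : ∀ j, ContinuousOn (fun t => u j t) (Icc 0 T) := hu.cont
  unfold freeEnergy gradEnergy
  fun_prop (discharger := exact hu.hpos.ne')

lemma DSol.freeEnergy_lower (hu : DSol N h c M T u) (t : ℝ) :
    -(N * h / 2) ≤ freeEnergy N h u t - gradEnergy N h u t / 2 := by
  have : h * ∑ j ∈ Finset.range N, (u (j + 1) t - u (j + 1) t ^ 2 / 2) ≤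
      h * ∑ j ∈ Finset.range N, (1 / 2 : ℝ) := by
    refine mul_le_mul_of_nonneg_left (Finset.sum_le_sum fun j _ => ?_) hu.hpos.le
    nlinarith [sq_nonneg (u (j + 1) t - 1)]
  rw [Finset.sum_const, Finset.card_range, nsmul_eq_mul] at this
  unfold freeEnergy
  linarith

lemma DSol.gradEnergy_nonneg (hu : DSol N h c M T u) (t : ℝ) : 0 ≤ gradEnergy N h u t := by
  have := hu.hpos
  exact Finset.sum_nonneg fun j _ => by positivity

theorem DSol.freeEnergy_upper (hu : DSol N h c M T u) {t : ℝ} (ht : t ∈ Ioc 0 T) :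
    t * freeEnergy N h u t ≤ N * h * (M + 1) + N * h * (1 + M ^ 2) * t := by
  have hh := hu.hpos
  have hM := hu.leM
  have hT : 0 ≤ T := ht.1.le.trans ht.2
  set Φ : ℝ → ℝ := fun t => h * ∑ j ∈ Finset.range N, (u (j + 1) t - c * Real.log (u (j + 1) t))
    with hΦ
  have hconst : ∀ b : ℝ, h * ∑ j ∈ Finset.range N, b = N * h * b := by
    intro b
    rw [Finset.sum_const, Finset.card_range, nsmul_eq_mul]; ring
  have key := le_left_of_hasDerivAt_nonpos (p := 0) (q := T)
    (f := fun t => Φ t + t * freeEnergy N h u t - N * h * (1 + M ^ 2) * t)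
    (f' := fun t => h * ∑ j ∈ Finset.range N,
        (dg N h u (j + 1) t - c * (dg N h u (j + 1) t / u (j + 1) t)) +
      (1 * freeEnergy N h u t + t * (-dissip N h u (fun _ => 1) t)) - N * h * (1 + M ^ 2))
    ?_ (fun t ht => ?_) (fun t ht => ?_)
  · have h1 := key t (Ioc_subset_Icc_self ht)
    have h2 : 0 ≤ Φ t := by
      refine mul_nonneg hh.le (Finset.sum_nonneg fun j _ => ?_)
      have hp := hu.pos (j + 1) (Ioc_subset_Icc_self ht)
      have := Real.log_le_sub_one_of_pos hp
      have hc := hu.cpos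
      have hc1 := hu.cle
      nlinarith
    have h3 : Φ 0 ≤ N * h * (M + 1) := by
      rw [← hconst]
      refine mul_le_mul_of_nonneg_left (Finset.sum_le_sum fun j _ => ?_) hh.le
      have hz : (0 : ℝ) ∈ Icc 0 T := ⟨le_rfl, hT⟩
      have hc := hu.cpos
      have e1 := Real.log_le_log hc (hu.lower (j + 1) 0 hz)
      have e2 := Real.one_sub_inv_le_log_of_pos hc
      have e3 := hu.upper (j + 1) 0 hz
      have e4 : c * (1 - c⁻¹) ≤ c * Real.log (u (j + 1) 0) :=
        mul_le_mul_of_nonneg_left (e2.trans e1) hc.le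
      rw [mul_sub, mul_inv_cancel₀ hc.ne'] at e4
      linarith
    simp only [zero_mul, mul_zero] at h1
    linarith
  · have h1 := hu.continuousOn_freeEnergy
    have h2 : ∀ j, ContinuousOn (fun t => u j t) (Icc 0 T) := hu.cont
    have h3 : ∀ j, ContinuousOn (fun t => Real.log (u j t)) (Icc 0 T) := fun j =>
      (h2 j).log fun t ht => (hu.pos j ht).ne'
    have h4 : ContinuousOn (fun t => freeEnergy N h u t) (Icc 0 T) := h1
    simp only [hΦ]
    fun_prop
  · have ht' := Ioo_subset_Icc_self ht
    refine ((HasDerivAt.const_mul h (HasDerivAt.fun_sum fun j _ => ?_)).add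
      ((hasDerivAt_id t).mul (hu.hasDerivAt_freeEnergy ht))).sub (hasDerivAt_const_mul _)
    exact (hu.hasDerivAt (j + 1) ht).sub
      (((hu.hasDerivAt (j + 1) ht).log (hu.pos _ ht').ne').const_mul c)
  · have ht' := Ioo_subset_Icc_self ht
    have sbp := sum_diff_mul_eq (N := N) (k := fun j => u j t - c)
      (q := fun j => u (j + 1) t - u j t) (by simp [hu.left t ht'])
      (by simp [hu.right N le_rfl t ht'])
    have e1 : h * ∑ j ∈ Finset.range N,
        (dg N h u (j + 1) t - c * (dg N h u (j + 1) t / u (j + 1) t)) ≤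
        -gradEnergy N h u t + N * h * 1 := by
      have e2 : gradEnergy N h u t = -∑ j ∈ Finset.range N, (u (j + 1) t - c) *
          ((u (j + 1 + 1) t - u (j + 1) t) - (u (j + 1) t - u j t)) / h := by
        rw [gradEnergy, ← Finset.sum_div, ← Finset.sum_div, ← neg_div, ← sbp]
        congr 1
        exact Finset.sum_congr rfl fun j _ => by ring
      rw [e2, neg_neg, ← hconst, Finset.mul_sum, Finset.mul_sum, ← Finset.sum_add_distrib]
      refine Finset.sum_le_sum fun j hj => ?_
      rw [Finset.mem_range] at hj
      rcases lt_or_ge (j + 1) N with hj1 | hj1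
      · have e := hu.sq_div hj1 ht'
        have hp := hu.pos (j + 1) ht'
        have e3 : dg N h u (j + 1) t = u (j + 1) t * (dg N h u (j + 1) t / u (j + 1) t) := by
          field_simp
        have e4 : dg N h u (j + 1) t - c * (dg N h u (j + 1) t / u (j + 1) t) =
            (u (j + 1) t - c) * ((u (j + 2) t - 2 * u (j + 1) t + u j t) / h ^ 2) +
            (u (j + 1) t - c) * (1 - u (j + 1) t) := by
          rw [← sub_eq_zero]
          nth_rewrite 1 [e3]
          rw [e]; ring
        have e5 : (u (j + 1) t - c) * (1 - u (j + 1) t) ≤ 1 := by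
          have hc := hu.cpos
          have hl := hu.lower (j + 1) t ht'
          have hp := hu.pos (j + 1) ht'
          nlinarith [sq_nonneg (u (j + 1) t - 1), mul_nonneg hc.le hp.le, sq_nonneg (u (j + 1) t),
            hu.cle]
        rw [e4, mul_add]
        refine add_le_add (le_of_eq ?_) (mul_le_mul_of_nonneg_left e5 hh.le)
        field_simp
        ring
      · simp [dg_right hj1, hu.right (j + 1) hj1 t ht']
        exact hh.le
    have e6 : -(h * ∑ j ∈ Finset.range N, (u (j + 1) t - u (j + 1) t ^ 2 / 2)) ≤
        N * h * M ^ 2 := by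
      rw [← hconst, ← mul_neg, ← Finset.sum_neg_distrib]
      refine mul_le_mul_of_nonneg_left (Finset.sum_le_sum fun j _ => ?_) hh.le
      have hp := hu.pos (j + 1) ht'
      have hm := hu.upper (j + 1) t ht'
      nlinarith
    have e7 : freeEnergy N h u t = gradEnergy N h u t / 2 -
      h * ∑ j ∈ Finset.range N, (u (j + 1) t - u (j + 1) t ^ 2 / 2) := rfl
    have e8 := mul_nonneg ht.1.le (hu.dissip_nonneg (fun _ => 1) ht')
    have e9 := hu.gradEnergy_nonneg t
    linarith

end

lemma le_add_of_sq_le_four_mul {x p q : ℝ} (hp : 0 ≤ p) (hq : 0 ≤ q) (h : x ^ 2 ≤ 4 * p * q) :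
    x ≤ p + q := by
  refine (le_abs_self x).trans (abs_le_of_sq_le_sq ?_ (by positivity))
  nlinarith [sq_nonneg (p - q)]

lemma sum_range_shift {N : ℕ} {f : ℕ → ℝ} (h0 : f 0 = 0) (hN : f N = 0) :
    ∑ j ∈ Finset.range N, f j = ∑ j ∈ Finset.range N, f (j + 1) := by
  have h1 := Finset.sum_range_succ f N
  have h2 := Finset.sum_range_succ' f N
  linarith

lemma cutoff_mul_sq_le {N : ℕ} {h l : ℝ} (hh : 0 < h) {g χ ψ : ℕ → ℝ} (g0 : g 0 = 0)
    (gN : g N = 0) (h1 : ∀ j, |χ (j + 1) - χ j| ≤ l * h * |ψ j|)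
    (h2 : ∀ j, |χ (j + 1) - χ j| ≤ l * h * |ψ (j + 1)|) {k : ℕ} (hk : k ≤ N) :
    (χ k * g k) ^ 2 ≤ 2 * (N * h) *
      (∑ j ∈ Finset.range N, (χ j ^ 2 + χ (j + 1) ^ 2) / 2 * (g (j + 1) - g j) ^ 2 / h +
        l ^ 2 * (h * ∑ j ∈ Finset.range N, ψ (j + 1) ^ 2 * g (j + 1) ^ 2)) := by
  set e : ℕ → ℝ := fun j => χ (j + 1) * g (j + 1) - χ j * g j with he
  have e1 : χ k * g k = ∑ j ∈ Finset.range k, e j := by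
    rw [Finset.sum_range_sub (fun j => χ j * g j), g0]; ring
  have e2 : (χ k * g k) ^ 2 ≤ N * ∑ j ∈ Finset.range N, e j ^ 2 := by
    rw [e1]
    have := sq_sum_le_card_mul_sum_sq (s := Finset.range k) (f := e)
    rw [Finset.card_range] at this
    refine this.trans (mul_le_mul (by exact_mod_cast hk) ?_
      (Finset.sum_nonneg fun _ _ => sq_nonneg _) (by positivity))
    exact Finset.sum_le_sum_of_subset_of_nonneg (by simpa using hk) fun _ _ _ => sq_nonneg _
  have e3 : ∀ j, e j ^ 2 ≤ 2 * ((χ j ^ 2 + χ (j + 1) ^ 2) / 2 * (g (j + 1) - g j) ^ 2 +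
      l ^ 2 * h ^ 2 * ((ψ j ^ 2 * g j ^ 2 + ψ (j + 1) ^ 2 * g (j + 1) ^ 2) / 2)) := by
    intro j
    have a1 : (χ (j + 1) - χ j) ^ 2 ≤ l ^ 2 * h ^ 2 * ψ j ^ 2 := by
      rw [← sq_abs, ← sq_abs (ψ j), ← mul_pow, ← mul_pow]
      exact pow_le_pow_left₀ (abs_nonneg _) (h1 j) 2
    have a2 : (χ (j + 1) - χ j) ^ 2 ≤ l ^ 2 * h ^ 2 * ψ (j + 1) ^ 2 := by
      rw [← sq_abs, ← sq_abs (ψ (j + 1)), ← mul_pow, ← mul_pow]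
      exact pow_le_pow_left₀ (abs_nonneg _) (h2 j) 2
    have a3 := mul_le_mul_of_nonneg_right a1 (sq_nonneg (g j))
    have a4 := mul_le_mul_of_nonneg_right a2 (sq_nonneg (g (j + 1)))
    have a5 : e j = (χ j + χ (j + 1)) / 2 * (g (j + 1) - g j) +
        (χ (j + 1) - χ j) * ((g j + g (j + 1)) / 2) := by simp only [he]; ring
    have a6 : ((χ j + χ (j + 1)) / 2 * (g (j + 1) - g j)) ^ 2 ≤
        (χ j ^ 2 + χ (j + 1) ^ 2) / 2 * (g (j + 1) - g j) ^ 2 := by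
      rw [mul_pow]
      exact mul_le_mul_of_nonneg_right (by nlinarith [sq_nonneg (χ j - χ (j + 1))]) (sq_nonneg _)
    have a7 : ((χ (j + 1) - χ j) * ((g j + g (j + 1)) / 2)) ^ 2 ≤
        (χ (j + 1) - χ j) ^ 2 * ((g j ^ 2 + g (j + 1) ^ 2) / 2) := by
      rw [mul_pow]
      exact mul_le_mul_of_nonneg_left (by nlinarith [sq_nonneg (g j - g (j + 1))]) (sq_nonneg _)
    have a8 := add_sq_le (a := (χ j + χ (j + 1)) / 2 * (g (j + 1) - g j))
      (b := (χ (j + 1) - χ j) * ((g j + g (j + 1)) / 2))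
    rw [a5]
    linarith
  have e4 := sum_range_shift (N := N) (f := fun j => ψ j ^ 2 * g j ^ 2) (by simp [g0])
    (by simp [gN])
  have e5 : ∑ j ∈ Finset.range N, e j ^ 2 ≤
      2 * (∑ j ∈ Finset.range N, (χ j ^ 2 + χ (j + 1) ^ 2) / 2 * (g (j + 1) - g j) ^ 2 +
        l ^ 2 * h ^ 2 * ∑ j ∈ Finset.range N, ψ (j + 1) ^ 2 * g (j + 1) ^ 2) := by
    refine (Finset.sum_le_sum fun j _ => e3 j).trans (le_of_eq ?_)
    rw [← Finset.mul_sum, Finset.sum_add_distrib, ← Finset.mul_sum, ← Finset.sum_div,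
      Finset.sum_add_distrib, e4]
    ring
  refine e2.trans ((mul_le_mul_of_nonneg_left e5 (Nat.cast_nonneg N)).trans (le_of_eq ?_))
  rw [← Finset.sum_div]
  field_simp

/-- Discrete space cutoffs for localized energy estimates. -/
structure CutoffPair (N : ℕ) (h l m τ T : ℝ) (u : ℕ → ℝ → ℝ) (η σ : ℕ → ℝ) : Prop where
  lpos : 0 ≤ l
  mpos : 0 < m
  outer_nonneg : ∀ j, 0 ≤ η j
  outer_le : ∀ j, η j ≤ 1
  inner_nonneg : ∀ j, 0 ≤ σ j
  inner_le : ∀ j, σ j ≤ 1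
  outer_lip : ∀ j, |η (j + 1) - η j| ≤ l * h
  inner_lip : ∀ j, |σ (j + 1) - σ j| ≤ l * h
  outer_eq_one : ∀ j, σ j ≠ 0 ∨ σ (j + 1) ≠ 0 ∨ σ (j + 2) ≠ 0 →
    η j = 1 ∧ η (j + 1) = 1 ∧ η (j + 2) = 1
  low : ∀ j < N, η j ≠ 0 → ∀ t ∈ Icc τ T, m ≤ u j t

section

variable {N : ℕ} {h c M T l m τ : ℝ} {u : ℕ → ℝ → ℝ} {η σ : ℕ → ℝ}

lemma DSol.sum_sq_le (hu : DSol N h c M T u) (η : ℕ → ℝ) {t : ℝ} (ht : t ∈ Icc 0 T) :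
    h * ∑ j ∈ Finset.range N, η (j + 1) ^ 2 * dg N h u (j + 1) t ^ 2 ≤ M * dissip N h u η t := by
  rw [dissip, mul_left_comm, Finset.mul_sum _ _ M]
  refine mul_le_mul_of_nonneg_left (Finset.sum_le_sum fun j _ => ?_) hu.hpos.le
  have hp := hu.pos (j + 1) ht
  rw [mul_left_comm]
  refine mul_le_mul_of_nonneg_left ?_ (sq_nonneg _)
  rw [mul_div_assoc', le_div_iff₀ hp, mul_comm M]
  exact mul_le_mul_of_nonneg_left (hu.upper _ t ht) (sq_nonneg _)

lemma DSol.dissip_mono (hu : DSol N h c M T u) {η χ : ℕ → ℝ} (hη : ∀ j, η j ^ 2 ≤ χ j ^ 2)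
    {t : ℝ} (ht : t ∈ Icc 0 T) : dissip N h u η t ≤ dissip N h u χ t := by
  refine mul_le_mul_of_nonneg_left (Finset.sum_le_sum fun j _ => ?_) hu.hpos.le
  have hp := hu.pos (j + 1) ht
  exact mul_le_mul_of_nonneg_right (hη _) (by positivity)

lemma DSol.speedEnergy_mono (hu : DSol N h c M T u) {η χ : ℕ → ℝ} (hη : ∀ j, η j ^ 2 ≤ χ j ^ 2)
    (t : ℝ) : speedEnergy N h u η t ≤ speedEnergy N h u χ t := by
  refine Finset.sum_le_sum fun j _ => ?_
  have hp := hu.hpos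
  have h1 := hη j
  have h2 := hη (j + 1)
  gcongr

lemma CutoffPair.outer_sq_le (hc : CutoffPair N h l m τ T u η σ) (j : ℕ) :
    η j ^ 2 ≤ 1 := by
  nlinarith [hc.outer_nonneg j, hc.outer_le j]

lemma CutoffPair.inner_sq_le (hc : CutoffPair N h l m τ T u η σ) (j : ℕ) :
    σ j ^ 2 ≤ η j ^ 2 := by
  by_cases h0 : σ j = 0
  · rw [h0]; nlinarith [sq_nonneg (η j)]
  · rw [(hc.outer_eq_one j (Or.inl h0)).1]
    nlinarith [hc.inner_nonneg j, hc.inner_le j]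

lemma DSol.outer_mul_sq_le (hu : DSol N h c M T u) (hc : CutoffPair N h l m τ T u η σ) {t : ℝ}
    (ht : t ∈ Icc 0 T) {k : ℕ} (hk : k ≤ N) : (η k * dg N h u k t) ^ 2 ≤
      2 * (N * h) * (speedEnergy N h u η t + l ^ 2 * (M * dissip N h u (fun _ => 1) t)) := by
  have h1 := cutoff_mul_sq_le (l := l) hu.hpos (g := fun j => dg N h u j t) (χ := η)
    (ψ := fun _ => 1) (dg_zero t) (dg_right le_rfl t) (by simpa using hc.outer_lip)
    (by simpa using hc.outer_lip) hk
  have h2 := hu.sum_sq_le (fun _ => 1) ht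
  have h3 := mul_le_mul_of_nonneg_left h2 (sq_nonneg l)
  have h4 : 0 ≤ 2 * (N * h) := by have := hu.hpos; positivity
  exact h1.trans (mul_le_mul_of_nonneg_left (add_le_add le_rfl h3) h4)

lemma DSol.inner_mul_sq_le (hu : DSol N h c M T u) (hc : CutoffPair N h l m τ T u η σ) {t : ℝ}
    (ht : t ∈ Icc 0 T) {k : ℕ} (hk : k ≤ N) : (σ k * dg N h u k t) ^ 2 ≤
      2 * (N * h) * (speedEnergy N h u σ t + l ^ 2 * (M * dissip N h u η t)) := by
  have h0 : ∀ j, σ j = 0 ∧ σ (j + 1) = 0 ∨ η j = 1 ∧ η (j + 1) = 1 := by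
    intro j
    by_cases h : σ j = 0 ∧ σ (j + 1) = 0
    · exact Or.inl h
    · have := hc.outer_eq_one j (by tauto)
      tauto
  have h1 := cutoff_mul_sq_le (l := l) hu.hpos (g := fun j => dg N h u j t) (χ := σ)
    (ψ := η) (dg_zero t) (dg_right le_rfl t) (fun j => ?_) (fun j => ?_) hk
  · have h2 := hu.sum_sq_le η ht
    have h3 := mul_le_mul_of_nonneg_left h2 (sq_nonneg l)
    have h4 : 0 ≤ 2 * (N * h) := by have := hu.hpos; positivity
    exact h1.trans (mul_le_mul_of_nonneg_left (add_le_add le_rfl h3) h4)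
  · rcases h0 j with h | h
    · rw [h.1, h.2]
      have := hu.hpos; have := hc.lpos
      simp; positivity
    · rw [h.1]; simpa using hc.inner_lip j
  · rcases h0 j with h | h
    · rw [h.1, h.2]
      have := hu.hpos; have := hc.lpos
      simp; positivity
    · rw [h.2]; simpa using hc.inner_lip j

lemma DSol.hasDerivAt_dissip (hu : DSol N h c M T u) (η : ℕ → ℝ) {t : ℝ} (ht : t ∈ Ioo 0 T) :
    HasDerivAt (dissip N h u η) (h * ∑ j ∈ Finset.range N, η (j + 1) ^ 2 *
      (2 * dg N h u (j + 1) t * ddg N h u (j + 1) t / u (j + 1) t -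
        dg N h u (j + 1) t ^ 3 / u (j + 1) t ^ 2)) t := by
  unfold dissip
  refine HasDerivAt.const_mul h (HasDerivAt.fun_sum fun j _ => HasDerivAt.const_mul _ ?_)
  have hp := (hu.pos (j + 1) (Ioo_subset_Icc_self ht)).ne'
  refine (((hu.hasDerivAt_dg (j + 1) ht).pow 2).div (hu.hasDerivAt (j + 1) ht) hp).congr_deriv ?_
  simp
  field_simp

lemma DSol.hasDerivAt_speedEnergy (hu : DSol N h c M T u) (σ : ℕ → ℝ) {t : ℝ}
    (ht : t ∈ Ioo 0 T) :
    HasDerivAt (speedEnergy N h u σ) (∑ j ∈ Finset.range N, (σ j ^ 2 + σ (j + 1) ^ 2) / 2 *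
      (2 * (dg N h u (j + 1) t - dg N h u j t) * (ddg N h u (j + 1) t - ddg N h u j t)) / h) t := by
  unfold speedEnergy
  refine HasDerivAt.fun_sum fun j _ => ?_
  refine (((((hu.hasDerivAt_dg (j + 1) ht).sub (hu.hasDerivAt_dg j ht)).pow 2).const_mul
    _).div_const h).congr_deriv ?_
  simp

lemma DSol.cubic_le (hu : DSol N h c M T u) (hc : CutoffPair N h l m τ T u η σ) {t : ℝ}
    (ht : t ∈ Icc τ T) (ht0 : 0 ≤ t) :
    h * ∑ j ∈ Finset.range N, η (j + 1) ^ 2 * (dg N h u (j + 1) t ^ 3 / u (j + 1) t ^ 2) ≤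
      (speedEnergy N h u η t + l ^ 2 * (M * dissip N h u (fun _ => 1) t)) / 2 +
      N * h / m ^ 2 * (dissip N h u η t * dissip N h u (fun _ => 1) t) := by
  have ht' : t ∈ Icc 0 T := ⟨ht0, ht.2⟩
  have hh := hu.hpos
  have hm := hc.mpos
  have hM : 0 ≤ M := zero_le_one.trans hu.leM
  have hy := hu.dissip_nonneg η ht'
  have ha := hu.dissip_nonneg (fun _ => 1) ht'
  have hd := hu.speedEnergy_nonneg η t
  set S := speedEnergy N h u η t + l ^ 2 * (M * dissip N h u (fun _ => 1) t) with hS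
  have hS0 : 0 ≤ S := by positivity
  refine le_add_of_sq_le_four_mul (by positivity) (by positivity) ?_
  have cs := Finset.sum_sq_le_sum_mul_sum_of_sq_le_mul (Finset.range N)
    (r := fun j => η (j + 1) ^ 2 * (dg N h u (j + 1) t ^ 3 / u (j + 1) t ^ 2))
    (f := fun j => η (j + 1) ^ 2 * (dg N h u (j + 1) t ^ 2 / u (j + 1) t))
    (g := fun j => η (j + 1) ^ 2 * (dg N h u (j + 1) t ^ 4 / u (j + 1) t ^ 3))
    (fun j _ => by have := hu.pos (j + 1) ht'; positivity)
    (fun j _ => by have := hu.pos (j + 1) ht'; positivity)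
    (fun j _ => by have := hu.pos (j + 1) ht'; apply le_of_eq; field_simp)
  have e1 : h * ∑ j ∈ Finset.range N, η (j + 1) ^ 2 * (dg N h u (j + 1) t ^ 4 / u (j + 1) t ^ 3) ≤
      2 * (N * h) * S / m ^ 2 * dissip N h u (fun _ => 1) t := by
    rw [dissip, mul_left_comm, Finset.mul_sum _ _ (2 * (N * h) * S / m ^ 2)]
    refine mul_le_mul_of_nonneg_left (Finset.sum_le_sum fun j hj => ?_) hh.le
    rw [Finset.mem_range] at hj
    have hp := hu.pos (j + 1) ht'
    by_cases h0 : η (j + 1) = 0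
    · rw [h0]; simp; positivity
    rcases lt_or_ge (j + 1) N with hj1 | hj1
    · have b1 := hu.outer_mul_sq_le hc ht' hj1.le
      have b2 := hc.low (j + 1) hj1 h0 t ht
      have b3 : m ^ 2 ≤ u (j + 1) t ^ 2 := pow_le_pow_left₀ hm.le b2 2
      have b4 : (η (j + 1) * dg N h u (j + 1) t) ^ 2 / u (j + 1) t ^ 2 ≤
        2 * (N * h) * S / m ^ 2 := by gcongr
      have b5 := mul_le_mul_of_nonneg_right b4
        (show 0 ≤ dg N h u (j + 1) t ^ 2 / u (j + 1) t by positivity)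
      simp only [one_pow, one_mul]
      refine le_trans (le_of_eq ?_) b5
      field_simp
    · simp [dg_right hj1]
  have e2 : 0 ≤ dissip N h u η t := hy
  calc _ = h ^ 2 * (∑ j ∈ Finset.range N,
        η (j + 1) ^ 2 * (dg N h u (j + 1) t ^ 3 / u (j + 1) t ^ 2)) ^ 2 := by ring
    _ ≤ h ^ 2 * (_ * _) := mul_le_mul_of_nonneg_left cs (by positivity)
    _ = dissip N h u η t * (h * ∑ j ∈ Finset.range N,
        η (j + 1) ^ 2 * (dg N h u (j + 1) t ^ 4 / u (j + 1) t ^ 3)) := by rw [dissip]; ring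
    _ ≤ dissip N h u η t * (2 * (N * h) * S / m ^ 2 * dissip N h u (fun _ => 1) t) :=
        mul_le_mul_of_nonneg_left e1 hy
    _ = _ := by ring

theorem DSol.deriv_dissip_le (hu : DSol N h c M T u) (hc : CutoffPair N h l m τ T u η σ) {t : ℝ}
    (ht : t ∈ Icc τ T) (ht0 : 0 ≤ t) :
    h * ∑ j ∈ Finset.range N, η (j + 1) ^ 2 *
      (2 * dg N h u (j + 1) t * ddg N h u (j + 1) t / u (j + 1) t -
        dg N h u (j + 1) t ^ 3 / u (j + 1) t ^ 2) ≤
      -(speedEnergy N h u η t / 2) + (5 * l ^ 2 * M + N * h / m ^ 2) *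
        (dissip N h u (fun _ => 1) t * (1 + dissip N h u η t)) := by
  have ht' : t ∈ Icc 0 T := ⟨ht0, ht.2⟩
  have hh := hu.hpos
  have hm := hc.mpos
  have hM : 0 ≤ M := zero_le_one.trans hu.leM
  have hy := hu.dissip_nonneg η ht'
  have ha := hu.dissip_nonneg (fun _ => 1) ht'
  have hd := hu.speedEnergy_nonneg η t
  have cub := hu.cubic_le hc ht ht0
  set g : ℕ → ℝ := fun j => dg N h u j t with hg
  have hg1 : ∀ j, dg N h u j t = g j := fun _ => rfl
  have g0 : g 0 = 0 := dg_zero t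
  have gN : g N = 0 := dg_right le_rfl t
  have sbp := sum_diff_mul_eq (N := N) (k := fun j => η j ^ 2 * g j)
    (q := fun j => g (j + 1) - g j) (by simp [g0]) (by simp [gN])
  have e1 : h * ∑ j ∈ Finset.range N, η (j + 1) ^ 2 *
      (2 * g (j + 1) * ddg N h u (j + 1) t / u (j + 1) t - g (j + 1) ^ 3 / u (j + 1) t ^ 2) ≤
      h * ∑ j ∈ Finset.range N, η (j + 1) ^ 2 * (g (j + 1) ^ 3 / u (j + 1) t ^ 2) +
      2 / h * ∑ j ∈ Finset.range N, η (j + 1) ^ 2 * g (j + 1) *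
        ((g (j + 1 + 1) - g (j + 1)) - (g (j + 1) - g j)) := by
    rw [Finset.mul_sum, Finset.mul_sum, Finset.mul_sum, ← Finset.sum_add_distrib]
    refine Finset.sum_le_sum fun j hj => ?_
    rw [Finset.mem_range] at hj
    rcases lt_or_ge (j + 1) N with hj1 | hj1
    · have hp := hu.pos (j + 1) ht'
      have hs : 0 ≤ h * (η (j + 1) ^ 2 * (2 * g (j + 1) ^ 2)) := by positivity
      have : h * (η (j + 1) ^ 2 *
        (2 * g (j + 1) * ddg N h u (j + 1) t / u (j + 1) t - g (j + 1) ^ 3 / u (j + 1) t ^ 2)) =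
        h * (η (j + 1) ^ 2 * (g (j + 1) ^ 3 / u (j + 1) t ^ 2)) +
        2 / h * (η (j + 1) ^ 2 * g (j + 1) *
        ((g (j + 1 + 1) - g (j + 1)) - (g (j + 1) - g j))) -
        h * (η (j + 1) ^ 2 * (2 * g (j + 1) ^ 2)) := by
        rw [ddg_succ hj1]
        simp only [hg1]
        field_simp
        ring
      linarith
    · have : g (j + 1) = 0 := dg_right hj1 t
      simp [this]
  have e2 : 2 / h * ∑ j ∈ Finset.range N, η (j + 1) ^ 2 * g (j + 1) *
        ((g (j + 1 + 1) - g (j + 1)) - (g (j + 1) - g j)) ≤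
      -speedEnergy N h u η t + 4 * l ^ 2 * (h * ∑ j ∈ Finset.range N, g (j + 1) ^ 2) := by
    have e3 := sum_range_shift (N := N) (f := fun j => g j ^ 2) (by simp [g0]) (by simp [gN])
    have e4 : ∑ j ∈ Finset.range N, g (j + 1) ^ 2 =
        ∑ j ∈ Finset.range N, (g j ^ 2 + g (j + 1) ^ 2) / 2 := by
      rw [← Finset.sum_div, Finset.sum_add_distrib, e3]; ring
    have e5 : ∑ j ∈ Finset.range N, η (j + 1) ^ 2 * g (j + 1) *
        ((g (j + 1 + 1) - g (j + 1)) - (g (j + 1) - g j)) =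
        -∑ j ∈ Finset.range N, (η (j + 1) ^ 2 * g (j + 1) - η j ^ 2 * g j) * (g (j + 1) - g j) := by
      rw [sbp, neg_neg]
    rw [e5, e4, speedEnergy, ← Finset.sum_neg_distrib, ← Finset.sum_neg_distrib, Finset.mul_sum,
      Finset.mul_sum, Finset.mul_sum, ← Finset.sum_add_distrib]
    refine Finset.sum_le_sum fun j _ => ?_
    simp only [hg1]
    have b1 : (η (j + 1) - η j) ^ 2 ≤ (l * h) ^ 2 := by
      rw [← sq_abs]
      exact pow_le_pow_left₀ (abs_nonneg _) (hc.outer_lip j) 2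
    set D := g (j + 1) - g j with hD
    set E := (η j + η (j + 1)) * D with hE
    set F := (η (j + 1) - η j) * (g j + g (j + 1)) with hF
    have b2 : E ^ 2 ≤ 4 * ((η j ^ 2 + η (j + 1) ^ 2) / 2 * D ^ 2) := by
      have : (η j + η (j + 1)) ^ 2 ≤ 2 * (η j ^ 2 + η (j + 1) ^ 2) := by
        nlinarith [sq_nonneg (η j - η (j + 1))]
      have := mul_le_mul_of_nonneg_right this (sq_nonneg D)
      rw [hE]; linarith
    have b3 : F ^ 2 ≤ (l * h) ^ 2 * (2 * (g j ^ 2 + g (j + 1) ^ 2)) := by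
      rw [hF, mul_pow]
      exact mul_le_mul b1 (by nlinarith [sq_nonneg (g j - g (j + 1))]) (sq_nonneg _) (sq_nonneg _)
    have b4 : -(E * F) ≤ E ^ 2 / 4 + F ^ 2 := by nlinarith [sq_nonneg (E / 2 + F)]
    have b5 : 2 / h * -((η (j + 1) ^ 2 * g (j + 1) - η j ^ 2 * g j) * D) =
        (-2 * ((η j ^ 2 + η (j + 1) ^ 2) / 2 * D ^ 2) + -(E * F)) / h := by
      rw [hE, hF, hD]; field_simp; ring
    have b6 : -((η j ^ 2 + η (j + 1) ^ 2) / 2 * D ^ 2 / h) +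
        4 * l ^ 2 * (h * ((g j ^ 2 + g (j + 1) ^ 2) / 2)) =
        (-((η j ^ 2 + η (j + 1) ^ 2) / 2 * D ^ 2) +
          (l * h) ^ 2 * (2 * (g j ^ 2 + g (j + 1) ^ 2))) / h := by
      field_simp; ring
    rw [b5, b6]
    exact div_le_div_of_nonneg_right (by linarith) hh.le
  have e6 : h * ∑ j ∈ Finset.range N, g (j + 1) ^ 2 ≤ M * dissip N h u (fun _ => 1) t := by
    have := hu.sum_sq_le (fun _ => 1) ht'
    simpa [hg] using this
  have e7 := mul_le_mul_of_nonneg_left e6 (show 0 ≤ 4 * l ^ 2 by positivity)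
  simp only [hg1] at cub ⊢
  have e8 : 0 ≤ l ^ 2 * (M * dissip N h u (fun _ => 1) t) := by positivity
  have e9 : 0 ≤ l ^ 2 * (M * dissip N h u (fun _ => 1) t) * dissip N h u η t := by positivity
  have e10 : 0 ≤ N * h / m ^ 2 * dissip N h u (fun _ => 1) t := by positivity
  linarith

end

lemma diffusion_term_le {h l m M U A f P w δ : ℝ} (hh : 0 < h) (hm : 0 < m) (hmU : m ≤ U)
    (hUM : U ≤ M) (hw : 0 ≤ w) (hδ : δ ^ 2 ≤ 8 * l ^ 2 * h ^ 2 * w) :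
    -((U * A / h ^ 2 + f) * (w * A + δ * P)) ≤
      8 * l ^ 2 * (M + 1) * P ^ 2 + h ^ 2 * (1 / m + 1) / 2 * (w * f ^ 2) := by
  have hU : 0 < U := hm.trans_le hmU
  have a1 : -(A * δ * P * U / h ^ 2) ≤ U * w * A ^ 2 / (4 * h ^ 2) + 8 * l ^ 2 * U * P ^ 2 := by
    refine le_add_of_sq_le_four_mul (by positivity) (by positivity) ?_
    have e1 : (-(A * δ * P * U / h ^ 2)) ^ 2 = δ ^ 2 * (A ^ 2 * P ^ 2 * U ^ 2 / h ^ 4) := by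
      field_simp
    have e2 : 4 * (U * w * A ^ 2 / (4 * h ^ 2)) * (8 * l ^ 2 * U * P ^ 2) =
        8 * l ^ 2 * h ^ 2 * w * (A ^ 2 * P ^ 2 * U ^ 2 / h ^ 4) := by
      field_simp
    rw [e1, e2]
    exact mul_le_mul_of_nonneg_right hδ (by positivity)
  have a2 : -(f * w * A) ≤ U * w * A ^ 2 / (2 * h ^ 2) + w * f ^ 2 * h ^ 2 / (2 * U) := by
    refine le_add_of_sq_le_four_mul (by positivity) (by positivity) (le_of_eq ?_)
    field_simp
    ring
  have a3 : -(f * δ * P) ≤ w * f ^ 2 * h ^ 2 / 2 + 4 * l ^ 2 * P ^ 2 := by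
    refine le_add_of_sq_le_four_mul (by positivity) (by positivity) ?_
    have := mul_le_mul_of_nonneg_right hδ (show 0 ≤ f ^ 2 * P ^ 2 by positivity)
    linarith
  have a4 : w * f ^ 2 * h ^ 2 / (2 * U) ≤ w * f ^ 2 * h ^ 2 / (2 * m) := by gcongr
  have a5 : 8 * l ^ 2 * P ^ 2 * U ≤ 8 * l ^ 2 * P ^ 2 * M := by gcongr
  have a6 : 0 ≤ l ^ 2 * P ^ 2 := by positivity
  have a7 : -((U * A / h ^ 2 + f) * (w * A + δ * P)) =
      -(A * δ * P * U / h ^ 2) - f * w * A - f * δ * P - U * w * A ^ 2 / h ^ 2 := by ring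
  have a8 : U * w * A ^ 2 / (4 * h ^ 2) + U * w * A ^ 2 / (2 * h ^ 2) ≤ U * w * A ^ 2 / h ^ 2 := by
    have : 0 ≤ U * w * A ^ 2 / h ^ 2 := by positivity
    have e : U * w * A ^ 2 / (4 * h ^ 2) + U * w * A ^ 2 / (2 * h ^ 2) =
      3 / 4 * (U * w * A ^ 2 / h ^ 2) := by field_simp; ring
    linarith
  have a9 : h ^ 2 * (1 / m + 1) / 2 * (w * f ^ 2) =
      w * f ^ 2 * h ^ 2 / (2 * m) + w * f ^ 2 * h ^ 2 / 2 := by field_simp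
  rw [a7, a9]
  linarith

lemma half_add_sq_le (a b : ℝ) : ((a + b) / 2) ^ 2 ≤ (b ^ 2 + a ^ 2) / 2 := by
  nlinarith [sq_nonneg (a - b)]

lemma reaction_sq_le {U M m G b : ℝ} (hm : 0 < m) (hmU : m ≤ U) (hUM : U ≤ M) (hG : G ^ 2 ≤ b) :
    (G ^ 2 / U - U * G) ^ 2 ≤ 2 * (b / m + M ^ 3) * (G ^ 2 / U) := by
  have hU : 0 < U := hm.trans_le hmU
  have hb : 0 ≤ b := (sq_nonneg G).trans hG
  have b2 : (G ^ 2 / U - U * G) ^ 2 ≤ 2 * ((G ^ 2 / U) ^ 2 + (U * G) ^ 2) := by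
    nlinarith [sq_nonneg (G ^ 2 / U + U * G)]
  have b3 : (G ^ 2 / U) ^ 2 ≤ b / m * (G ^ 2 / U) := by
    rw [sq (G ^ 2 / U)]
    exact mul_le_mul_of_nonneg_right (by gcongr) (by positivity)
  have b4 : (U * G) ^ 2 ≤ M ^ 3 * (G ^ 2 / U) := by
    have : (U * G) ^ 2 = U ^ 3 * (G ^ 2 / U) := by field_simp
    rw [this]
    gcongr
  linarith

lemma weight_diff_sq_le {a b c r : ℝ} (h1 : |b - a| ≤ r) (h2 : |c - b| ≤ r) :
    ((b ^ 2 + c ^ 2) / 2 - (a ^ 2 + b ^ 2) / 2) ^ 2 ≤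
      8 * r ^ 2 * (((a ^ 2 + b ^ 2) / 2 + (b ^ 2 + c ^ 2) / 2) / 2) := by
  have b1 := abs_le.1 h1
  have b2 := abs_le.1 h2
  have b3 : (c - a) ^ 2 ≤ (2 * r) ^ 2 := by
    refine sq_le_sq' ?_ ?_ <;> linarith [b1.1, b1.2, b2.1, b2.2]
  have b4 : (c + a) ^ 2 ≤ 8 * (((a ^ 2 + b ^ 2) / 2 + (b ^ 2 + c ^ 2) / 2) / 2) := by
    nlinarith [sq_nonneg (c - a), sq_nonneg b]
  have b6 := mul_le_mul b3 b4 (sq_nonneg _) (sq_nonneg _)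
  linarith

section

variable {N : ℕ} {h c M T l m τ : ℝ} {u : ℕ → ℝ → ℝ} {η σ : ℕ → ℝ}

theorem DSol.deriv_speedEnergy_le (hu : DSol N h c M T u) (hc : CutoffPair N h l m τ T u η σ)
    {t : ℝ} (ht : t ∈ Icc τ T) (ht0 : 0 ≤ t) :
    ∑ j ∈ Finset.range N, (σ j ^ 2 + σ (j + 1) ^ 2) / 2 *
      (2 * (dg N h u (j + 1) t - dg N h u j t) * (ddg N h u (j + 1) t - ddg N h u j t)) / h ≤
    2 * (8 * l ^ 2 * (M + 1) * speedEnergy N h u η t + (1 / m + 1) * ((2 * (N * h) / m *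
      (speedEnergy N h u η t + l ^ 2 * (M * dissip N h u (fun _ => 1) t)) + M ^ 3) *
        dissip N h u η t)) := by
  have ht' : t ∈ Icc 0 T := ⟨ht0, ht.2⟩
  have hh := hu.hpos
  have hm := hc.mpos
  have hM : 0 ≤ M := zero_le_one.trans hu.leM
  have hy := hu.dissip_nonneg η ht'
  have ha := hu.dissip_nonneg (fun _ => 1) ht'
  have hd := hu.speedEnergy_nonneg η t
  set S := speedEnergy N h u η t + l ^ 2 * (M * dissip N h u (fun _ => 1) t) with hS
  have hS0 : 0 ≤ S := by positivity
  have hsup : ∀ k ≤ N, (η k * dg N h u k t) ^ 2 ≤ 2 * (N * h) * S := fun k hk =>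
    hu.outer_mul_sq_le hc ht' hk
  set g : ℕ → ℝ := fun j => dg N h u j t with hg
  have hg1 : ∀ j, dg N h u j t = g j := fun _ => rfl
  have gz : ∀ j, N ≤ j → g j = 0 := fun j hj => dg_right hj t
  set k : ℕ → ℝ := fun j => ddg N h u j t with hk
  have hk1 : ∀ j, ddg N h u j t = k j := fun _ => rfl
  set ρ : ℕ → ℝ := fun j => (η j ^ 2 + η (j + 1) ^ 2) / 2 with hρ
  have hρ0 : ∀ j, 0 ≤ ρ j := fun j => by positivity
  set ω : ℕ → ℝ := fun j => (σ j ^ 2 + σ (j + 1) ^ 2) / 2 with hω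
  set q : ℕ → ℝ := fun j => ω j * (g (j + 1) - g j) with hq
  have hω1 : ∀ j, ω j = (σ j ^ 2 + σ (j + 1) ^ 2) / 2 := fun _ => rfl
  have hω0 : ∀ j, 0 ≤ ω j := fun j => by rw [hω1]; positivity
  have hρ1 : ∀ j, ρ j = (η j ^ 2 + η (j + 1) ^ 2) / 2 := fun _ => rfl
  have hq1 : ∀ j, q j = ω j * (g (j + 1) - g j) := fun _ => rfl
  have kz : ∀ j, N ≤ j → k j = 0 := fun j hj => ddg_right hj t
  have hks : ∀ j, j + 1 < N → k (j + 1) = g (j + 1) ^ 2 / u (j + 1) t + u (j + 1) t *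
      ((g (j + 2) - 2 * g (j + 1) + g j) / h ^ 2 - g (j + 1)) := fun j hj => ddg_succ hj t
  have e4 : ∑ j ∈ Finset.range N, ρ j * (g (j + 1) - g j) ^ 2 / h = speedEnergy N h u η t := rfl
  have e5 : ∑ j ∈ Finset.range N, h * (η (j + 1) ^ 2 * (g (j + 1) ^ 2 / u (j + 1) t)) =
      dissip N h u η t := by rw [dissip, ← Finset.mul_sum]
  have sbp := sum_diff_mul_eq (N := N) (k := k) (q := q) (ddg_zero t) (ddg_right le_rfl t)
  have e1 : ∑ j ∈ Finset.range N, (σ j ^ 2 + σ (j + 1) ^ 2) / 2 *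
      (2 * (g (j + 1) - g j) * (k (j + 1) - k j)) / h =
      2 * ∑ j ∈ Finset.range N, -(k (j + 1) * (q (j + 1) - q j)) / h := by
    rw [← Finset.sum_div _ _ h, ← Finset.sum_div _ _ h, Finset.sum_neg_distrib, ← sbp,
      mul_div_assoc', Finset.mul_sum]
    congr 1
    refine Finset.sum_congr rfl fun j _ => ?_
    rw [hq1, hω1]; ring
  simp only [hg1, hk1]
  clear_value g k ρ ω q
  rw [e1]
  refine mul_le_mul_of_nonneg_left ?_ zero_le_two
  set B := 2 * (N * h) / m * S + M ^ 3 with hB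
  have hB0 : 0 ≤ B := by positivity
  have e2 : ∀ j ∈ Finset.range N, -(k (j + 1) * (q (j + 1) - q j)) / h ≤
      8 * l ^ 2 * (M + 1) * ((ρ j * (g (j + 1) - g j) ^ 2 / h +
        ρ (j + 1) * (g (j + 2) - g (j + 1)) ^ 2 / h) / 2) +
      (1 / m + 1) * B * (h * (η (j + 1) ^ 2 * (g (j + 1) ^ 2 / u (j + 1) t))) := by
    intro j hj
    rw [Finset.mem_range] at hj
    have hp := hu.pos (j + 1) ht'
    have r0 : 0 ≤ 8 * l ^ 2 * (M + 1) * ((ρ j * (g (j + 1) - g j) ^ 2 / h +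
        ρ (j + 1) * (g (j + 2) - g (j + 1)) ^ 2 / h) / 2) +
      (1 / m + 1) * B * (h * (η (j + 1) ^ 2 * (g (j + 1) ^ 2 / u (j + 1) t))) := by
      have := hρ0 j; have := hρ0 (j + 1); positivity
    rcases lt_or_ge (j + 1) N with hj1 | hj1
    swap
    · have : k (j + 1) = 0 := kz _ hj1
      rw [this]; simpa using r0
    by_cases hz : σ j ≠ 0 ∨ σ (j + 1) ≠ 0 ∨ σ (j + 2) ≠ 0
    swap
    · push Not at hz
      have : q (j + 1) - q j = 0 := by simp [hq1, hω1, hz.1, hz.2.1, hz.2.2]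
      rw [this]; simpa using r0
    obtain ⟨h1, h2, h3⟩ := hc.outer_eq_one j hz
    have hmU : m ≤ u (j + 1) t := hc.low (j + 1) hj1 (by rw [h2]; exact one_ne_zero) t ht
    set f := g (j + 1) ^ 2 / u (j + 1) t - u (j + 1) t * g (j + 1) with hf
    set A := g (j + 2) - 2 * g (j + 1) + g j with hA
    set P := ((g (j + 2) - g (j + 1)) + (g (j + 1) - g j)) / 2 with hP
    have hk2 : k (j + 1) = u (j + 1) t * A / h ^ 2 + f := by
      rw [hks j hj1, hA, hf]; ring
    have hq2 : q (j + 1) - q j = (ω j + ω (j + 1)) / 2 * A + (ω (j + 1) - ω j) * P := by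
      rw [hq1, hq1, hA, hP]; ring
    have hδ : (ω (j + 1) - ω j) ^ 2 ≤ 8 * l ^ 2 * h ^ 2 * ((ω j + ω (j + 1)) / 2) := by
      have := weight_diff_sq_le (hc.inner_lip j) (hc.inner_lip (j + 1))
      rw [hω1, hω1]
      linarith
    have hw : 0 ≤ (ω j + ω (j + 1)) / 2 := by have := hω0 j; have := hω0 (j + 1); positivity
    have hw1 : (ω j + ω (j + 1)) / 2 ≤ 1 := by
      have b1 := (hc.inner_sq_le j).trans (hc.outer_sq_le j)
      have b2 := (hc.inner_sq_le (j + 1)).trans (hc.outer_sq_le (j + 1))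
      have b3 := (hc.inner_sq_le (j + 2)).trans (hc.outer_sq_le (j + 2))
      rw [hω1, hω1]; linarith
    have main := diffusion_term_le (A := A) (f := f) (P := P) hh hm hmU (hu.upper (j + 1) t ht')
      hw hδ
    have hP2 : P ^ 2 ≤ (ρ j * (g (j + 1) - g j) ^ 2 + ρ (j + 1) * (g (j + 2) - g (j + 1)) ^ 2) / 2 := by
      have : ρ j = 1 := by rw [hρ1, h1, h2]; norm_num
      have h4 : ρ (j + 1) = 1 := by rw [hρ1, h2, h3]; norm_num
      rw [this, h4, hP]
      rw [one_mul, one_mul]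
      exact half_add_sq_le _ _
    have hf2 : (ω j + ω (j + 1)) / 2 * f ^ 2 ≤
        2 * B * (η (j + 1) ^ 2 * (g (j + 1) ^ 2 / u (j + 1) t)) := by
      have b1 : (ω j + ω (j + 1)) / 2 * f ^ 2 ≤ 1 * f ^ 2 :=
        mul_le_mul_of_nonneg_right hw1 (sq_nonneg _)
      have b2 := hsup (j + 1) hj1.le
      rw [h2, one_mul, hg1] at b2
      have b3 := reaction_sq_le hm hmU (hu.upper (j + 1) t ht') b2
      have b4 : 2 * (N * h) * S / m = 2 * (N * h) / m * S := by ring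
      rw [b4] at b3
      rw [h2, one_pow, one_mul, hB]
      exact (b1.trans (one_mul _).le).trans b3
    rw [hk2, hq2]
    have c1 := mul_le_mul_of_nonneg_left hP2 (show 0 ≤ 8 * l ^ 2 * (M + 1) by positivity)
    have c2 := mul_le_mul_of_nonneg_left hf2 (show 0 ≤ h ^ 2 * (1 / m + 1) / 2 by positivity)
    rw [div_le_iff₀ hh]
    refine (main.trans (add_le_add c1 c2)).trans (le_of_eq ?_)
    generalize ρ j * (g (j + 1) - g j) ^ 2 = x1
    generalize ρ (j + 1) * (g (j + 2) - g (j + 1)) ^ 2 = x2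
    generalize η (j + 1) ^ 2 * (g (j + 1) ^ 2 / u (j + 1) t) = x3
    have : x1 / h + x2 / h = (x1 + x2) / h := by ring
    rw [this]
    have h2 : (x1 + x2) / h * h = x1 + x2 := div_mul_cancel₀ _ hh.ne'
    calc _ = 8 * l ^ 2 * (M + 1) * (((x1 + x2) / h * h) / 2) + (1 / m + 1) * B * (h * x3) * h := by
          rw [h2]; ring
      _ = _ := by ring
  refine (Finset.sum_le_sum e2).trans ?_
  rw [Finset.sum_add_distrib, ← Finset.mul_sum, ← Finset.mul_sum, ← Finset.sum_div,
    Finset.sum_add_distrib]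
  have e3 : ∑ j ∈ Finset.range N, ρ (j + 1) * (g (j + 2) - g (j + 1)) ^ 2 / h ≤
      speedEnergy N h u η t := by
    have b1 := Finset.sum_range_succ (fun j => ρ j * (g (j + 1) - g j) ^ 2 / h) N
    have b2 := Finset.sum_range_succ' (fun j => ρ j * (g (j + 1) - g j) ^ 2 / h) N
    rw [gz N le_rfl, gz (N + 1) (by omega)] at b1
    have b3 : 0 ≤ ρ 0 * (g (0 + 1) - g 0) ^ 2 / h := by have := hρ0 0; positivity
    simp only [sub_self, ne_eq, OfNat.ofNat_ne_zero, not_false_eq_true, zero_pow, mul_zero,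
      zero_div, add_zero] at b1
    have b5 : ∑ j ∈ Finset.range N, ρ (j + 1) * (g (j + 2) - g (j + 1)) ^ 2 / h =
      ∑ j ∈ Finset.range N, ρ (j + 1) * (g (j + 1 + 1) - g (j + 1)) ^ 2 / h := rfl
    rw [← e4, b5]
    linarith
  rw [e4, e5]
  have e6 : 8 * l ^ 2 * (M + 1) * ((speedEnergy N h u η t +
      ∑ j ∈ Finset.range N, ρ (j + 1) * (g (j + 2) - g (j + 1)) ^ 2 / h) / 2) ≤
      8 * l ^ 2 * (M + 1) * speedEnergy N h u η t := by
    gcongr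
    linarith
  linarith

end

theorem exists_energy_bound {B C₁ T K L : ℝ} (hB : 0 ≤ B) (hC : 0 ≤ C₁) (hT : 0 ≤ T) :
    ∃ C, 0 ≤ C ∧ ∀ (τ : ℝ) (y d a Z Φ y' Z' : ℝ → ℝ), 0 ≤ τ →
      ContinuousOn y (Icc τ T) → ContinuousOn Z (Icc τ T) → ContinuousOn Φ (Icc τ T) →
      (∀ t ∈ Ioo τ T, HasDerivAt y (y' t) t) → (∀ t ∈ Ioo τ T, HasDerivAt Z (Z' t) t) →
      (∀ t ∈ Ioo τ T, HasDerivAt Φ (-a t) t) →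
      (∀ t ∈ Icc τ T, 0 ≤ y t ∧ y t ≤ a t ∧ 0 ≤ Z t ∧ 2 * Z t ≤ d t ∧ -L ≤ Φ t) →
      (∀ t ∈ Icc τ T, y' t ≤ -(d t / 2) + B * (a t * (1 + y t))) →
      (∀ t ∈ Icc τ T, Z' t ≤ C₁ * (d t + d t * y t + a t * y t + y t)) → Φ τ ≤ K →
      ∀ t ∈ Icc τ T, (t - τ) * y t ≤ C ∧ (t - τ) ^ 2 * Z t ≤ C := by
  set B₂ := 1 + B * (1 + T) with hB₂
  have hB₂0 : 0 ≤ B₂ := by positivity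
  set Y₀ := Real.exp (B₂ * (K + L)) with hY₀
  have hY₀0 : 0 < Y₀ := Real.exp_pos _
  set C₂ := 1 + C₁ * T + C₁ * Y₀ with hC₂
  have hC₂0 : 0 ≤ C₂ := by positivity
  set C₄ := C₁ * T * Y₀ with hC₄
  have hC₄0 : 0 ≤ C₄ := by positivity
  set C₃ := C₄ + 2 * C₂ * B₂ * Y₀ with hC₃
  have hC₃0 : 0 ≤ C₃ := by positivity
  refine ⟨Y₀ + |C₃ * (K + L)| + C₄ * T, by positivity, ?_⟩
  intro τ y d a Z Φ y' Z' hτ hyc hZc hΦc hyd hZd hΦd hnn hy' hZ' hK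
  have keyY : ∀ t ∈ Icc τ T, 1 + (t - τ) * y t ≤ Y₀ := by
    intro t ht
    have key := le_left_of_hasDerivAt_nonpos (p := τ) (q := T)
      (f := fun t => (1 + (t - τ) * y t) * Real.exp (B₂ * Φ t))
      (f' := fun t => ((1 * y t + (t - τ) * y' t)) * Real.exp (B₂ * Φ t) +
        (1 + (t - τ) * y t) * (Real.exp (B₂ * Φ t) * (B₂ * (-a t)))) (by fun_prop)
      (fun t ht => by
        have h1 : HasDerivAt (fun t => 1 + (t - τ) * y t) (1 * y t + (t - τ) * y' t) t :=
          (((hasDerivAt_id t).sub_const τ).mul (hyd t ht)).const_add 1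
        exact h1.mul ((hΦd t ht).const_mul B₂).exp)
      (fun t ht => by
        obtain ⟨h1, h2, h3, h4, h5⟩ := hnn t (Ioo_subset_Icc_self ht)
        have h6 := hy' t (Ioo_subset_Icc_self ht)
        have hθ : 0 ≤ t - τ := by linarith [ht.1]
        have hθT : t - τ ≤ T := by linarith [ht.2]
        have ha : 0 ≤ a t := h1.trans h2
        have h7 := mul_le_mul_of_nonneg_left h6 hθ
        have h8 : (t - τ) * (B * a t) ≤ T * (B * a t) :=
          mul_le_mul_of_nonneg_right hθT (by positivity)
        have h9 : 0 ≤ (t - τ) * (d t / 2) := mul_nonneg hθ (by linarith)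
        have h10 : 0 ≤ a t * ((t - τ) * y t) := by positivity
        have h11 : 0 ≤ B * T * (a t * ((t - τ) * y t)) := by positivity
        have h12 : 0 ≤ B * a t := by positivity
        have h13 : 1 * y t + (t - τ) * y' t ≤ B₂ * a t * (1 + (t - τ) * y t) := by
          rw [hB₂]; nlinarith
        have h14 := mul_le_mul_of_nonneg_right h13 (Real.exp_pos (B₂ * Φ t)).le
        linarith) t ht
    have h1 : (1 + (t - τ) * y t) * Real.exp (B₂ * Φ t) ≤ Real.exp (B₂ * Φ τ) := by
      simpa using key
    have h2 : Real.exp (B₂ * Φ τ) ≤ Real.exp (B₂ * (K + L)) * Real.exp (B₂ * Φ t) := by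
      rw [← Real.exp_add, Real.exp_le_exp]
      have := mul_le_mul_of_nonneg_left hK hB₂0
      have := mul_le_mul_of_nonneg_left (hnn t ht).2.2.2.2 hB₂0
      linarith
    exact le_of_mul_le_mul_right (h1.trans h2) (Real.exp_pos _)
  intro t ht
  have hC5 : 0 ≤ |C₃ * (K + L)| := abs_nonneg _
  have hC6 : 0 ≤ C₄ * T := by positivity
  refine ⟨by linarith [keyY t ht], ?_⟩
  have key := le_left_of_hasDerivAt_nonpos (p := τ) (q := T)
    (f := fun t => (t - τ) ^ 2 * Z t + 2 * C₂ * ((t - τ) * y t) + C₃ * Φ t - C₄ * t)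
    (f' := fun t => ((2 * (t - τ)) * Z t + (t - τ) ^ 2 * Z' t) +
      2 * C₂ * (1 * y t + (t - τ) * y' t) + C₃ * (-a t) - C₄) (by fun_prop)
    (fun t ht => by
      have h1 : HasDerivAt (fun t => (t - τ) * y t) (1 * y t + (t - τ) * y' t) t :=
        ((hasDerivAt_id t).sub_const τ).mul (hyd t ht)
      have h2 : HasDerivAt (fun t => (t - τ) ^ 2) (2 * (t - τ)) t := by
        refine (((hasDerivAt_id t).sub_const τ).pow 2).congr_deriv ?_
        simp
      exact (((h2.mul (hZd t ht)).add (h1.const_mul _)).add ((hΦd t ht).const_mul _)).sub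
        (hasDerivAt_const_mul C₄))
    (fun t ht => by
      have ht' := Ioo_subset_Icc_self ht
      obtain ⟨h1, h2, h3, h4, h5⟩ := hnn t ht'
      have h6 := hy' t ht'
      have h7 := hZ' t ht'
      have hY := keyY t ht'
      have hθ : 0 ≤ t - τ := by linarith [ht.1]
      have hθT : t - τ ≤ T := by linarith [ht.2]
      have ha : 0 ≤ a t := h1.trans h2
      have hd : 0 ≤ d t := by linarith
      set θ := t - τ
      have hYθ : θ * y t ≤ Y₀ := by linarith
      have hYθ0 : 0 ≤ θ * y t := by positivity
      have b1 : 2 * θ * Z t ≤ θ * d t := by nlinarith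
      have b2 : θ ^ 2 * Z' t ≤ C₁ * (T + Y₀) * (θ * d t) + C₄ * a t + C₄ := by
        have e1 := mul_le_mul_of_nonneg_left h7 (sq_nonneg θ)
        have e2 : θ ^ 2 * (C₁ * (d t + d t * y t + a t * y t + y t)) =
          C₁ * (θ * (θ * d t) + (θ * d t) * (θ * y t) + θ * (θ * y t) * a t + θ * (θ * y t)) := by
          ring
        have e3 : θ * (θ * d t) ≤ T * (θ * d t) := by gcongr
        have e4 : (θ * d t) * (θ * y t) ≤ (θ * d t) * Y₀ := by gcongr
        have e5 : θ * (θ * y t) ≤ T * Y₀ := by gcongr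
        have e6 : θ * (θ * y t) * a t ≤ T * Y₀ * a t := by gcongr
        have e7 := mul_le_mul_of_nonneg_left (add_le_add (add_le_add (add_le_add e3 e4) e6) e5) hC
        rw [e2] at e1
        refine e1.trans (e7.trans (le_of_eq ?_))
        rw [hC₄]; ring
      have b3 : 1 * y t + θ * y' t ≤ -(θ * d t / 2) + B₂ * Y₀ * a t := by
        have e1 := mul_le_mul_of_nonneg_left h6 hθ
        have e2 : θ * (B * a t) ≤ T * (B * a t) :=
          mul_le_mul_of_nonneg_right hθT (by positivity)
        have e10 : 0 ≤ a t * (θ * y t) := by positivity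
        have e11 : 0 ≤ B * T * (a t * (θ * y t)) := by positivity
        have e12 : B₂ * a t * (1 + θ * y t) ≤ B₂ * a t * Y₀ := by gcongr
        have e13 : 1 * y t + θ * y' t ≤ -(θ * d t / 2) + B₂ * a t * (1 + θ * y t) := by
          rw [hB₂]; nlinarith
        linarith
      have b4 := mul_le_mul_of_nonneg_left b3 (show 0 ≤ 2 * C₂ by positivity)
      have b5 : θ * d t + C₁ * (T + Y₀) * (θ * d t) = C₂ * (θ * d t) := by rw [hC₂]; ring
      have b6 : C₃ * -a t = -(C₄ * a t) - 2 * C₂ * (B₂ * Y₀ * a t) := by rw [hC₃]; ring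
      linarith) t ht
  have h1 : (t - τ) ^ 2 * Z t + 2 * C₂ * ((t - τ) * y t) + C₃ * Φ t - C₄ * t ≤
      C₃ * Φ τ - C₄ * τ := by simpa using key
  obtain ⟨g1, g2, g3, g4, g5⟩ := hnn t ht
  have hθ : 0 ≤ t - τ := by linarith [ht.1]
  have h2 : 0 ≤ 2 * C₂ * ((t - τ) * y t) := by positivity
  have h3 := mul_le_mul_of_nonneg_left g5 hC₃0
  have h4 := mul_le_mul_of_nonneg_left hK hC₃0
  have h5 : C₄ * (t - τ) ≤ C₄ * T := mul_le_mul_of_nonneg_left (by linarith [ht.2]) hC₄0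
  have h6 := le_abs_self (C₃ * (K + L))
  linarith

theorem exists_uniform_energy_bound {L M T l m τ : ℝ} (hM : 1 ≤ M)
    (hm : 0 < m) (hτ : 0 < τ) (hT : 0 ≤ T) (hL : 0 ≤ L) :
    ∃ C, 0 ≤ C ∧ ∀ (N : ℕ) (h c : ℝ) (u : ℕ → ℝ → ℝ) (η σ : ℕ → ℝ), N * h = L →
      DSol N h c M T u → CutoffPair N h l m τ T u η σ → ∀ t ∈ Icc (2 * τ) T,
      gradEnergy N h u t ≤ C ∧ speedEnergy N h u σ t ≤ C ∧
        ∀ k ≤ N, (σ k * dg N h u k t) ^ 2 ≤ C := by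
  set K := (L * (M + 1) + L * (1 + M ^ 2) * T) / τ with hK
  have hM0 : 0 ≤ M := by linarith
  have hK0 : 0 ≤ K := by positivity
  set C₁ := 8 * l ^ 2 * (M + 1) + (1 / m + 1) * (2 * L / m * (1 + l ^ 2 * M) + M ^ 3) with hC₁
  have hC₁0 : 0 ≤ C₁ := by positivity
  obtain ⟨C, hC, H⟩ := exists_energy_bound (B := 5 * l ^ 2 * M + L / m ^ 2) (C₁ := C₁) (T := T)
    (K := K) (L := L / 2) (by positivity) hC₁0 hT
  set D := 2 * C / τ ^ 2 with hD
  have hD0 : 0 ≤ D := by positivity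
  have hE0 : 0 ≤ 2 * L * (D + l ^ 2 * (M * (C / τ))) := by positivity
  refine ⟨2 * (K + L / 2) + D + 2 * L * (D + l ^ 2 * (M * (C / τ))), by positivity, ?_⟩
  intro N h c u η σ hNh hu hc t ht
  have hh := hu.hpos
  have hτT : 2 * τ ≤ T := ht.1.trans ht.2
  have ht1 : t ∈ Icc τ T := ⟨by linarith [ht.1], ht.2⟩
  have hsub : ∀ s ∈ Icc τ T, s ∈ Icc 0 T := fun s hs => ⟨hτ.le.trans hs.1, hs.2⟩
  have hsub' : ∀ s ∈ Ioo τ T, s ∈ Ioo 0 T := fun s hs => ⟨hτ.trans hs.1, hs.2⟩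
  have hup : ∀ s ∈ Icc τ T, freeEnergy N h u s ≤ K := by
    intro s hs
    have hs0 : 0 < s := hτ.trans_le hs.1
    have h1 := hu.freeEnergy_upper ⟨hs0, hs.2⟩
    rw [hNh] at h1
    rcases le_or_gt (freeEnergy N h u s) 0 with h0 | h0
    · exact h0.trans hK0
    rw [hK, le_div_iff₀ hτ]
    have h2 : freeEnergy N h u s * τ ≤ freeEnergy N h u s * s := by gcongr; exact hs.1
    have h3 : L * (1 + M ^ 2) * s ≤ L * (1 + M ^ 2) * T := by gcongr; exact hs.2
    linarith
  have hlow : ∀ s, gradEnergy N h u s / 2 - L / 2 ≤ freeEnergy N h u s := fun s => by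
    have := hu.freeEnergy_lower s
    rw [hNh] at this
    linarith
  have hcdg := fun j => (hu.continuousOn_dg j).mono hsub
  have hcu : ∀ j, ContinuousOn (fun t => u j t) (Icc τ T) := fun j => (hu.cont j).mono hsub
  have hcdg' : ∀ j, ContinuousOn (fun t => dg N h u j t) (Icc τ T) := hcdg
  have hne : ∀ j, ∀ s ∈ Icc τ T, u j s ≠ 0 := fun j s hs => (hu.pos j (hsub s hs)).ne'
  have H1 := H τ (dissip N h u η) (speedEnergy N h u η) (dissip N h u (fun _ => 1))
    (fun t => speedEnergy N h u σ t / 2) (freeEnergy N h u) _ _ hτ.le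
    (by
      unfold dissip
      refine continuousOn_const.mul (continuousOn_finsetSum _ fun j _ => ?_)
      exact continuousOn_const.mul (((hcdg' _).pow 2).div (hcu _) (hne _)))
    (by
      unfold speedEnergy
      fun_prop (discharger := exact hu.hpos.ne'))
    (hu.continuousOn_freeEnergy.mono hsub)
    (fun s hs => hu.hasDerivAt_dissip η (hsub' s hs))
    (fun s hs => (hu.hasDerivAt_speedEnergy σ (hsub' s hs)).div_const 2)
    (fun s hs => hu.hasDerivAt_freeEnergy (hsub' s hs))
    (fun s hs => by
      refine ⟨hu.dissip_nonneg η (hsub s hs), hu.dissip_mono (fun j => ?_) (hsub s hs), ?_, ?_, ?_⟩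
      · simpa using hc.outer_sq_le j
      · exact div_nonneg (hu.speedEnergy_nonneg σ s) zero_le_two
      · have := hu.speedEnergy_mono hc.inner_sq_le s
        linarith
      · linarith [hlow s, hu.gradEnergy_nonneg s])
    (fun s hs => by
      have := hu.deriv_dissip_le hc hs (hsub s hs).1
      rwa [hNh] at this)
    (fun s hs => by
      have h1 := hu.deriv_speedEnergy_le hc hs (hsub s hs).1
      rw [hNh] at h1
      have hy := hu.dissip_nonneg η (hsub s hs)
      have ha := hu.dissip_nonneg (fun _ => 1) (hsub s hs)
      have hd := hu.speedEnergy_nonneg η s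
      generalize speedEnergy N h u η s = d at *
      generalize dissip N h u η s = y at *
      generalize dissip N h u (fun _ => 1) s = a at *
      refine (div_le_div_of_nonneg_right h1 zero_le_two).trans ?_
      have e1 : 0 ≤ 8 * l ^ 2 * (M + 1) := by positivity
      have e2 : 0 ≤ 1 / m + 1 := by positivity
      have e3 : 0 ≤ 2 * L / m := by positivity
      have e4 : 0 ≤ l ^ 2 * M := by positivity
      have e5 : 0 ≤ M ^ 3 := by positivity
      have e6 : 0 ≤ d + d * y + a * y + y := by positivity
      have f1 : d ≤ d + d * y + a * y + y := by nlinarith [mul_nonneg hd hy, mul_nonneg ha hy]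
      have f2 : (d + l ^ 2 * M * a) * y ≤ (1 + l ^ 2 * M) * (d + d * y + a * y + y) := by
        nlinarith [mul_nonneg hd hy, mul_nonneg ha hy, mul_nonneg e4 hd, mul_nonneg e4 hy,
          mul_nonneg e4 (mul_nonneg hd hy)]
      have f3 : y ≤ d + d * y + a * y + y := by nlinarith [mul_nonneg hd hy, mul_nonneg ha hy]
      have g1 := mul_le_mul_of_nonneg_left f1 e1
      have g2 := mul_le_mul_of_nonneg_left f2 e3
      have g3 := mul_le_mul_of_nonneg_left f3 e5
      have g4 := mul_le_mul_of_nonneg_left (add_le_add g2 g3) e2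
      rw [hC₁]
      linarith)
    (hup τ ⟨le_rfl, by linarith⟩) t ht1
  obtain ⟨h1, h2⟩ := H1
  have hθ : τ ≤ t - τ := by linarith [ht.1]
  have hy := hu.dissip_nonneg η (hsub t ht1)
  have hz := hu.speedEnergy_nonneg σ t
  have hyb : dissip N h u η t ≤ C / τ := by
    rw [le_div_iff₀ hτ]
    have : τ * dissip N h u η t ≤ (t - τ) * dissip N h u η t := by gcongr
    linarith
  have hzb : speedEnergy N h u σ t ≤ D := by
    rw [hD, le_div_iff₀ (by positivity)]
    have : τ ^ 2 * speedEnergy N h u σ t ≤ (t - τ) ^ 2 * speedEnergy N h u σ t := by gcongr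
    linarith
  refine ⟨by linarith [hlow t, hup t ht1], by linarith, fun k hk => ?_⟩
  have h3 := hu.inner_mul_sq_le hc (hsub t ht1) hk
  rw [hNh] at h3
  have h4 : 2 * L * (speedEnergy N h u σ t + l ^ 2 * (M * dissip N h u η t)) ≤
    2 * L * (D + l ^ 2 * (M * (C / τ))) := by gcongr
  linarith

lemma abs_sub_le_of_steps {f : ℕ → ℝ} {E : ℝ} {j k : ℕ}
    (hf : ∀ i, min j k ≤ i → i < max j k → |f (i + 1) - f i| ≤ E) :
    |f k - f j| ≤ |(k : ℝ) - j| * E := by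
  wlog hjk : j ≤ k generalizing j k
  · rw [abs_sub_comm, abs_sub_comm (k : ℝ)]
    exact this (by rwa [min_comm, max_comm]) (le_of_not_ge hjk)
  rw [min_eq_left hjk, max_eq_right hjk] at hf
  rw [abs_of_nonneg (sub_nonneg.2 (Nat.cast_le.2 hjk)), ← Finset.sum_Ico_sub f hjk]
  calc |∑ i ∈ Finset.Ico j k, (f (i + 1) - f i)| ≤ ∑ i ∈ Finset.Ico j k, |f (i + 1) - f i| :=
        Finset.abs_sum_le_sum_abs _ _
    _ ≤ ∑ i ∈ Finset.Ico j k, E := Finset.sum_le_sum fun i hi => by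
        rw [Finset.mem_Ico] at hi
        exact hf i hi.1 hi.2
    _ = ((k : ℝ) - j) * E := by
        rw [Finset.sum_const, Nat.card_Ico, nsmul_eq_mul, Nat.cast_sub hjk]

lemma sq_sub_le_of_energy {f : ℕ → ℝ} {h S : ℝ} (hh : 0 < h) {j k : ℕ}
    (hS : ∑ i ∈ Finset.Ico (min j k) (max j k), (f (i + 1) - f i) ^ 2 / h ≤ S) :
    (f k - f j) ^ 2 ≤ S * (|(k : ℝ) - j| * h) := by
  wlog hjk : j ≤ k generalizing j k
  · rw [abs_sub_comm (k : ℝ), ← neg_sub, neg_sq]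
    exact this (by rwa [min_comm, max_comm]) (le_of_not_ge hjk)
  rw [min_eq_left hjk, max_eq_right hjk] at hS
  rw [abs_of_nonneg (sub_nonneg.2 (Nat.cast_le.2 hjk)), ← Finset.sum_Ico_sub f hjk]
  have h1 := sq_sum_le_card_mul_sum_sq (s := Finset.Ico j k) (f := fun i => f (i + 1) - f i)
  rw [Nat.card_Ico, Nat.cast_sub hjk] at h1
  refine h1.trans ?_
  rw [← Finset.sum_div, div_le_iff₀ hh] at hS
  have h2 : (0 : ℝ) ≤ (k : ℝ) - j := sub_nonneg.2 (Nat.cast_le.2 hjk)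
  calc _ ≤ ((k : ℝ) - j) * (S * h) := mul_le_mul_of_nonneg_left hS h2
    _ = _ := by ring

lemma abs_natCast_sub_le_of_between {i j k : ℕ} (h1 : min j k ≤ i) (h2 : i ≤ max j k) :
    |(i : ℝ) - j| ≤ |(k : ℝ) - j| := by
  rcases le_total j k with h | h
  · rw [min_eq_left h] at h1
    rw [max_eq_right h] at h2
    have h1' : (j : ℝ) ≤ i := by exact_mod_cast h1
    have h2' : (i : ℝ) ≤ k := by exact_mod_cast h2
    rw [abs_of_nonneg (by linarith), abs_of_nonneg (by linarith)]
    linarith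
  · rw [min_eq_right h] at h1
    rw [max_eq_left h] at h2
    have h1' : (k : ℝ) ≤ i := by exact_mod_cast h1
    have h2' : (i : ℝ) ≤ j := by exact_mod_cast h2
    rw [abs_of_nonpos (by linarith), abs_of_nonpos (by linarith)]
    linarith

lemma taylor_one_of_steps {u v : ℕ → ℝ} {h A : ℝ} (hh : 0 < h) {j k : ℕ}
    (hu : ∀ i, u (i + 1) - u i = h * v i) (hA : 0 ≤ A)
    (hv : ∀ i, min j k ≤ i → i < max j k → |v (i + 1) - v i| ≤ h * A) :
    |u k - u j - (((k : ℝ) - j) * h) * v j| ≤ A * (((k : ℝ) - j) * h) ^ 2 := by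
  have key : ∀ i, min j k ≤ i → i < max j k → |v i - v j| ≤ |(k : ℝ) - j| * (h * A) := by
    intro i h1 h2
    refine (abs_sub_le_of_steps (f := v) (j := j) (k := i) (E := h * A) fun l h3 h4 =>
      hv l (by omega) (by omega)).trans ?_
    exact mul_le_mul_of_nonneg_right (abs_natCast_sub_le_of_between h1 h2.le) (by positivity)
  have := abs_sub_le_of_steps (f := fun i => u i - i * h * v j) (j := j) (k := k)
    (E := h * (|(k : ℝ) - j| * (h * A))) fun i h1 h2 => by
      have e : u (i + 1) - ((i + 1 : ℕ) : ℝ) * h * v j - (u i - i * h * v j) =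
          h * (v i - v j) := by
        push_cast
        linear_combination hu i
      rw [e, abs_mul, abs_of_pos hh]
      exact mul_le_mul_of_nonneg_left (key i h1 h2) hh.le
  have e : u k - k * h * v j - (u j - j * h * v j) = u k - u j - (((k : ℝ) - j) * h) * v j := by
    ring
  simp only [e] at this
  refine this.trans (le_of_eq ?_)
  rw [mul_pow, ← sq_abs ((k : ℝ) - j)]
  ring

lemma taylor_half_of_steps {v w : ℕ → ℝ} {h B : ℝ} (hh : 0 < h) {j k : ℕ} (hB : 0 ≤ B)
    (hv : ∀ i, min j k ≤ i → i < max j k → v (i + 1) - v i = h * w (i + 1))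
    (hw : ∀ i, min j k ≤ i → i ≤ max j k → |w i - w j| ≤ B * √(|(i : ℝ) - j| * h)) :
    |v k - v j - (((k : ℝ) - j) * h) * w j| ≤
      B * (|((k : ℝ) - j) * h| * √|((k : ℝ) - j) * h|) := by
  have := abs_sub_le_of_steps (f := fun i => v i - i * h * w j) (j := j) (k := k)
    (E := h * (B * √(|(k : ℝ) - j| * h))) fun i h1 h2 => by
      have e : v (i + 1) - ((i + 1 : ℕ) : ℝ) * h * w j - (v i - i * h * w j) =
          h * (w (i + 1) - w j) := by
        push_cast
        linear_combination hv i h1 h2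
      rw [e, abs_mul, abs_of_pos hh]
      refine mul_le_mul_of_nonneg_left ((hw (i + 1) (by omega) (by omega)).trans ?_) hh.le
      refine mul_le_mul_of_nonneg_left (Real.sqrt_le_sqrt ?_) hB
      exact mul_le_mul_of_nonneg_right (abs_natCast_sub_le_of_between (by omega) (by omega)) hh.le
  have e : v k - k * h * w j - (v j - j * h * w j) = v k - v j - (((k : ℝ) - j) * h) * w j := by
    ring
  simp only [e] at this
  refine this.trans (le_of_eq ?_)
  rw [abs_mul, abs_of_pos hh]
  ring

lemma abs_ratio_sub_le {g g' u u' m E r : ℝ} (hm : 0 < m) (hu : m ≤ u) (hu' : m ≤ u')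
    (hg : g ^ 2 ≤ E) (hgg : (g' - g) ^ 2 ≤ E * r) (huu : (u' - u) ^ 2 ≤ E * r) (hE : 0 ≤ E) :
    |(g' / u' - 1 + u') - (g / u - 1 + u)| ≤ (√E / m + E / m ^ 2 + √E) * √r := by
  have h0 : 0 < u := hm.trans_le hu
  have h0' : 0 < u' := hm.trans_le hu'
  have e : (g' / u' - 1 + u') - (g / u - 1 + u) =
      (g' - g) / u' + -(g * (u' - u) / (u * u')) + (u' - u) := by
    field_simp
    ring
  have a1 : |g' - g| ≤ √E * √r := by
    rw [← Real.sqrt_mul hE]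
    exact Real.abs_le_sqrt hgg
  have a2 : |u' - u| ≤ √E * √r := by
    rw [← Real.sqrt_mul hE]
    exact Real.abs_le_sqrt huu
  have a3 : |g| ≤ √E := Real.abs_le_sqrt hg
  rw [e]
  have b1 : |(g' - g) / u'| ≤ √E * √r / m := by
    rw [abs_div, abs_of_pos h0']
    gcongr
  have b2 : |(-(g * (u' - u) / (u * u')))| ≤ √E * (√E * √r) / (m * m) := by
    rw [abs_neg, abs_div, abs_mul, abs_of_pos (mul_pos h0 h0')]
    gcongr
  have := abs_add_three ((g' - g) / u') (-(g * (u' - u) / (u * u'))) (u' - u)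
  have e2 : √E * (√E * √r) / (m * m) = E / m ^ 2 * √r := by
    rw [← mul_assoc, Real.mul_self_sqrt hE]
    ring
  calc _ ≤ √E * √r / m + √E * (√E * √r) / (m * m) + √E * √r := by linarith
    _ = _ := by
      rw [e2]
      ring

lemma abs_ratio_le {g u m M E : ℝ} (hm : 0 < m) (hu : m ≤ u) (huM : u ≤ M)
    (hg : g ^ 2 ≤ E) : |g / u - 1 + u| ≤ √E / m + 1 + M := by
  have h0 : 0 < u := hm.trans_le hu
  have a3 : |g| ≤ √E := Real.abs_le_sqrt hg
  have b1 : |g / u| ≤ √E / m := by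
    rw [abs_div, abs_of_pos h0]
    gcongr
  rw [abs_le] at *
  constructor <;> linarith

lemma abs_le_of_taylor {u u' v r M A L d : ℝ} (hd : 0 < d) (hr : d ≤ |r|) (hrL : |r| ≤ L)
    (hu : |u| ≤ M) (hu' : |u'| ≤ M) (hA : 0 ≤ A) (h : |u' - u - r * v| ≤ A * r ^ 2) :
    |v| ≤ (2 * M + A * L ^ 2) / d := by
  rw [le_div_iff₀ hd]
  have h1 : |r * v| ≤ 2 * M + A * L ^ 2 := by
    have : r ^ 2 ≤ L ^ 2 := by
      rw [← sq_abs]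
      gcongr
    have h3 := mul_le_mul_of_nonneg_left this hA
    rw [abs_le] at *
    constructor <;> linarith
  calc |v| * d ≤ |v| * |r| := by gcongr
    _ = |r * v| := by rw [abs_mul, mul_comm]
    _ ≤ _ := h1

/-- The index of the grid point at or just to the left of `x`, among the first `N`. -/
noncomputable def gridIndex (N : ℕ) (a h x : ℝ) : ℕ := min ⌊(x - a) / h⌋₊ (N - 1)

lemma gridIndex_lt {N : ℕ} (hN : 0 < N) (a h x : ℝ) : gridIndex N a h x < N := by
  unfold gridIndex
  omega

lemma gridIndex_mem {N : ℕ} {a h x : ℝ} (hN : 0 < N) (hh : 0 < h)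
    (hx : x ∈ Icc a (a + N * h)) : a + gridIndex N a h x * h ∈ Icc (x - h) x := by
  have h0 : 0 ≤ (x - a) / h := div_nonneg (by linarith [hx.1]) hh.le
  have h1 := Nat.floor_le h0
  have h2 := Nat.lt_floor_add_one ((x - a) / h)
  rw [le_div_iff₀ hh] at h1
  rw [div_lt_iff₀ hh] at h2
  unfold gridIndex
  rcases le_total ⌊(x - a) / h⌋₊ (N - 1) with hc | hc
  · rw [min_eq_left hc]
    constructor <;> linarith
  · rw [min_eq_right hc]
    have h3 : (((N - 1 : ℕ) : ℝ)) = N - 1 := by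
      rw [Nat.cast_sub hN, Nat.cast_one]
    have h4 : ((N - 1 : ℕ) : ℝ) * h ≤ ⌊(x - a) / h⌋₊ * h :=
      mul_le_mul_of_nonneg_right (Nat.cast_le.2 hc) hh.le
    refine ⟨?_, by linarith⟩
    rw [h3]
    have := hx.2
    linarith

/-- The discrete second space derivative of a discrete solution, recovered from the equation. -/
noncomputable def dw (N : ℕ) (h : ℝ) (u : ℕ → ℝ → ℝ) (j : ℕ) (t : ℝ) : ℝ :=
  dg N h u j t / u j t - 1 + u j t

/-- The constant in the discrete Taylor estimates. -/
noncomputable def regConst (E m M L d : ℝ) : ℝ :=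
  M + (√E / m + 1 + M) + (√E / m + E / m ^ 2 + √E) + (2 * M + (√E / m + 1 + M) * L ^ 2) / d

section

variable {N : ℕ} {h c M T : ℝ} {u : ℕ → ℝ → ℝ}

lemma DSol.dw_succ (hu : DSol N h c M T u) {j : ℕ} (hj : j + 1 < N) {t : ℝ} (ht : t ∈ Icc 0 T) :
    (u (j + 2) t - u (j + 1) t) / h - (u (j + 1) t - u j t) / h = h * dw N h u (j + 1) t := by
  have := hu.hpos.ne'
  rw [dw, hu.sq_div hj ht]
  field_simp
  ring

lemma DSol.dg_eq (hu : DSol N h c M T u) (j : ℕ) {t : ℝ} (ht : t ∈ Icc 0 T) :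
    dg N h u j t = u j t * (dw N h u j t + 1 - u j t) := by
  have := (hu.pos j ht).ne'
  rw [dw]
  field_simp
  ring

/-- The sites of the grid lying between `α - h` and `β`. -/
def gridSites (N : ℕ) (a h α β : ℝ) : Set ℕ := {j | j < N ∧ a + j * h ∈ Icc (α - h) β}

lemma gridIndex_mem_gridSites {a α β x : ℝ} (hN : 0 < N) (hh : 0 < h) (hα : a ≤ α)
    (hβ : β ≤ a + N * h) (hx : x ∈ Icc α β) : gridIndex N a h x ∈ gridSites N a h α β := by
  have := gridIndex_mem hN hh (x := x) ⟨hα.trans hx.1, hx.2.trans hβ⟩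
  exact ⟨gridIndex_lt hN a h x, by linarith [this.1, hx.1], this.2.trans hx.2⟩

lemma gridSites_between {a α β : ℝ} (hh : 0 < h) {i j k : ℕ} (hj : j ∈ gridSites N a h α β)
    (hk : k ∈ gridSites N a h α β) (h1 : min j k ≤ i) (h2 : i ≤ max j k) :
    i ∈ gridSites N a h α β := by
  refine ⟨by have := hj.1; have := hk.1; omega, ?_, ?_⟩
  · have h3 : α - h ≤ a + (min j k : ℕ) * h := by
      rcases min_choice j k with e | e <;> rw [e]
      exacts [hj.2.1, hk.2.1]
    have : ((min j k : ℕ) : ℝ) * h ≤ i * h :=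
      mul_le_mul_of_nonneg_right (Nat.cast_le.2 h1) hh.le
    linarith
  · have h3 : a + (max j k : ℕ) * h ≤ β := by
      rcases max_choice j k with e | e <;> rw [e]
      exacts [hj.2.2, hk.2.2]
    have : (i : ℝ) * h ≤ (max j k : ℕ) * h :=
      mul_le_mul_of_nonneg_right (Nat.cast_le.2 h2) hh.le
    linarith

lemma DSol.abs_dw_le (hu : DSol N h c M T u) {E m t : ℝ} {σ : ℕ → ℝ} (hm : 0 < m)
    (ht : t ∈ Icc 0 T) {j : ℕ} (hj : j ≤ N) (hσ : σ j = 1) (hlow : m ≤ u j t)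
    (hd : ∀ k ≤ N, (σ k * dg N h u k t) ^ 2 ≤ E) : |dw N h u j t| ≤ √E / m + 1 + M := by
  have := hd j hj
  rw [hσ, one_mul] at this
  exact abs_ratio_le hm hlow (hu.upper j t ht) this

lemma DSol.abs_dw_sub_le (hu : DSol N h c M T u) {E m t : ℝ} {σ : ℕ → ℝ} (hm : 0 < m)
    {j k : ℕ} (hj : j < N) (hk : k < N)
    (hσ : ∀ i, min j k ≤ i → i ≤ max j k → σ i = 1)
    (hlow : ∀ i, min j k ≤ i → i ≤ max j k → m ≤ u i t)
    (hg : gradEnergy N h u t ≤ E) (hs : speedEnergy N h u σ t ≤ E)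
    (hd : ∀ k ≤ N, (σ k * dg N h u k t) ^ 2 ≤ E) :
    |dw N h u k t - dw N h u j t| ≤
      (√E / m + E / m ^ 2 + √E) * √(|(k : ℝ) - j| * h) := by
  have hh := hu.hpos
  have hE : 0 ≤ E := (hu.gradEnergy_nonneg t).trans hg
  have hsub : Finset.Ico (min j k) (max j k) ⊆ Finset.range N := by
    intro i hi
    rw [Finset.mem_Ico] at hi
    rw [Finset.mem_range]
    omega
  have h1 : (dg N h u k t - dg N h u j t) ^ 2 ≤ E * (|(k : ℝ) - j| * h) := by
    refine sq_sub_le_of_energy (f := fun i => dg N h u i t) hh (le_trans ?_ hs)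
    calc _ = ∑ i ∈ Finset.Ico (min j k) (max j k), (σ i ^ 2 + σ (i + 1) ^ 2) / 2 *
          (dg N h u (i + 1) t - dg N h u i t) ^ 2 / h := by
          refine Finset.sum_congr rfl fun i hi => ?_
          rw [Finset.mem_Ico] at hi
          rw [hσ i hi.1 hi.2.le, hσ (i + 1) (by omega) (by omega)]
          ring
      _ ≤ _ := Finset.sum_le_sum_of_subset_of_nonneg hsub fun i _ _ => by positivity
  have h2 : (u k t - u j t) ^ 2 ≤ E * (|(k : ℝ) - j| * h) := by
    refine sq_sub_le_of_energy (f := fun i => u i t) hh (le_trans ?_ hg)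
    exact Finset.sum_le_sum_of_subset_of_nonneg hsub fun i _ _ => by positivity
  have h3 := hd j hj.le
  rw [hσ j (by omega) (by omega), one_mul] at h3
  exact abs_ratio_sub_le hm (hlow j (by omega) (by omega)) (hlow k (by omega) (by omega)) h3 h1 h2
    hE

theorem DSol.reg (hu : DSol N h c M T u) {a α β τ E m : ℝ} {σ : ℕ → ℝ} (hN : 0 < N)
    (hα : a ≤ α) (hβ : β ≤ a + N * h) (hαβ : α < β) (hhβ : 8 * h ≤ β - α) (hτ : 0 < τ)
    (hτT : τ ≤ T)
    (hm : 0 < m) (hσ : ∀ j ∈ gridSites N a h α β, σ j = 1)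
    (hlow : ∀ j ∈ gridSites N a h α β, ∀ t ∈ Icc τ T, m ≤ u j t)
    (hE : ∀ t ∈ Icc τ T, gradEnergy N h u t ≤ E ∧ speedEnergy N h u σ t ≤ E ∧
      ∀ k ≤ N, (σ k * dg N h u k t) ^ 2 ≤ E) :
    Reg (regConst E m M (N * h) ((β - α) / 4)) α β τ T (fun x => a + gridIndex N a h x * h)
      (fun x t => u (gridIndex N a h x) t)
      (fun x t => (u (gridIndex N a h x + 1) t - u (gridIndex N a h x) t) / h)
      (fun x t => dw N h u (gridIndex N a h x) t) := by
  have hh := hu.hpos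
  have hM := hu.leM
  have hc := hu.cpos
  have hE0 : 0 ≤ E := (hu.gradEnergy_nonneg τ).trans (hE τ ⟨le_rfl, hτT⟩).1
  have hJ : ∀ x ∈ Icc α β, gridIndex N a h x ∈ gridSites N a h α β := fun x hx =>
    gridIndex_mem_gridSites hN hh hα hβ hx
  have hT : ∀ t ∈ Icc τ T, t ∈ Icc 0 T := fun t ht => ⟨hτ.le.trans ht.1, ht.2⟩
  have hd : 0 < (β - α) / 4 := by linarith
  have habs : ∀ j, ∀ t ∈ Icc τ T, |u j t| ≤ M := fun j t ht => by
    rw [abs_of_pos (hu.pos j (hT t ht))]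
    exact hu.upper j t (hT t ht)
  have hA0 : 0 ≤ √E / m + 1 + M := by positivity
  have hB0 : 0 ≤ √E / m + E / m ^ 2 + √E := by positivity
  have hV0 : 0 ≤ (2 * M + (√E / m + 1 + M) * (N * h) ^ 2) / ((β - α) / 4) := by positivity
  have hM0 : 0 ≤ M := by linarith
  have hC1 : M ≤ regConst E m M (N * h) ((β - α) / 4) := by
    unfold regConst; linarith
  have hC2 : √E / m + 1 + M ≤ regConst E m M (N * h) ((β - α) / 4) := by
    unfold regConst; linarith
  have hC3 : √E / m + E / m ^ 2 + √E ≤ regConst E m M (N * h) ((β - α) / 4) := by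
    unfold regConst; linarith
  have hC4 : (2 * M + (√E / m + 1 + M) * (N * h) ^ 2) / ((β - α) / 4) ≤
      regConst E m M (N * h) ((β - α) / 4) := by
    unfold regConst; linarith
  have hw : ∀ j ∈ gridSites N a h α β, ∀ t ∈ Icc τ T, |dw N h u j t| ≤ √E / m + 1 + M :=
    fun j hj t ht => hu.abs_dw_le hm (hT t ht) hj.1.le (hσ j hj) (hlow j hj t ht) (hE t ht).2.2
  have htay1 : ∀ j ∈ gridSites N a h α β, ∀ k ∈ gridSites N a h α β, ∀ t ∈ Icc τ T,
      |u k t - u j t - (((k : ℝ) - j) * h) * ((u (j + 1) t - u j t) / h)| ≤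
        (√E / m + 1 + M) * (((k : ℝ) - j) * h) ^ 2 := by
    intro j hj k hk t ht
    refine taylor_one_of_steps (u := fun i => u i t) (v := fun i => (u (i + 1) t - u i t) / h)
      hh (fun i => by field_simp) hA0 fun i h1 h2 => ?_
    have hi := gridSites_between hh hj hk (i := i + 1) (by omega) (by omega)
    rw [hu.dw_succ hi.1 (hT t ht), abs_mul, abs_of_pos hh]
    exact mul_le_mul_of_nonneg_left (hw _ hi t ht) hh.le
  have hX : ∀ j k : ℕ, a + (k : ℝ) * h - (a + (j : ℝ) * h) = ((k : ℝ) - j) * h := fun j k => by ring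
  refine ⟨fun x hx t ht => (habs _ t ht).trans hC1, fun x hx t ht => ?_,
    fun x hx t ht => (hw _ (hJ x hx) t ht).trans hC2, fun x hx y hy t ht => ?_,
    fun x hx y hy t ht => ?_, fun x hx s hs t ht hst => ?_⟩
  · refine le_trans ?_ hC4
    have hxs := gridIndex_mem hN hh (x := x) ⟨hα.trans hx.1, hx.2.trans hβ⟩
    obtain ⟨y, hy, hxy⟩ : ∃ y ∈ Icc α β, (β - α) / 4 + h ≤ |y - x| := by
      rcases le_total (x - α) (β - x) with hc | hc
      · exact ⟨β, ⟨hαβ.le, le_rfl⟩, (by linarith : _ ≤ β - x).trans (le_abs_self _)⟩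
      · exact ⟨α, ⟨le_rfl, hαβ.le⟩, (by linarith : _ ≤ -(α - x)).trans (neg_le_abs _)⟩
    have hys := gridIndex_mem hN hh (x := y) ⟨hα.trans hy.1, hy.2.trans hβ⟩
    have h1 := htay1 _ (hJ x hx) _ (hJ y hy) t ht
    rw [← hX] at h1
    refine abs_le_of_taylor hd ?_ ?_ (habs _ t ht) (habs _ t ht) hA0 h1
    · rcases le_abs.1 hxy with h2 | h2
      · exact (by linarith [hxs.2, hys.1] : _ ≤ _).trans (le_abs_self _)
      · exact (by linarith [hxs.1, hys.2] : _ ≤ -(_ : ℝ)).trans (neg_le_abs _)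
    · rw [hX, abs_mul, abs_of_pos hh]
      refine mul_le_mul_of_nonneg_right ?_ hh.le
      have h3 : (gridIndex N a h x : ℝ) ≤ N := Nat.cast_le.2 (hJ x hx).1.le
      have h4 : (gridIndex N a h y : ℝ) ≤ N := Nat.cast_le.2 (hJ y hy).1.le
      have h5 : (0 : ℝ) ≤ gridIndex N a h x := Nat.cast_nonneg _
      have h6 : (0 : ℝ) ≤ gridIndex N a h y := Nat.cast_nonneg _
      rw [abs_le]
      constructor <;> linarith
  · simp only [hX]
    exact (htay1 _ (hJ x hx) _ (hJ y hy) t ht).trans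
      (mul_le_mul_of_nonneg_right hC2 (sq_nonneg _))
  · simp only [hX]
    refine (taylor_half_of_steps (v := fun i => (u (i + 1) t - u i t) / h)
      (w := fun i => dw N h u i t) hh hB0 (fun i h1 h2 => ?_) fun i h1 h2 => ?_).trans
      (mul_le_mul_of_nonneg_right hC3 (by positivity))
    · exact hu.dw_succ (gridSites_between hh (hJ x hx) (hJ y hy) (i := i + 1) (by omega)
        (by omega)).1 (hT t ht)
    · have hi := gridSites_between hh (hJ x hx) (hJ y hy) h1 h2
      refine hu.abs_dw_sub_le hm (hJ x hx).1 hi.1 (fun l h3 h4 => hσ l ?_)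
        (fun l h3 h4 => hlow l ?_ t ht) (hE t ht).1 (hE t ht).2.1 (hE t ht).2.2
      · exact gridSites_between hh (hJ x hx) hi h3 h4
      · exact gridSites_between hh (hJ x hx) hi h3 h4
  · rcases hst.eq_or_lt with rfl | hlt
    · exact ⟨s, ⟨le_rfl, le_rfl⟩, by ring⟩
    · obtain ⟨ξ, hξ, h1⟩ := exists_hasDerivAt_eq_slope (u (gridIndex N a h x))
        (dg N h u (gridIndex N a h x)) hlt
        ((hu.cont _).mono (Icc_subset_Icc (hT s hs).1 ht.2))
        (fun r hr => hu.hasDerivAt _ ⟨(hT s hs).1.trans_lt hr.1, hr.2.trans_le ht.2⟩)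
      refine ⟨ξ, Ioo_subset_Icc_self hξ, ?_⟩
      rw [← hu.dg_eq _ ⟨(hT s hs).1.trans hξ.1.le, hξ.2.le.trans ht.2⟩, h1]
      have : t - s ≠ 0 := by linarith
      field_simp

end

/-- A trapezoidal cutoff with slopes `1 / δ` and support `[p, q]`. -/
noncomputable def trapezoid (p q δ x : ℝ) : ℝ := max 0 (min 1 (min ((x - p) / δ) ((q - x) / δ)))

lemma trapezoid_nonneg (p q δ x : ℝ) : 0 ≤ trapezoid p q δ x := le_max_left _ _

lemma trapezoid_le_one (p q δ x : ℝ) : trapezoid p q δ x ≤ 1 :=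
  max_le zero_le_one (min_le_left _ _)

lemma trapezoid_eq_one {p q δ x : ℝ} (hδ : 0 < δ) (h : x ∈ Icc (p + δ) (q - δ)) :
    trapezoid p q δ x = 1 := by
  have h1 : 1 ≤ (x - p) / δ := by rw [le_div_iff₀ hδ]; linarith [h.1]
  have h2 : 1 ≤ (q - x) / δ := by rw [le_div_iff₀ hδ]; linarith [h.2]
  rw [trapezoid, min_eq_left (le_min h1 h2), max_eq_right zero_le_one]

lemma mem_of_trapezoid_ne_zero {p q δ x : ℝ} (hδ : 0 < δ) (h : trapezoid p q δ x ≠ 0) :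
    x ∈ Icc p q := by
  by_contra hx
  apply h
  rw [trapezoid]
  refine max_eq_left ((min_le_right _ _).trans ?_)
  rw [mem_Icc, not_and_or, not_le, not_le] at hx
  rcases hx with hx | hx
  · exact (min_le_left _ _).trans (div_nonpos_of_nonpos_of_nonneg (by linarith) hδ.le)
  · exact (min_le_right _ _).trans (div_nonpos_of_nonpos_of_nonneg (by linarith) hδ.le)

lemma abs_trapezoid_sub_le {p q δ : ℝ} (hδ : 0 < δ) (x y : ℝ) :
    |trapezoid p q δ x - trapezoid p q δ y| ≤ δ⁻¹ * |x - y| := by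
  unfold trapezoid
  refine (abs_max_sub_max_le_max _ _ _ _).trans (max_le (by simp; positivity) ?_)
  refine (abs_min_sub_min_le_max _ _ _ _).trans (max_le (by simp; positivity) ?_)
  refine (abs_min_sub_min_le_max _ _ _ _).trans (max_le (le_of_eq ?_) (le_of_eq ?_))
  · rw [← sub_div, abs_div, abs_of_pos hδ, div_eq_inv_mul]
    congr 2
    ring
  · rw [← sub_div, abs_div, abs_of_pos hδ, div_eq_inv_mul, abs_sub_comm x]
    congr 2
    ring

lemma cutoffPair_one {N : ℕ} {h c M T τ : ℝ} {u : ℕ → ℝ → ℝ} (hu : DSol N h c M T u)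
    (hτ : 0 ≤ τ) : CutoffPair N h 0 c τ T u (fun _ => 1) fun _ => 1 where
  lpos := le_rfl
  mpos := hu.cpos
  outer_nonneg _ := zero_le_one
  outer_le _ := le_rfl
  inner_nonneg _ := zero_le_one
  inner_le _ := le_rfl
  outer_lip _ := by simp
  inner_lip _ := by simp
  outer_eq_one _ _ := ⟨rfl, rfl, rfl⟩
  low j _ _ t ht := hu.lower j t ⟨hτ.trans ht.1, ht.2⟩

lemma cutoffPair_trapezoid {N : ℕ} {h m T τ a α β δ : ℝ} {u : ℕ → ℝ → ℝ} (hh : 0 < h)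
    (hδ : 0 < δ) (hhδ : 2 * h ≤ δ) (hm : 0 < m)
    (hlow : ∀ j < N, a + j * h ∈ Icc (α - 4 * δ) (β + 4 * δ) → ∀ t ∈ Icc τ T, m ≤ u j t) :
    CutoffPair N h δ⁻¹ m τ T u (fun j => trapezoid (α - 4 * δ) (β + 4 * δ) δ (a + j * h))
      fun j => trapezoid (α - 2 * δ) (β + 2 * δ) δ (a + j * h) where
  lpos := by positivity
  mpos := hm
  outer_nonneg _ := trapezoid_nonneg _ _ _ _
  outer_le _ := trapezoid_le_one _ _ _ _
  inner_nonneg _ := trapezoid_nonneg _ _ _ _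
  inner_le _ := trapezoid_le_one _ _ _ _
  outer_lip j := by
    refine (abs_trapezoid_sub_le hδ _ _).trans (le_of_eq ?_)
    congr 1
    rw [show a + ((j + 1 : ℕ) : ℝ) * h - (a + j * h) = h by push_cast; ring, abs_of_pos hh]
  inner_lip j := by
    refine (abs_trapezoid_sub_le hδ _ _).trans (le_of_eq ?_)
    congr 1
    rw [show a + ((j + 1 : ℕ) : ℝ) * h - (a + j * h) = h by push_cast; ring, abs_of_pos hh]
  outer_eq_one j hj := by
    have hx : a + j * h ∈ Icc (α - 3 * δ) (β + 2 * δ) := by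
      rcases hj with hj | hj | hj
      all_goals
        have := mem_of_trapezoid_ne_zero hδ hj
        push_cast at this
        constructor <;> linarith [this.1, this.2]
    refine ⟨?_, ?_, ?_⟩
    all_goals
      refine trapezoid_eq_one hδ ?_
      push_cast
      constructor <;> linarith [hx.1, hx.2]
  low j hj hne := hlow j hj (mem_of_trapezoid_ne_zero hδ hne)

/-- The mesh width of the uniform grid with `N + 1` cells on `[a, b]`. -/
noncomputable def gridStep (a b : ℝ) (N : ℕ) : ℝ := (b - a) / ((N + 1 : ℕ) : ℝ)

lemma gridStep_mul (a b : ℝ) (N : ℕ) : ((N + 1 : ℕ) : ℝ) * gridStep a b N = b - a := by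
  have : ((N + 1 : ℕ) : ℝ) ≠ 0 := Nat.cast_ne_zero.2 (Nat.succ_ne_zero N)
  rw [gridStep, mul_div_cancel₀ _ this]

lemma gridStep_pos {a b : ℝ} (hab : a < b) (N : ℕ) : 0 < gridStep a b N :=
  div_pos (sub_pos.2 hab) (Nat.cast_pos.2 N.succ_pos)

lemma tendsto_gridStep (a b : ℝ) : Tendsto (gridStep a b) atTop (𝓝 0) := by
  unfold gridStep
  exact ((tendsto_const_div_atTop_nhds_zero_nat (b - a)).comp (tendsto_add_atTop_nat 1))

lemma eventually_gridStep_le (a b : ℝ) {ε : ℝ} (hε : 0 < ε) :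
    ∀ᶠ N in (hyperfilter ℕ : Filter ℕ), gridStep a b N ≤ ε :=
  (((tendsto_gridStep a b).eventually (gt_mem_nhds hε)).mono fun _ h => le_of_lt h).filter_mono
    Nat.hyperfilter_le_atTop

/-- The grid point to the left of `x` in the `N`-th grid. -/
noncomputable def site (a b : ℝ) (N : ℕ) (x : ℝ) : ℕ := gridIndex (N + 1) a (gridStep a b N) x

lemma site_mem {a b x : ℝ} (hab : a < b) (N : ℕ) (hx : x ∈ Icc a b) :
    a + site a b N x * gridStep a b N ∈ Icc (x - gridStep a b N) x :=
  gridIndex_mem N.succ_pos (gridStep_pos hab N) (by rwa [gridStep_mul, add_sub_cancel])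

lemma site_lt (a b : ℝ) (N : ℕ) (x : ℝ) : site a b N x < N + 1 := gridIndex_lt N.succ_pos _ _ _

lemma tendsto_site {a b x : ℝ} (hab : a < b) (hx : x ∈ Icc a b) :
    Tendsto (fun N => a + site a b N x * gridStep a b N) (hyperfilter ℕ : Filter ℕ) (𝓝 x) := by
  refine Tendsto.mono_left ?_ Nat.hyperfilter_le_atTop
  refine tendsto_of_tendsto_of_tendsto_of_le_of_le (g := fun N => x - gridStep a b N)
    (h := fun _ => x) ?_ tendsto_const_nhds (fun N => (site_mem hab N hx).1)
    fun N => (site_mem hab N hx).2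
  simpa using (tendsto_gridStep a b).const_sub x

/-- A sequence of discrete solutions on finer and finer grids with initial datum `f`. -/
structure DSeq (a b c M T : ℝ) (f : ℝ → ℝ) (u : ℕ → ℕ → ℝ → ℝ) : Prop where
  sol : ∀ N, DSol (N + 1) (gridStep a b N) c M T (u N)
  init : ∀ N, ∀ j ≤ N + 1, u N j 0 = f (a + j * gridStep a b N)

theorem exists_dSeq {a b c M T : ℝ} (hab : a < b) (hc : 0 < c) (hc1 : c ≤ 1) (hM : 1 ≤ M)
    (hT : 0 < T) {f : ℝ → ℝ} (hf : ∀ x ∈ Icc a b, f x ∈ Icc c M) (hfa : f a = c)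
    (hfb : f b = c) : ∃ u, DSeq a b c M T f u := by
  have key : ∀ N : ℕ, ∃ u, DSol (N + 1) (gridStep a b N) c M T u ∧
      ∀ j ≤ N + 1, u j 0 = f (a + j * gridStep a b N) := by
    intro N
    have hs := gridStep_mul a b N
    have hp := gridStep_pos hab N
    obtain ⟨u, hu, h0⟩ := exists_dSol (N := N + 1) (f := fun j => if j < N + 1 then
      f (a + j * gridStep a b N) else c) hp hc hc1 hM hT (fun j => by
        split_ifs with hj
        · refine hf _ ⟨by have : 0 ≤ (j : ℝ) * gridStep a b N := by positivity
                          linarith, ?_⟩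
          have : (j : ℝ) * gridStep a b N ≤ ((N + 1 : ℕ) : ℝ) * gridStep a b N :=
            mul_le_mul_of_nonneg_right (Nat.cast_le.2 hj.le) hp.le
          linarith
        · exact ⟨le_rfl, hc1.trans hM⟩) (by simp [hfa]) (fun j hj => by
        rw [if_neg (by omega)])
    refine ⟨u, hu, fun j hj => ?_⟩
    rw [h0]
    split_ifs with h1
    · rfl
    · obtain rfl : j = N + 1 := by omega
      rw [hs, add_sub_cancel, hfb]
  choose u h1 h2 using key
  exact ⟨u, h1, h2⟩

/-- The limit of discrete solutions. -/
noncomputable def limSol (a b : ℝ) (u : ℕ → ℕ → ℝ → ℝ) (x t : ℝ) : ℝ :=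
  ulim fun N => u N (site a b N x) t

/-- The limit of the difference quotients of discrete solutions. -/
noncomputable def limSolV (a b : ℝ) (u : ℕ → ℕ → ℝ → ℝ) (x t : ℝ) : ℝ :=
  ulim fun N => (u N (site a b N x + 1) t - u N (site a b N x) t) / gridStep a b N

/-- The limit of the second difference quotients of discrete solutions. -/
noncomputable def limSolW (a b : ℝ) (u : ℕ → ℕ → ℝ → ℝ) (x t : ℝ) : ℝ :=
  ulim fun N => dw (N + 1) (gridStep a b N) (u N) (site a b N x) t

section

variable {a b c M T : ℝ} {f : ℝ → ℝ} {u : ℕ → ℕ → ℝ → ℝ}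

lemma DSeq.tendsto (hu : DSeq a b c M T f u) (x : ℝ) {t : ℝ} (ht : t ∈ Icc 0 T) :
    Tendsto (fun N => u N (site a b N x) t) (hyperfilter ℕ : Filter ℕ) (𝓝 (limSol a b u x t)) := by
  refine tendsto_ulim (C := M) (Eventually.of_forall fun N => ?_)
  rw [abs_of_pos ((hu.sol N).pos _ ht)]
  exact (hu.sol N).upper _ t ht

lemma limSol_reg {C α β s : ℝ} (hab : a < b) (haα : a ≤ α) (hαβ : α < β) (hβb : β ≤ b)
    (hs : s ≤ T)
    (h : ∀ᶠ N in (hyperfilter ℕ : Filter ℕ), Reg C α β s T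
      (fun x => a + site a b N x * gridStep a b N) (fun x t => u N (site a b N x) t)
      (fun x t => (u N (site a b N x + 1) t - u N (site a b N x) t) / gridStep a b N)
      (fun x t => dw (N + 1) (gridStep a b N) (u N) (site a b N x) t)) :
    Reg C α β s T id (limSol a b u) (limSolV a b u) (limSolW a b u) :=
  Reg.limit hαβ hs
    (fun _ hx => tendsto_site hab ⟨haα.trans hx.1, hx.2.trans hβb⟩) h
    (fun x hx t ht => tendsto_ulim (h.mono fun _ hN => hN.bddU x hx t ht))
    (fun x hx t ht => tendsto_ulim (h.mono fun _ hN => hN.bddV x hx t ht))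
    (fun x hx t ht => tendsto_ulim (h.mono fun _ hN => hN.bddW x hx t ht))

theorem DSeq.reg_global (hu : DSeq a b c M T f u) (hab : a < b) {τ : ℝ} (hτ : 0 < τ)
    (hτT : 2 * τ ≤ T) :
    ∃ C, Reg C a b (2 * τ) T id (limSol a b u) (limSolV a b u) (limSolW a b u) := by
  have hu0 := hu.sol 0
  obtain ⟨E, -, hE⟩ := exists_uniform_energy_bound (L := b - a) (T := T) (l := 0) (m := c)
    hu0.leM hu0.cpos hτ (by linarith) (by linarith)
  refine ⟨regConst E c M (b - a) ((b - a) / 4), limSol_reg hab le_rfl hab le_rfl hτT ?_⟩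
  filter_upwards [eventually_gridStep_le a b (ε := (b - a) / 8) (by linarith)] with N hN
  have := (hu.sol N).reg (a := a) (α := a) (β := b) (τ := 2 * τ) (E := E) (m := c)
    (σ := fun _ => 1) N.succ_pos le_rfl (by rw [gridStep_mul]; linarith) hab (by linarith)
    (by linarith) hτT hu0.cpos (fun _ _ => rfl)
    (fun j _ t ht => (hu.sol N).lower j t ⟨by linarith [ht.1], ht.2⟩)
    (fun t ht => hE _ _ _ _ _ _ (gridStep_mul a b N) (hu.sol N)
      (cutoffPair_one (hu.sol N) hτ.le) t ht)
  rwa [gridStep_mul] at this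

theorem exists_reg_local {a b M T α β δ m τ : ℝ} (hM : 1 ≤ M) (hδ : 0 < δ) (hm : 0 < m)
    (hτ : 0 < τ) (hτT : 2 * τ ≤ T) (haα : a ≤ α) (hαβ : α < β) (hβb : β ≤ b) :
    ∃ C, ∀ (c : ℝ) (f : ℝ → ℝ) (u : ℕ → ℕ → ℝ → ℝ), DSeq a b c M T f u →
      (∀ N j : ℕ, j < N + 1 → a + j * gridStep a b N ∈ Icc (α - 4 * δ) (β + 4 * δ) →
        ∀ t ∈ Icc 0 T, m ≤ u N j t) →
      Reg C α β (2 * τ) T id (limSol a b u) (limSolV a b u) (limSolW a b u) := by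
  have hab : a < b := haα.trans_lt (hαβ.trans_le hβb)
  obtain ⟨E, -, hE⟩ := exists_uniform_energy_bound (L := b - a) (T := T) (l := δ⁻¹) (m := m)
    hM hm hτ (by linarith) (by linarith)
  refine ⟨regConst E m M (b - a) ((β - α) / 4), fun c f u hu hlow =>
    limSol_reg hab haα hαβ hβb hτT ?_⟩
  filter_upwards [eventually_gridStep_le a b (ε := (β - α) / 8) (by linarith),
    eventually_gridStep_le a b (ε := δ / 2) (by linarith)] with N hN hN2
  have hp := gridStep_pos hab N
  have := (hu.sol N).reg (a := a) (α := α) (β := β) (τ := 2 * τ) (E := E) (m := m)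
    (σ := fun j => trapezoid (α - 2 * δ) (β + 2 * δ) δ (a + j * gridStep a b N))
    N.succ_pos haα (by rw [gridStep_mul]; linarith) hαβ (by linarith)
    (by linarith) hτT hm
    (fun j hj => trapezoid_eq_one hδ ⟨by linarith [hj.2.1], by linarith [hj.2.2]⟩)
    (fun j hj t ht => hlow N j hj.1 ⟨by linarith [hj.2.1], by linarith [hj.2.2]⟩ t
      ⟨by linarith [ht.1], ht.2⟩)
    (fun t ht => hE _ _ _ _ _ _ (gridStep_mul a b N) (hu.sol N)
      (cutoffPair_trapezoid hp hδ (by linarith) hm fun j hj hjm s hs =>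
        hlow N j hj hjm s ⟨hτ.le.trans hs.1, hs.2⟩) t ht)
  rwa [gridStep_mul] at this

end

lemma exists_quadratic_modulus {a b : ℝ} {g : ℝ → ℝ} (hg : ContinuousOn g (Icc a b)) {ε : ℝ}
    (hε : 0 < ε) : ∃ K, 0 ≤ K ∧ ∀ s ∈ Icc a b, ∀ x ∈ Icc a b, |g x - g s| ≤ ε + K * (x - s) ^ 2 := by
  obtain ⟨M, hM⟩ := isCompact_Icc.exists_bound_of_continuousOn hg
  obtain ⟨δ, hδ, h⟩ := Metric.uniformContinuousOn_iff.1
    (isCompact_Icc.uniformContinuousOn_of_continuous hg) ε hε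
  refine ⟨2 * |M| / δ ^ 2, by positivity, fun s hs x hx => ?_⟩
  rcases lt_or_ge (dist x s) δ with hd | hd
  · have h1 := (h x hx s hs hd).le
    rw [Real.dist_eq] at h1
    have : 0 ≤ 2 * |M| / δ ^ 2 * (x - s) ^ 2 := by positivity
    linarith
  · have h1 := hM x hx
    have h2 := hM s hs
    rw [Real.norm_eq_abs] at h1 h2
    have h3 : |g x - g s| ≤ 2 * |M| := by
      have := abs_sub (g x) (g s)
      have := le_abs_self M
      linarith
    rw [Real.dist_eq] at hd
    have h4 : δ ^ 2 ≤ (x - s) ^ 2 := by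
      rw [← sq_abs (x - s)]
      gcongr
    have h5 : 2 * |M| ≤ 2 * |M| / δ ^ 2 * (x - s) ^ 2 := by
      rw [div_mul_eq_mul_div, le_div_iff₀ (by positivity)]
      gcongr
    linarith

/-- `w` stays close to the datum `f` for short times, with a quadratic barrier. -/
def InitBarrier (a b T : ℝ) (f : ℝ → ℝ) (w : ℝ → ℝ → ℝ) : Prop :=
  ∀ ε > 0, ∃ K Λ : ℝ, ∀ s ∈ Icc a b, ∀ x ∈ Icc a b, ∀ t ∈ Icc 0 T,
    |w x t - f s| ≤ ε + K * (x - s) ^ 2 + Λ * t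

section

variable {a b c M T : ℝ} {f : ℝ → ℝ} {w : ℝ → ℝ → ℝ}

lemma InitBarrier.initial (h : InitBarrier a b T f w) (hT : 0 ≤ T) {x : ℝ} (hx : x ∈ Icc a b) :
    w x 0 = f x := by
  have : |w x 0 - f x| ≤ 0 := by
    refine le_of_forall_pos_le_add fun ε hε => ?_
    obtain ⟨K, Λ, hK⟩ := h ε hε
    have := hK x hx x hx 0 ⟨le_rfl, hT⟩
    simpa using this
  have := abs_eq_zero.1 (le_antisymm this (abs_nonneg _))
  linarith

lemma InitBarrier.continuousWithinAt (h : InitBarrier a b T f w) (hT : 0 ≤ T) {x : ℝ}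
    (hx : x ∈ Icc a b) :
    ContinuousWithinAt (fun p : ℝ × ℝ => w p.1 p.2) (Icc a b ×ˢ Icc 0 T) (x, 0) := by
  rw [ContinuousWithinAt, h.initial hT hx, Metric.tendsto_nhds]
  intro ε hε
  obtain ⟨K, Λ, hK⟩ := h (ε / 2) (by linarith)
  have h1 : Tendsto (fun p : ℝ × ℝ => ε / 2 + K * (p.1 - x) ^ 2 + Λ * p.2) (𝓝 (x, 0))
      (𝓝 (ε / 2)) := by
    have : Continuous fun p : ℝ × ℝ => ε / 2 + K * (p.1 - x) ^ 2 + Λ * p.2 := by fun_prop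
    simpa using this.tendsto (x, 0)
  filter_upwards [(h1.eventually (gt_mem_nhds (by linarith : ε / 2 < ε))).filter_mono
    nhdsWithin_le_nhds, self_mem_nhdsWithin] with p hp hps
  rw [Real.dist_eq]
  exact (hK x hx p.1 hps.1 p.2 hps.2).trans_lt hp

lemma continuousOn_Ioc_of_Icc {S : Set ℝ} {F : ℝ × ℝ → ℝ}
    (h : ∀ τ > 0, 2 * τ ≤ T → ContinuousOn F (S ×ˢ Icc (2 * τ) T)) :
    ContinuousOn F (S ×ˢ Ioc 0 T) := by
  rintro ⟨x, t⟩ ⟨hx, ht⟩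
  have ht0 : 0 < t := ht.1
  have h1 := h (t / 4) (by linarith) (by linarith [ht.2]) (x, t)
    ⟨hx, by linarith, ht.2⟩
  refine h1.mono_of_mem_nhdsWithin ?_
  have h2 : {p : ℝ × ℝ | t / 2 < p.2} ∈ 𝓝 (x, t) :=
    (isOpen_lt continuous_const continuous_snd).mem_nhds (by
      change t / 2 < t
      linarith)
  filter_upwards [mem_nhdsWithin_of_mem_nhds h2, self_mem_nhdsWithin] with p hp hps
  have hp' : t / 2 < p.2 := hp
  exact ⟨hps.1, by linarith, hps.2.2⟩

lemma InitBarrier.continuousOn (h : InitBarrier a b T f w) (hT : 0 ≤ T)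
    (hw : ContinuousOn (fun p : ℝ × ℝ => w p.1 p.2) (Icc a b ×ˢ Ioc 0 T)) :
    ContinuousOn (fun p : ℝ × ℝ => w p.1 p.2) (Icc a b ×ˢ Icc 0 T) := by
  rintro ⟨x, t⟩ ⟨hx, ht⟩
  rcases ht.1.eq_or_lt with h0 | h0
  · dsimp only at h0
    subst h0
    exact h.continuousWithinAt hT hx
  · refine (hw (x, t) ⟨hx, h0, ht.2⟩).mono_of_mem_nhdsWithin ?_
    have h2 : {p : ℝ × ℝ | 0 < p.2} ∈ 𝓝 (x, t) :=
      (isOpen_lt continuous_const continuous_snd).mem_nhds h0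
    filter_upwards [mem_nhdsWithin_of_mem_nhds h2, self_mem_nhdsWithin] with p hp hps
    exact ⟨hps.1, hp, hps.2.2⟩

variable {u : ℕ → ℕ → ℝ → ℝ}

lemma grid_mem (hab : a < b) {N j : ℕ} (hj : j ≤ N + 1) : a + j * gridStep a b N ∈ Icc a b := by
  have hp := gridStep_pos hab N
  have hs := gridStep_mul a b N
  have h1 : 0 ≤ (j : ℝ) * gridStep a b N := by positivity
  have h2 : (j : ℝ) * gridStep a b N ≤ ((N + 1 : ℕ) : ℝ) * gridStep a b N :=
    mul_le_mul_of_nonneg_right (Nat.cast_le.2 hj) hp.le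
  constructor <;> linarith

lemma DSeq.limSol_mem (hu : DSeq a b c M T f u) (x : ℝ) {t : ℝ} (ht : t ∈ Icc 0 T) :
    limSol a b u x t ∈ Icc c M :=
  isClosed_Icc.mem_of_tendsto (hu.tendsto x ht)
    (Eventually.of_forall fun N => ⟨(hu.sol N).lower _ t ht, (hu.sol N).upper _ t ht⟩)

lemma DSeq.limSol_le (hu : DSeq a b c M T f u) (hab : a < b) (hT : 0 ≤ T) {A s K Λ : ℝ}
    (hK : 0 ≤ K) (hΛ : M * (2 * K + 1) < Λ) (hf : ∀ x ∈ Icc a b, f x ≤ A + K * (x - s) ^ 2)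
    {x t : ℝ} (hx : x ∈ Icc a b) (ht : t ∈ Icc 0 T) :
    limSol a b u x t ≤ A + K * (x - s) ^ 2 + Λ * t := by
  have h1 : Tendsto (fun N => A + K * (a + site a b N x * gridStep a b N - s) ^ 2 + Λ * t)
      (hyperfilter ℕ : Filter ℕ) (𝓝 (A + K * (x - s) ^ 2 + Λ * t)) :=
    (((((tendsto_site hab hx).sub_const s).pow 2).const_mul K).const_add A).add_const (Λ * t)
  refine le_of_tendsto_of_tendsto (hu.tendsto x ht) h1 (Eventually.of_forall fun N => ?_)
  refine (hu.sol N).upper_barrier hT hK hΛ (fun j hj => ?_) _ (site_lt a b N x).le t ht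
  rw [hu.init N j hj]
  exact hf _ (grid_mem hab hj)

lemma DSeq.le_limSol (hu : DSeq a b c M T f u) (hab : a < b) (hT : 0 ≤ T) {A s K Λ : ℝ}
    (hK : 0 ≤ K) (hΛ : M * (2 * K + M) < Λ) (hf : ∀ x ∈ Icc a b, A - K * (x - s) ^ 2 ≤ f x)
    {x t : ℝ} (hx : x ∈ Icc a b) (ht : t ∈ Icc 0 T) :
    A - K * (x - s) ^ 2 - Λ * t ≤ limSol a b u x t := by
  have h1 : Tendsto (fun N => A - K * (a + site a b N x * gridStep a b N - s) ^ 2 - Λ * t)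
      (hyperfilter ℕ : Filter ℕ) (𝓝 (A - K * (x - s) ^ 2 - Λ * t)) :=
    (((((tendsto_site hab hx).sub_const s).pow 2).const_mul K).const_sub A).sub_const (Λ * t)
  refine le_of_tendsto_of_tendsto h1 (hu.tendsto x ht) (Eventually.of_forall fun N => ?_)
  refine (hu.sol N).lower_barrier hT hK hΛ (fun j hj => ?_) _ (site_lt a b N x).le t ht
  rw [hu.init N j hj]
  exact hf _ (grid_mem hab hj)

lemma DSeq.exp_mul_le (hu : DSeq a b c M T f u) (hab : a < b) (hT : 0 ≤ T) {m s K Λ : ℝ}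
    (hK : 0 ≤ K) (hm : 0 ≤ m) (hΛ : 2 * K + m ≤ Λ)
    (hf : ∀ x ∈ Icc a b, m - K * (x - s) ^ 2 ≤ f x) (N j : ℕ) (hj : j ≤ N + 1) {t : ℝ}
    (ht : t ∈ Icc 0 T) :
    Real.exp (-(Λ * t)) * (m - K * (a + j * gridStep a b N - s) ^ 2) ≤ u N j t := by
  refine (hu.sol N).decay_barrier hT hK hm hΛ (fun j hj => ?_) _ hj t ht
  rw [hu.init N j hj]
  exact hf _ (grid_mem hab hj)

lemma DSeq.exp_mul_le_limSol (hu : DSeq a b c M T f u) (hab : a < b) (hT : 0 ≤ T) {m s K Λ : ℝ}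
    (hK : 0 ≤ K) (hm : 0 ≤ m) (hΛ : 2 * K + m ≤ Λ)
    (hf : ∀ x ∈ Icc a b, m - K * (x - s) ^ 2 ≤ f x) {x t : ℝ} (hx : x ∈ Icc a b)
    (ht : t ∈ Icc 0 T) :
    Real.exp (-(Λ * t)) * (m - K * (x - s) ^ 2) ≤ limSol a b u x t := by
  have h1 : Tendsto (fun N => Real.exp (-(Λ * t)) *
      (m - K * (a + site a b N x * gridStep a b N - s) ^ 2))
      (hyperfilter ℕ : Filter ℕ) (𝓝 (Real.exp (-(Λ * t)) * (m - K * (x - s) ^ 2))) :=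
    ((((((tendsto_site hab hx).sub_const s).pow 2).const_mul K).const_sub m)).const_mul _
  exact le_of_tendsto_of_tendsto h1 (hu.tendsto x ht) (Eventually.of_forall fun N =>
    hu.exp_mul_le hab hT hK hm hΛ hf N _ (site_lt a b N x).le ht)

/-- The short time barrier, with constants depending only on the modulus of continuity of the
datum and on the upper bound `M`. -/
lemma DSeq.abs_limSol_sub_le (hu : DSeq a b c M T f u) (hab : a < b) (hT : 0 ≤ T) {ε K : ℝ}
    (hK : 0 ≤ K) (hf : ∀ s ∈ Icc a b, ∀ x ∈ Icc a b, |f x - f s| ≤ ε + K * (x - s) ^ 2)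
    {s x t : ℝ} (hs : s ∈ Icc a b) (hx : x ∈ Icc a b) (ht : t ∈ Icc 0 T) :
    |limSol a b u x t - f s| ≤ ε + K * (x - s) ^ 2 + (M * (2 * K + M) + 1) * t := by
  have hM := (hu.sol 0).leM
  have hle : M * (2 * K + 1) ≤ M * (2 * K + M) := by gcongr
  have h1 := hu.limSol_le hab hT (A := f s + ε) (s := s) hK (Λ := M * (2 * K + M) + 1)
    (by linarith) (fun y hy => by linarith [(abs_le.1 (hf s hs y hy)).2]) hx ht
  have h2 := hu.le_limSol hab hT (A := f s - ε) (s := s) hK (Λ := M * (2 * K + M) + 1)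
    (by linarith) (fun y hy => by linarith [(abs_le.1 (hf s hs y hy)).1]) hx ht
  rw [abs_le]
  constructor <;> linarith

lemma DSeq.initBarrier (hu : DSeq a b c M T f u) (hab : a < b) (hT : 0 ≤ T)
    (hf : ContinuousOn f (Icc a b)) : InitBarrier a b T f (limSol a b u) := by
  intro ε hε
  obtain ⟨K, hK, h⟩ := exists_quadratic_modulus hf hε
  exact ⟨K, _, fun s hs x hx t ht => hu.abs_limSol_sub_le hab hT hK h hs hx ht⟩

lemma DSeq.limSol_left (hu : DSeq a b c M T f u) {t : ℝ} (ht : t ∈ Icc 0 T) :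
    limSol a b u a t = c := by
  have h1 : ∀ N, u N (site a b N a) t = c := fun N => by
    have : site a b N a = 0 := by simp [site, gridIndex]
    rw [this, (hu.sol N).left t ht]
  have h2 := hu.tendsto a ht
  simp only [h1] at h2
  exact tendsto_nhds_unique h2 tendsto_const_nhds

lemma site_right (hab : a < b) (N : ℕ) : site a b N b = N := by
  have : (b - a) / gridStep a b N = ((N + 1 : ℕ) : ℝ) := by
    rw [← gridStep_mul a b N, mul_div_cancel_right₀ _ (gridStep_pos hab N).ne']
  rw [site, gridIndex, this, Nat.floor_natCast]
  simp

lemma DSeq.limSol_right (hu : DSeq a b c M T f u) (hab : a < b) {t : ℝ} (ht : t ∈ Ioc 0 T) :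
    limSol a b u b t = c := by
  have ht' := Ioc_subset_Icc_self ht
  have hu0 := hu.sol 0
  have ht0 := ht.1
  obtain ⟨E, hE0, hE⟩ := exists_uniform_energy_bound (L := b - a) (T := T) (l := 0) (m := c)
    (τ := t / 2) hu0.leM hu0.cpos (by linarith) (by linarith [ht.2]) (by linarith)
  have h1 : ∀ N, |u N (site a b N b) t - c| ≤ √(E * gridStep a b N) := fun N => by
    have hp := gridStep_pos hab N
    have h2 := (hE _ _ _ _ _ _ (gridStep_mul a b N) (hu.sol N)
      (cutoffPair_one (hu.sol N) (by linarith)) t ⟨by linarith, ht.2⟩).1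
    have h3 : (u N (N + 1) t - u N N t) ^ 2 / gridStep a b N ≤ E := by
      refine le_trans ?_ h2
      exact Finset.single_le_sum
        (f := fun j => (u N (j + 1) t - u N j t) ^ 2 / gridStep a b N)
        (fun i _ => by positivity) (Finset.self_mem_range_succ N)
    rw [(hu.sol N).right (N + 1) le_rfl t ht', div_le_iff₀ hp] at h3
    rw [site_right hab, abs_sub_comm]
    exact Real.abs_le_sqrt h3
  have h4 : Tendsto (fun N => √(E * gridStep a b N)) atTop (𝓝 0) := by
    have := ((tendsto_gridStep a b).const_mul E).sqrt
    simpa using this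
  have h5 : Tendsto (fun N => u N (site a b N b) t) atTop (𝓝 c) := by
    rw [tendsto_iff_dist_tendsto_zero]
    exact squeeze_zero (fun _ => dist_nonneg) (fun N => by rw [Real.dist_eq]; exact h1 N) h4
  exact tendsto_nhds_unique (hu.tendsto b ht') (h5.mono_left Nat.hyperfilter_le_atTop)

theorem DSeq.isApproxSol (hu : DSeq a b c M T f u) (hab : a < b) (hT : 0 < T)
    (hf : ContinuousOn f (Icc a b)) : IsApproxSol a b T c f (limSol a b u) := by
  have hreg : ∀ τ > 0, 2 * τ ≤ T → ∃ C, Reg C a b (2 * τ) T id (limSol a b u)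
      (limSolV a b u) (limSolW a b u) := fun τ hτ hτT => hu.reg_global hab hτ hτT
  have hU : ContinuousOn (fun p : ℝ × ℝ => limSol a b u p.1 p.2) (Icc a b ×ˢ Ioc 0 T) :=
    continuousOn_Ioc_of_Icc fun τ hτ hτT => by
      obtain ⟨C, hC⟩ := hreg τ hτ hτT
      exact (hC.continuousOn hab hτT).1
  have hV : ContinuousOn (fun p : ℝ × ℝ => limSolV a b u p.1 p.2) (Icc a b ×ˢ Ioc 0 T) :=
    continuousOn_Ioc_of_Icc fun τ hτ hτT => by
      obtain ⟨C, hC⟩ := hreg τ hτ hτT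
      exact (hC.continuousOn hab hτT).2.1
  have hW : ContinuousOn (fun p : ℝ × ℝ => limSolW a b u p.1 p.2) (Icc a b ×ˢ Ioc 0 T) :=
    continuousOn_Ioc_of_Icc fun τ hτ hτT => by
      obtain ⟨C, hC⟩ := hreg τ hτ hτT
      exact (hC.continuousOn hab hτT).2.2
  have hI := hu.initBarrier hab hT.le hf
  refine ⟨hI.continuousOn hT.le hU,
    fun t ht => ⟨hu.limSol_left (Ioc_subset_Icc_self ht), hu.limSol_right hab ht⟩,
    fun x hx => hI.initial hT.le hx, limSolV a b u, limSolW a b u,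
    fun x t => limSol a b u x t * (limSolW a b u x t + 1 - limSol a b u x t), hV, hW,
    hU.mul ((hW.add continuousOn_const).sub hU), fun x hx t ht => ?_, fun _ _ _ _ => rfl⟩
  have ht0 := ht.1
  obtain ⟨C, hC⟩ := hreg (t / 4) (by linarith) (by linarith [ht.2])
  have h1 := hC.hasDeriv_space hx (t := t) ⟨by linarith, ht.2⟩
  exact ⟨h1.1, h1.2, hC.hasDeriv_time hab hx ⟨by linarith, ht.2⟩⟩

end

lemma prod_mem_nhdsWithin {α β τ T x t : ℝ} (hx : x ∈ Ioo α β) (ht : t ∈ Ioc τ T) {S : Set (ℝ × ℝ)}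
    (hS : ∀ p ∈ S, p.2 ≤ T) : Icc α β ×ˢ Icc τ T ∈ 𝓝[S] (x, t) := by
  have h1 : Ioo α β ×ˢ Ioi τ ∈ 𝓝 (x, t) := (isOpen_Ioo.prod isOpen_Ioi).mem_nhds ⟨hx, ht.1⟩
  filter_upwards [mem_nhdsWithin_of_mem_nhds h1, self_mem_nhdsWithin] with p hp hpS
  exact ⟨Ioo_subset_Icc_self hp.1, le_of_lt hp.2, hS p hpS⟩

theorem isDegSol_of_reg {a b T : ℝ} {f : ℝ → ℝ} {u v w : ℝ → ℝ → ℝ} (hT : 0 < T)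
    (hI : InitBarrier a b T f u)
    (hreg : ∀ α β τ, a < α → α < β → β < b → 0 < τ → 2 * τ ≤ T →
      ∃ C, Reg C α β (2 * τ) T id u v w)
    (hpos : ∀ x ∈ Ioo a b, ∀ t ∈ Ioc 0 T, 0 < u x t)
    (hlat : ∀ t ∈ Ioc 0 T, u a t = 0 ∧ u b t = 0)
    (hlatc : ∀ t ∈ Ioc 0 T, ∀ x, x = a ∨ x = b →
      ContinuousWithinAt (fun p : ℝ × ℝ => u p.1 p.2) (Icc a b ×ˢ Icc 0 T) (x, t)) :
    IsDegSol a b T f u := by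
  have hloc : ∀ x ∈ Ioo a b, ∀ t ∈ Ioc 0 T, ∃ C α β τ, x ∈ Ioo α β ∧ t ∈ Ioc τ T ∧
      Reg C α β τ T id u v w := by
    intro x hx t ht
    have h1 := hx.1
    have h2 := hx.2
    have h3 := ht.1
    have h4 := ht.2
    obtain ⟨C, hC⟩ := hreg ((a + x) / 2) ((x + b) / 2) (t / 4) (by linarith) (by linarith)
      (by linarith) (by linarith) (by linarith)
    exact ⟨C, _, _, _, ⟨by linarith, by linarith⟩, ⟨by linarith, h4⟩, hC⟩
  have hder : ∀ x ∈ Ioo a b, ∀ t ∈ Ioc 0 T, HasDerivAt (fun y => u y t) (v x t) x ∧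
      HasDerivAt (fun y => v y t) (w x t) x ∧
      HasDerivWithinAt (fun s => u x s) (u x t * (w x t + 1 - u x t)) (Iic T) t := by
    intro x hx t ht
    obtain ⟨C, α, β, τ, hxα, htτ, hC⟩ := hloc x hx t ht
    have h1 := hC.hasDeriv_space (Ioo_subset_Icc_self hxα) (Ioc_subset_Icc_self htτ)
    exact ⟨h1.1.hasDerivAt (Icc_mem_nhds hxα.1 hxα.2), h1.2.hasDerivAt (Icc_mem_nhds hxα.1 hxα.2),
      hC.hasDeriv_time (hxα.1.trans hxα.2) (Ioo_subset_Icc_self hxα) htτ⟩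
  have hcont : ∀ x ∈ Ioo a b, ∀ t ∈ Ioc 0 T, ∀ S : Set (ℝ × ℝ), (∀ p ∈ S, p.2 ≤ T) →
      ContinuousWithinAt (fun p : ℝ × ℝ => u p.1 p.2) S (x, t) ∧
      ContinuousWithinAt (fun p : ℝ × ℝ => v p.1 p.2) S (x, t) ∧
      ContinuousWithinAt (fun p : ℝ × ℝ => w p.1 p.2) S (x, t) := by
    intro x hx t ht S hS
    obtain ⟨C, α, β, τ, hxα, htτ, hC⟩ := hloc x hx t ht
    obtain ⟨h1, h2, h3⟩ := hC.continuousOn (hxα.1.trans hxα.2) (htτ.1.le.trans htτ.2)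
    have hm : (x, t) ∈ Icc α β ×ˢ Icc τ T := ⟨Ioo_subset_Icc_self hxα, Ioc_subset_Icc_self htτ⟩
    have hn := prod_mem_nhdsWithin hxα htτ hS
    exact ⟨(h1 _ hm).mono_of_mem_nhdsWithin hn, (h2 _ hm).mono_of_mem_nhdsWithin hn,
      (h3 _ hm).mono_of_mem_nhdsWithin hn⟩
  have hd1 : ∀ x ∈ Ioo a b, ∀ t ∈ Ioc 0 T, deriv (fun z => u z t) x = v x t :=
    fun x hx t ht => (hder x hx t ht).1.deriv
  have hd2' : ∀ x ∈ Ioo a b, ∀ t ∈ Ioc 0 T,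
      HasDerivAt (fun y => deriv (fun z => u z t) y) (w x t) x := by
    intro x hx t ht
    refine (hder x hx t ht).2.1.congr_of_eventuallyEq ?_
    filter_upwards [Ioo_mem_nhds hx.1 hx.2] with y hy using hd1 y hy t ht
  have hd3 : ∀ x ∈ Ioo a b, ∀ t ∈ Ioc 0 T, derivWithin (fun s => u x s) (Iic T) t =
      u x t * (w x t + 1 - u x t) :=
    fun x hx t ht => (hder x hx t ht).2.2.derivWithin (uniqueDiffOn_Iic T t ht.2)
  have hQ : ∀ p ∈ QiSet a b T, p.2 ≤ T := fun p hp => hp.2.2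
  refine ⟨?_, hlat, fun x hx => hI.initial hT.le hx, hpos, fun x hx t ht => ⟨
    (hder x hx t ht).1.differentiableAt, (hd2' x hx t ht).differentiableAt,
    (hder x hx t ht).2.2.differentiableWithinAt, ?_⟩, ?_, ?_, ?_⟩
  · refine hI.continuousOn hT.le ?_
    rintro ⟨x, t⟩ ⟨hx, ht⟩
    have hsub : Icc a b ×ˢ Ioc 0 T ⊆ Icc a b ×ˢ Icc 0 T := prod_mono_right Ioc_subset_Icc_self
    by_cases hxl : x = a ∨ x = b
    · exact (hlatc t ht x hxl).mono hsub
    · rw [not_or] at hxl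
      exact (hcont x ⟨lt_of_le_of_ne hx.1 (Ne.symm hxl.1), lt_of_le_of_ne hx.2 hxl.2⟩ t ht _
        fun p hp => hp.2.2).1
  · rw [hd3 x hx t ht, (hd2' x hx t ht).deriv]
    ring
  · refine ContinuousOn.congr (f := fun p : ℝ × ℝ => v p.1 p.2)
      (fun p hp => (hcont p.1 hp.1 p.2 hp.2 _ hQ).2.1) fun p hp => hd1 p.1 hp.1 p.2 hp.2
  · refine ContinuousOn.congr (f := fun p : ℝ × ℝ => w p.1 p.2)
      (fun p hp => (hcont p.1 hp.1 p.2 hp.2 _ hQ).2.2) fun p hp => (hd2' p.1 hp.1 p.2 hp.2).deriv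
  · refine ContinuousOn.congr (f := fun p : ℝ × ℝ => u p.1 p.2 * (w p.1 p.2 + 1 - u p.1 p.2))
      (fun p hp => ?_) fun p hp => hd3 p.1 hp.1 p.2 hp.2
    have h1 := hcont p.1 hp.1 p.2 hp.2 _ hQ
    exact h1.1.mul ((h1.2.2.add continuousWithinAt_const).sub h1.1)

lemma exists_parabola_below {a b p q : ℝ} {g : ℝ → ℝ} (hg : ContinuousOn g (Icc a b))
    (hpos : ∀ x ∈ Ioo a b, 0 < g x) (hnn : ∀ x ∈ Icc a b, 0 ≤ g x) (hap : a < p) (hpq : p ≤ q)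
    (hqb : q < b) :
    ∃ m K : ℝ, 0 < m ∧ 0 ≤ K ∧ ∀ s ∈ Icc p q, ∀ x ∈ Icc a b, m - K * (x - s) ^ 2 ≤ g x := by
  obtain ⟨r, hr, hr1, hr2⟩ : ∃ r > 0, a < p - r ∧ q + r < b := by
    have h1 : 0 < min (p - a) (b - q) := lt_min (by linarith) (by linarith)
    have h2 := min_le_left (p - a) (b - q)
    have h3 := min_le_right (p - a) (b - q)
    exact ⟨min (p - a) (b - q) / 2, by linarith, by linarith, by linarith⟩
  have hsub : Icc (p - r) (q + r) ⊆ Ioo a b := fun y hy =>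
    ⟨hr1.trans_le hy.1, hy.2.trans_lt hr2⟩
  obtain ⟨y, hy, hmin⟩ := isCompact_Icc.exists_isMinOn (nonempty_Icc.2 (by linarith :
    p - r ≤ q + r)) (hg.mono (hsub.trans Ioo_subset_Icc_self))
  have hm := hpos y (hsub hy)
  refine ⟨g y, g y / r ^ 2, hm, by positivity, fun s hs x hx => ?_⟩
  rcases le_or_gt |x - s| r with h | h
  · have h1 : x ∈ Icc (p - r) (q + r) := by
      rw [abs_le] at h
      constructor <;> linarith [hs.1, hs.2]
    have h2 : g y ≤ g x := hmin h1
    have : 0 ≤ g y / r ^ 2 * (x - s) ^ 2 := by positivity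
    linarith
  · have h1 : r ^ 2 ≤ (x - s) ^ 2 := by
      rw [← sq_abs (x - s)]
      gcongr
    have h2 : g y ≤ g y / r ^ 2 * (x - s) ^ 2 := by
      rw [div_mul_eq_mul_div, le_div_iff₀ (by positivity)]
      gcongr
    linarith [hnn x hx]

section

variable {a b T M : ℝ} {g : ℝ → ℝ} {U : ℕ → ℕ → ℕ → ℝ → ℝ}

lemma exists_uniform_lower_bound (hab : a < b) (hT : 0 ≤ T) (hg : ContinuousOn g (Icc a b))
    (hpos : ∀ x ∈ Ioo a b, 0 < g x) (hnn : ∀ x ∈ Icc a b, 0 ≤ g x) {p q : ℝ} (hap : a < p)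
    (hpq : p ≤ q) (hqb : q < b) :
    ∃ m, 0 < m ∧ ∀ (c : ℝ) (f : ℝ → ℝ) (u : ℕ → ℕ → ℝ → ℝ), (∀ x ∈ Icc a b, g x ≤ f x) →
      DSeq a b c M T f u →
      (∀ N j : ℕ, j < N + 1 → a + j * gridStep a b N ∈ Icc p q → ∀ t ∈ Icc 0 T, m ≤ u N j t) ∧
      ∀ x ∈ Icc p q, ∀ t ∈ Icc 0 T, m ≤ limSol a b u x t := by
  obtain ⟨m, K, hm, hK, h⟩ := exists_parabola_below hg hpos hnn hap hpq hqb
  have hΛ : 0 ≤ 2 * K + m := by positivity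
  have hexp : ∀ t ∈ Icc 0 T, Real.exp (-((2 * K + m) * T)) ≤ Real.exp (-((2 * K + m) * t)) := by
    intro t ht
    rw [Real.exp_le_exp]
    have := mul_le_mul_of_nonneg_left ht.2 hΛ
    linarith
  refine ⟨Real.exp (-((2 * K + m) * T)) * m, by positivity, fun c f u hf hu =>
    ⟨fun N j hj hs t ht => ?_, fun x hx t ht => ?_⟩⟩
  · have := hu.exp_mul_le hab hT hK hm.le le_rfl (fun x hx => (h _ hs x hx).trans (hf x hx)) N j
      hj.le ht
    rw [sub_self, zero_pow two_ne_zero, mul_zero, sub_zero] at this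
    exact (mul_le_mul_of_nonneg_right (hexp t ht) hm.le).trans this
  · have := hu.exp_mul_le_limSol hab hT hK hm.le le_rfl
      (fun y hy => (h _ hx y hy).trans (hf y hy))
      (x := x) ⟨hap.le.trans hx.1, hx.2.trans hqb.le⟩ ht
    rw [sub_self, zero_pow two_ne_zero, mul_zero, sub_zero] at this
    exact (mul_le_mul_of_nonneg_right (hexp t ht) hm.le).trans this

theorem isDegSol_limit (hab : a < b) (hT : 0 < T) (hM : 1 ≤ M) (hg : ContinuousOn g (Icc a b))
    (hpos : ∀ x ∈ Ioo a b, 0 < g x) (hnn : ∀ x ∈ Icc a b, 0 ≤ g x)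
    (hU : ∀ n : ℕ, 0 < n → DSeq a b (1 / (n : ℝ)) M T (fun x => g x + 1 / (n : ℝ)) (U n))
    {u : ℝ → ℝ → ℝ}
    (hlim : ∀ x ∈ Icc a b, ∀ t ∈ Icc 0 T,
      Tendsto (fun n => limSol a b (U n) x t) atTop (𝓝 (u x t)))
    (hle : ∀ x ∈ Icc a b, ∀ t ∈ Icc 0 T, ∀ n : ℕ, 0 < n → u x t ≤ limSol a b (U n) x t) :
    IsDegSol a b T g u := by
  have hev : ∀ᶠ n : ℕ in atTop, 0 < n := eventually_gt_atTop 0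
  have hgf : ∀ n : ℕ, ∀ x ∈ Icc a b, g x ≤ g x + 1 / (n : ℝ) := fun n x _ => by
    have : 0 ≤ 1 / (n : ℝ) := by positivity
    linarith
  have hcn : Tendsto (fun n : ℕ => 1 / (n : ℝ)) atTop (𝓝 0) :=
    tendsto_const_div_atTop_nhds_zero_nat 1
  have hu0 : ∀ x ∈ Icc a b, ∀ t ∈ Icc 0 T, 0 ≤ u x t := fun x hx t ht =>
    ge_of_tendsto (hlim x hx t ht) (hev.mono fun n hn =>
      ((hU n hn).sol 0).cpos.le.trans ((hU n hn).limSol_mem x ht).1)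
  have ha : a ∈ Icc a b := ⟨le_rfl, hab.le⟩
  have hb : b ∈ Icc a b := ⟨hab.le, le_rfl⟩
  have happ : ∀ n : ℕ, 0 < n → IsApproxSol a b T (1 / (n : ℝ)) (fun x => g x + 1 / (n : ℝ))
      (limSol a b (U n)) := fun n hn =>
    (hU n hn).isApproxSol hab hT (hg.add continuousOn_const)
  have hlat : ∀ t ∈ Ioc 0 T, ∀ x, x = a ∨ x = b → ∀ n : ℕ, 0 < n →
      limSol a b (U n) x t = 1 / (n : ℝ) := by
    rintro t ht x (rfl | rfl) n hn
    exacts [((happ n hn).2.1 t ht).1, ((happ n hn).2.1 t ht).2]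
  have hlat0 : ∀ t ∈ Ioc 0 T, ∀ x, x = a ∨ x = b → u x t = 0 := by
    intro t ht x hx
    have hx' : x ∈ Icc a b := by
      rcases hx with rfl | rfl
      exacts [ha, hb]
    exact tendsto_nhds_unique (hlim x hx' t (Ioc_subset_Icc_self ht))
      (hcn.congr' (hev.mono fun n hn => (hlat t ht x hx n hn).symm))
  refine isDegSol_of_reg (v := fun x t => ulim fun n => limSolV a b (U n) x t)
    (w := fun x t => ulim fun n => limSolW a b (U n) x t) hT ?_ ?_ ?_
    (fun t ht => ⟨hlat0 t ht a (Or.inl rfl), hlat0 t ht b (Or.inr rfl)⟩) ?_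
  · intro ε hε
    obtain ⟨K, hK, h⟩ := exists_quadratic_modulus hg hε
    refine ⟨K, M * (2 * K + M) + 1, fun s hs x hx t ht => ?_⟩
    refine le_of_tendsto (x := atTop) (f := fun n : ℕ => |limSol a b (U n) x t -
      (g s + 1 / (n : ℝ))|) ?_ (hev.mono fun n hn => ?_) (b := ε + K * (x - s) ^ 2 +
        (M * (2 * K + M) + 1) * t)
    · have := ((hlim x hx t ht).sub (hcn.const_add (g s))).abs
      rwa [add_zero] at this
    · refine (hU n hn).abs_limSol_sub_le hab hT.le hK (fun s hs x hx => ?_) hs hx ht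
      rw [add_sub_add_right_eq_sub]
      exact h s hs x hx
  · intro α β τ haα hαβ hβb hτ hτT
    obtain ⟨δ, hδ, hδ1, hδ2⟩ : ∃ δ > 0, a < α - 4 * δ ∧ β + 4 * δ < b := by
      have h1 : 0 < min (α - a) (b - β) := lt_min (by linarith) (by linarith)
      have h2 := min_le_left (α - a) (b - β)
      have h3 := min_le_right (α - a) (b - β)
      exact ⟨min (α - a) (b - β) / 8, by linarith, by linarith, by linarith⟩
    obtain ⟨m, hm, hlow⟩ := exists_uniform_lower_bound (M := M) hab hT.le hg hpos hnn hδ1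
      (by linarith) hδ2
    obtain ⟨C, hC⟩ := exists_reg_local hM hδ hm hτ hτT haα.le hαβ hβb.le
    have hev' : ∀ᶠ n : ℕ in (hyperfilter ℕ : Filter ℕ), Reg C α β (2 * τ) T id
        (limSol a b (U n)) (limSolV a b (U n)) (limSolW a b (U n)) :=
      (hev.filter_mono Nat.hyperfilter_le_atTop).mono fun n hn =>
        hC _ _ _ (hU n hn) (hlow _ _ _ (hgf n) (hU n hn)).1
    exact ⟨C, Reg.limit (X := fun _ => id) hαβ hτT (fun x _ => tendsto_const_nhds) hev'
      (fun x hx t ht => (hlim x ⟨haα.le.trans hx.1, hx.2.trans hβb.le⟩ t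
        ⟨by linarith [ht.1], ht.2⟩).mono_left Nat.hyperfilter_le_atTop)
      (fun x hx t ht => tendsto_ulim (hev'.mono fun _ hN => hN.bddV x hx t ht))
      (fun x hx t ht => tendsto_ulim (hev'.mono fun _ hN => hN.bddW x hx t ht))⟩
  · intro x hx t ht
    obtain ⟨m, hm, hlow⟩ := exists_uniform_lower_bound (M := M) hab hT.le hg hpos hnn hx.1
      le_rfl hx.2
    have ht' := Ioc_subset_Icc_self ht
    exact hm.trans_le (ge_of_tendsto (hlim x (Ioo_subset_Icc_self hx) t ht')
      (hev.mono fun n hn => (hlow _ _ _ (hgf n) (hU n hn)).2 x ⟨le_rfl, le_rfl⟩ t ht'))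
  · intro t ht x hx
    have hx' : x ∈ Icc a b := by
      rcases hx with rfl | rfl
      exacts [ha, hb]
    rw [ContinuousWithinAt, hlat0 t ht x hx, Metric.tendsto_nhds]
    intro ε hε
    obtain ⟨n, hn, hn0⟩ := ((hcn.eventually (gt_mem_nhds hε)).and hev).exists
    have h1 := (happ n hn0).1 (x, t) ⟨hx', Ioc_subset_Icc_self ht⟩
    rw [ContinuousWithinAt, hlat t ht x hx n hn0] at h1
    filter_upwards [h1.eventually (gt_mem_nhds hn), self_mem_nhdsWithin] with p hp hps
    rw [Real.dist_eq, sub_zero, abs_of_nonneg (hu0 p.1 hps.1 p.2 hps.2)]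
    exact (hle p.1 hps.1 p.2 hps.2 n hn0).trans_lt hp

end

/-- Lemma 8.1: the approximating problems (8.45) have unique solutions `u_{i,n}`,
pointwise decreasing in `n`, whose pointwise limit `u_i` is the unique positive
classical solution of the degenerate problem (8.44). -/
theorem stmt14 (xi xip T : ℝ) (h : xi < xip) (hT : 0 < T)
    (u₀ : ℝ → ℝ) (h₀c : ContinuousOn u₀ (Set.Icc xi xip))
    (h₀pos : ∀ x ∈ Set.Ioo xi xip, 0 < u₀ x)
    (h₀i : u₀ xi = 0) (h₀ip : u₀ xip = 0) :
    ∃ uin : ℕ → ℝ → ℝ → ℝ,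
      (∀ n : ℕ, 0 < n →
        IsApproxSol xi xip T (1 / (n:ℝ)) (fun x => u₀ x + 1 / (n:ℝ)) (uin n) ∧
        ∀ v : ℝ → ℝ → ℝ,
          IsApproxSol xi xip T (1 / (n:ℝ)) (fun x => u₀ x + 1 / (n:ℝ)) v →
          ∀ x ∈ Set.Icc xi xip, ∀ t ∈ Set.Icc (0:ℝ) T, v x t = uin n x t) ∧
      (∀ n : ℕ, 0 < n → ∀ x ∈ Set.Icc xi xip, ∀ t ∈ Set.Icc (0:ℝ) T,
        uin (n + 1) x t ≤ uin n x t) ∧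
      ∃ ui : ℝ → ℝ → ℝ,
        (∀ x ∈ Set.Icc xi xip, ∀ t ∈ Set.Icc (0:ℝ) T,
          Tendsto (fun n => uin n x t) atTop (𝓝 (ui x t))) ∧
        IsDegSol xi xip T u₀ ui ∧
        ∀ v : ℝ → ℝ → ℝ, IsDegSol xi xip T u₀ v →
          ∀ x ∈ Set.Icc xi xip, ∀ t ∈ Set.Icc (0:ℝ) T, v x t = ui x t := by
  have hnn : ∀ x ∈ Icc xi xip, 0 ≤ u₀ x := by
    intro x hx
    rcases eq_or_lt_of_le hx.1 with rfl | h1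
    · exact h₀i.ge
    rcases eq_or_lt_of_le hx.2 with rfl | h2
    · exact h₀ip.ge
    exact (h₀pos x ⟨h1, h2⟩).le
  obtain ⟨B, hB⟩ := isCompact_Icc.exists_bound_of_continuousOn h₀c
  have hB0 : 0 ≤ B := (norm_nonneg _).trans (hB xi (left_mem_Icc.2 h.le))
  have hM : 1 ≤ B + 1 := by linarith
  have hc0 : ∀ n : ℕ, 0 < n → 0 < 1 / (n : ℝ) := fun n hn => by positivity
  have hc1 : ∀ n : ℕ, 0 < n → 1 / (n : ℝ) ≤ 1 := fun n hn => by
    rw [div_le_one (by positivity)]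
    exact_mod_cast hn
  have hge : ∀ n : ℕ, ∀ x ∈ Icc xi xip, 1 / (n : ℝ) ≤ u₀ x + 1 / (n : ℝ) := fun n x hx => by
    linarith [hnn x hx]
  have hex : ∀ n : ℕ, ∃ u, 0 < n →
      DSeq xi xip (1 / (n : ℝ)) (B + 1) T (fun x => u₀ x + 1 / (n : ℝ)) u := by
    intro n
    rcases n.eq_zero_or_pos with rfl | hn
    · exact ⟨fun _ _ _ => 0, fun h => absurd h (lt_irrefl 0)⟩
    · obtain ⟨u, hu⟩ := exists_dSeq (f := fun x => u₀ x + 1 / (n : ℝ)) h (hc0 n hn) (hc1 n hn)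
        hM hT
        (fun x hx => ⟨hge n x hx, by
          linarith [hc1 n hn, (le_abs_self (u₀ x)).trans (hB x hx)]⟩)
        (by simp [h₀i]) (by simp [h₀ip])
      exact ⟨u, fun _ => hu⟩
  choose U hU using hex
  have happ : ∀ n : ℕ, 0 < n → IsApproxSol xi xip T (1 / (n : ℝ))
      (fun x => u₀ x + 1 / (n : ℝ)) (limSol xi xip (U n)) := fun n hn =>
    (hU n hn).isApproxSol h hT (h₀c.add continuousOn_const)
  have hcomp : ∀ m n : ℕ, 0 < m → 0 < n → 1 / (m : ℝ) ≤ 1 / (n : ℝ) → ∀ u v,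
      IsApproxSol xi xip T (1 / (m : ℝ)) (fun x => u₀ x + 1 / (m : ℝ)) u →
      IsApproxSol xi xip T (1 / (n : ℝ)) (fun x => u₀ x + 1 / (n : ℝ)) v →
      ∀ x ∈ Icc xi xip, ∀ t ∈ Icc (0 : ℝ) T, u x t ≤ v x t := by
    intro m n hm hn hmn u v hu hv
    exact hu.comparison h hT hv hmn (hc0 n hn) (hc1 n hn)
      (fun x _ => by simpa using hmn) (hge n)
      (by simp [h₀i]) (by simp [h₀ip]) (by simp [h₀i]) (by simp [h₀ip])
  have hmono : ∀ n : ℕ, 0 < n → ∀ x ∈ Icc xi xip, ∀ t ∈ Icc (0 : ℝ) T,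
      limSol xi xip (U (n + 1)) x t ≤ limSol xi xip (U n) x t := fun n hn =>
    hcomp (n + 1) n n.succ_pos hn
      (one_div_le_one_div_of_le (by positivity) (by push_cast; linarith)) _ _
      (happ _ n.succ_pos) (happ n hn)
  have hpos : ∀ n : ℕ, ∀ x, ∀ t ∈ Icc (0 : ℝ) T, 0 ≤ limSol xi xip (U (n + 1)) x t :=
    fun n x t ht => (hc0 _ n.succ_pos).le.trans ((hU _ n.succ_pos).limSol_mem x ht).1
  have hbdd : ∀ x, ∀ t ∈ Icc (0 : ℝ) T,
      BddBelow (range fun n : ℕ => limSol xi xip (U (n + 1)) x t) := fun x t ht =>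
    ⟨0, by rintro _ ⟨n, rfl⟩; exact hpos n x t ht⟩
  have hlim : ∀ x ∈ Icc xi xip, ∀ t ∈ Icc (0 : ℝ) T, Tendsto
      (fun n => limSol xi xip (U n) x t) atTop
      (𝓝 (⨅ n : ℕ, limSol xi xip (U (n + 1)) x t)) := fun x hx t ht =>
    (tendsto_add_atTop_iff_nat 1).1 (tendsto_atTop_ciInf
      (antitone_nat_of_succ_le fun n => hmono _ n.succ_pos x hx t ht) (hbdd x t ht))
  have hdeg : IsDegSol xi xip T u₀ fun x t => ⨅ n : ℕ, limSol xi xip (U (n + 1)) x t := by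
    refine isDegSol_limit h hT hM h₀c h₀pos hnn hU hlim fun x hx t ht n hn => ?_
    obtain ⟨k, rfl⟩ := Nat.exists_eq_succ_of_ne_zero hn.ne'
    exact ciInf_le (hbdd x t ht) k
  refine ⟨fun n => limSol xi xip (U n), fun n hn => ⟨happ n hn, fun v hv x hx t ht =>
    le_antisymm (hcomp n n hn hn le_rfl _ _ hv (happ n hn) x hx t ht)
      (hcomp n n hn hn le_rfl _ _ (happ n hn) hv x hx t ht)⟩, hmono, _, hlim, hdeg,
    fun v hv x hx t ht => ?_⟩
  refine hdeg.eq_of_le h hT h₀i h₀ip h₀pos hv (fun x hx t ht => ?_) x hx t ht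
  refine le_ciInf fun n => ?_
  exact hv.le_approx h hT (happ _ n.succ_pos) (hc0 _ n.succ_pos) (hc1 _ n.succ_pos)
    (fun x _ => by simpa using (hc0 _ n.succ_pos).le) (hge _) h₀i h₀ip
    (by simp [h₀i]) (by simp [h₀ip]) x hx t ht
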